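/- arXiv:2512.11765 — 3 statements merged into one kernel-verified Lean document; each statement's English description precedes it below -/
import Mathlib

section
/- Let n ≥ 2 be an integer, ρ > 0, T > 0, and θ > 0. Define 𝕘(t) := 1 − [ n(ρt+1)(n+1)·E + 2n·e^{ρt(n+1)/(n−1)} − (n−1) ] / D, where E := e^{ρT(n+1)/(n−1)} and D := n((ρT+1)(n+1)+2)·E − (n−1). Then V^{(N)}_0 = 1 for every N ≥ 2, and for every t ∈ (0,T] the sequence ( N·|V^{(N)}_t − 𝕘(t)| )_{N ≥ 2} is bounded; in particular V^{(N)}_t → 𝕘(t) as N → ∞ for every t ∈ (0,T], at rate 1/N. -/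
open Matrix Finset Filter

noncomputable section

/-- The matrix `Γ^θ`. -/
def Gam (ρ θ : ℝ) {N : ℕ} (t : Fin (N + 1) → ℝ) : Matrix (Fin (N + 1)) (Fin (N + 1)) ℝ :=
  Matrix.of (fun i j => Real.exp (-(ρ * |t i - t j|)) + (if i = j then 2 * θ else 0))

/-- The matrix `Γ̃`. -/
def GamT (ρ : ℝ) {N : ℕ} (t : Fin (N + 1) → ℝ) : Matrix (Fin (N + 1)) (Fin (N + 1)) ℝ :=
  Matrix.of (fun i j =>
    if i < j then 0 else if i = j then 1 / 2 else Real.exp (-(ρ * (t i - t j))))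

/-- The equidistant grid `t_k = kT/N`. -/
def egrid (T : ℝ) (N : ℕ) : Fin (N + 1) → ℝ := fun k => (k.val : ℝ) * T / (N : ℝ)

/-- `ν^{(N)} := (Γ^θ + (n−1)Γ̃)^{−1} 1` on the equidistant `N`-step grid. -/
def nuN (n N : ℕ) (ρ T θ : ℝ) : Fin (N + 1) → ℝ :=
  (Gam ρ θ (egrid T N) + ((n : ℝ) - 1) • GamT ρ (egrid T N))⁻¹.mulVec 1

/-- `ω^{(N)} := (Γ^θ − Γ̃)^{−1} 1` on the equidistant `N`-step grid. -/
def omN (N : ℕ) (ρ T θ : ℝ) : Fin (N + 1) → ℝ :=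
  (Gam ρ θ (egrid T N) - GamT ρ (egrid T N))⁻¹.mulVec 1

/-- `v^{(N)} := ν^{(N)} / (1^⊤ν^{(N)})`. -/
def vN (n N : ℕ) (ρ T θ : ℝ) : Fin (N + 1) → ℝ :=
  (1 / ∑ k, nuN n N ρ T θ k) • nuN n N ρ T θ

/-- `w^{(N)} := ω^{(N)} / (1^⊤ω^{(N)})`. -/
def wN (N : ℕ) (ρ T θ : ℝ) : Fin (N + 1) → ℝ :=
  (1 / ∑ k, omN N ρ T θ k) • omN N ρ T θ

/-- `V^{(N)}_t = 1 − Σ_{k=1}^{⌈Nt/T⌉} v_k` (paper index `k` is Lean index `k.val + 1`). -/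
def VN (n N : ℕ) (ρ T θ : ℝ) (t : ℝ) : ℝ :=
  1 - ∑ k : Fin (N + 1), (if k.val < ⌈(N : ℝ) * t / T⌉₊ then vN n N ρ T θ k else 0)

/-- `W^{(N)}_t = 1 − Σ_{k=1}^{⌈Nt/T⌉} w_k` (paper index `k` is Lean index `k.val + 1`). -/
def WN (N : ℕ) (ρ T θ : ℝ) (t : ℝ) : ℝ :=
  1 - ∑ k : Fin (N + 1), (if k.val < ⌈(N : ℝ) * t / T⌉₊ then wN N ρ T θ k else 0)


lemma aux_sumL (a z : ℝ) (i : ℕ) :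
    (z - a) * ∑ j ∈ range i, a ^ (i - j) * z ^ j = a * (z ^ i - a ^ i) := by
  induction i with
  | zero => simp
  | succ i ih =>
    have h : ∑ j ∈ range i, a ^ (i + 1 - j) * z ^ j = a * ∑ j ∈ range i, a ^ (i - j) * z ^ j := by
      rw [Finset.mul_sum]
      refine Finset.sum_congr rfl fun j hj => ?_
      have : j < i := Finset.mem_range.1 hj
      rw [show i + 1 - j = (i - j) + 1 by omega]; ring
    rw [Finset.sum_range_succ, h, Nat.add_sub_cancel_left]
    linear_combination a * ih

lemma aux_sumR (a z : ℝ) (i M : ℕ) :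
    (1 - a * z) * ∑ j ∈ range M, a ^ (j + 1) * z ^ (i + 1 + j)
      = a * z ^ (i + 1) - a ^ (M + 1) * z ^ (i + M + 1) := by
  induction M with
  | zero => simp
  | succ M ih =>
    rw [Finset.sum_range_succ, mul_add, ih]; ring

/-- entries -/
def ent (n κ a : ℝ) (i j : ℕ) : ℝ :=
  if j < i then n * a ^ (i - j) else if i = j then κ else a ^ (j - i)

lemma aux_split (n κ a : ℝ) (i M : ℕ) (f : ℕ → ℝ) :
    ∑ j ∈ range (i + M + 1), ent n κ a i j * f j
     = n * ∑ j ∈ range i, a ^ (i - j) * f j + κ * f i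
        + ∑ j ∈ range M, a ^ (j + 1) * f (i + 1 + j) := by
  rw [show i + M + 1 = (i + 1) + M by ring, Finset.sum_range_add, Finset.sum_range_succ,
    Finset.mul_sum]
  congr 1
  · congr 1
    · refine Finset.sum_congr rfl fun j hj => ?_
      have : j < i := Finset.mem_range.1 hj
      simp [ent, this]; ring
    · simp [ent]
  · refine Finset.sum_congr rfl fun j hj => ?_
    have h1 : ¬ (i + 1 + j < i) := by omega
    have h2 : ¬ (i = i + 1 + j) := by omega
    simp only [ent, h1, h2, if_false]
    rw [show i + 1 + j - i = j + 1 by omega]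

lemma aux_row (n κ a z : ℝ) (i M : ℕ) (h1 : z - a ≠ 0) (h2 : 1 - a * z ≠ 0) :
    ∑ j ∈ range (i + M + 1), ent n κ a i j * z ^ j
     = z ^ i * (n * a / (z - a) + κ + a * z / (1 - a * z)) - n * a ^ (i + 1) * (1 / (z - a))
        - a ^ (M + 1) * (z ^ (i + M + 1) / (1 - a * z)) := by
  rw [aux_split]
  have hL := aux_sumL a z i
  have hR := aux_sumR a z i M
  rw [mul_comm, ← eq_div_iff h1] at hL
  rw [mul_comm, ← eq_div_iff h2] at hR
  rw [hL, hR]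
  field_simp
  ring

lemma aux_solve (n κ a z1 z2 c0 c1 c2 : ℝ) (i M : ℕ)
    (ha : 1 - a ≠ 0) (h0 : c0 * ((n + 1) * a + κ * (1 - a)) = 1 - a)
    (h1 : z1 - a ≠ 0) (h1' : 1 - a * z1 ≠ 0) (h2 : z2 - a ≠ 0) (h2' : 1 - a * z2 ≠ 0)
    (hz1 : n * a * (1 - a * z1) + κ * (z1 - a) * (1 - a * z1) + a * z1 * (z1 - a) = 0)
    (hz2 : n * a * (1 - a * z2) + κ * (z2 - a) * (1 - a * z2) + a * z2 * (z2 - a) = 0)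
    (hp : c0 / (1 - a) + c1 / (z1 - a) + c2 / (z2 - a) = 0)
    (hq : c0 / (1 - a) + c1 * (z1 ^ (i + M + 1) / (1 - a * z1))
      + c2 * (z2 ^ (i + M + 1) / (1 - a * z2)) = 0) :
    ∑ j ∈ range (i + M + 1), ent n κ a i j * (c0 + c1 * z1 ^ j + c2 * z2 ^ j) = 1 := by
  have e : ∑ j ∈ range (i + M + 1), ent n κ a i j * (c0 + c1 * z1 ^ j + c2 * z2 ^ j)
      = c0 * ∑ j ∈ range (i + M + 1), ent n κ a i j * 1 ^ j
      + c1 * ∑ j ∈ range (i + M + 1), ent n κ a i j * z1 ^ j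
      + c2 * ∑ j ∈ range (i + M + 1), ent n κ a i j * z2 ^ j := by
    rw [Finset.mul_sum, Finset.mul_sum, Finset.mul_sum, ← Finset.sum_add_distrib,
      ← Finset.sum_add_distrib]
    refine Finset.sum_congr rfl fun j _ => ?_
    rw [one_pow]; ring
  rw [e, aux_row n κ a 1 i M ha (by simpa using ha), aux_row n κ a z1 i M h1 h1',
    aux_row n κ a z2 i M h2 h2']
  have s1 : n * a / (z1 - a) + κ + a * z1 / (1 - a * z1) = 0 := by
    field_simp; linear_combination hz1
  have s2 : n * a / (z2 - a) + κ + a * z2 / (1 - a * z2) = 0 := by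
    field_simp; linear_combination hz2
  have s0 : c0 * (n * a / (1 - a) + κ + a * 1 / (1 - a * 1)) = 1 := by
    rw [mul_one]; field_simp; linear_combination h0
  rw [s1, s2]
  simp only [one_pow, mul_one] at *
  linear_combination s0 - n * a ^ (i + 1) * hp - a ^ (M + 1) * hq

lemma aux_pos (a : ℝ) (ha : a ^ 2 ≤ 1) (x : ℕ → ℝ) (M : ℕ) :
    (∑ j ∈ range M, a ^ (M - j) * x j) ^ 2 ≤
      2 * ∑ i ∈ range M, x i * ∑ j ∈ range i, a ^ (i - j) * x j + ∑ i ∈ range M, x i ^ 2 := by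
  induction M with
  | zero => simp
  | succ i ih =>
    have h : ∑ j ∈ range i, a ^ (i + 1 - j) * x j = a * ∑ j ∈ range i, a ^ (i - j) * x j := by
      rw [Finset.mul_sum]
      refine Finset.sum_congr rfl fun j hj => ?_
      have : j < i := Finset.mem_range.1 hj
      rw [show i + 1 - j = (i - j) + 1 by omega]; ring
    rw [Finset.sum_range_succ, h, Nat.add_sub_cancel_left, Finset.sum_range_succ (fun i => x i * _),
      Finset.sum_range_succ (fun i => x i ^ 2)]
    set L := ∑ j ∈ range i, a ^ (i - j) * x j
    have : a ^ 2 * (L + x i) ^ 2 ≤ 1 * (L + x i) ^ 2 := by gcongr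
    nlinarith

lemma aux_quad (n κ a : ℝ) (ha : a ^ 2 ≤ 1) (hn : 0 ≤ n + 1) (x : ℕ → ℝ) (M : ℕ) :
    (κ - (n + 1) / 2) * ∑ i ∈ range M, x i ^ 2 ≤
      ∑ i ∈ range M, x i * ∑ j ∈ range M, ent n κ a i j * x j := by
  have key : ∑ i ∈ range M, x i * ∑ j ∈ range M, ent n κ a i j * x j =
      (n + 1) * ∑ i ∈ range M, x i * ∑ j ∈ range i, a ^ (i - j) * x j
        + κ * ∑ i ∈ range M, x i ^ 2 := by
    induction M with
    | zero => simp
    | succ M ih =>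
      rw [Finset.sum_range_succ, Finset.sum_range_succ (fun i => x i * ∑ j ∈ range i, _),
        Finset.sum_range_succ (fun i => x i ^ 2)]
      have e1 : ∑ i ∈ range M, x i * ∑ j ∈ range (M + 1), ent n κ a i j * x j
          = ∑ i ∈ range M, x i * ∑ j ∈ range M, ent n κ a i j * x j
           + x M * ∑ i ∈ range M, a ^ (M - i) * x i := by
        rw [Finset.mul_sum, ← Finset.sum_add_distrib]
        refine Finset.sum_congr rfl fun j hj => ?_
        have : j < M := Finset.mem_range.1 hj
        rw [Finset.sum_range_succ]
        simp only [ent, show ¬ M < j by omega, show ¬ j = M by omega, if_false]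
        ring
      have e2 := aux_split n κ a M 0 x
      simp only [Finset.range_zero, Finset.sum_empty, add_zero] at e2
      rw [e1, e2, ih]; ring
  rw [key]
  have := aux_pos a ha x M
  nlinarith [sq_nonneg (∑ j ∈ range M, a ^ (M - j) * x j)]

lemma aux_ent (n N : ℕ) (ρ T θ : ℝ) (hN : 0 < N) (hρ : 0 < ρ) (hT : 0 < T) (i j : Fin (N + 1)) :
    (Gam ρ θ (egrid T N) + ((n : ℝ) - 1) • GamT ρ (egrid T N)) i j
      = ent n (2 * θ + ((n : ℝ) + 1) / 2) (Real.exp (-(ρ * T / N))) i j := by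
  have hN' : (0 : ℝ) < N := by exact_mod_cast hN
  simp only [Matrix.add_apply, Matrix.smul_apply, Gam, GamT, Matrix.of_apply, ent, egrid,
    smul_eq_mul]
  rcases lt_trichotomy j i with h | h | h
  · have hv : (j : ℕ) < i := h
    have hc : ((i - j : ℕ) : ℝ) = (i : ℝ) - j := by push_cast [hv.le]; ring
    have hd : (i : ℝ) * T / N - (j : ℝ) * T / N = (i - j : ℕ) * (T / N) := by rw [hc]; ring
    rw [if_neg h.ne', if_neg (not_lt.2 h.le), if_neg h.ne', if_pos hv, hd, abs_of_nonneg (by positivity),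
      ← Real.exp_nat_mul]
    rw [show -(ρ * (((i - j : ℕ) : ℝ) * (T / N))) = ((i - j : ℕ) : ℝ) * -(ρ * T / N) by ring]
    ring
  · subst h; simp; ring
  · have hv : (i : ℕ) < j := h
    have hc : ((j - i : ℕ) : ℝ) = (j : ℝ) - i := by push_cast [hv.le]; ring
    have hd : (i : ℝ) * T / N - (j : ℝ) * T / N = -((j - i : ℕ) * (T / N)) := by rw [hc]; ring
    rw [if_neg h.ne, if_pos h, if_neg (by omega), if_neg (by omega), hd, abs_neg,
      abs_of_nonneg (by positivity), ← Real.exp_nat_mul]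
    rw [show -(ρ * (((j - i : ℕ) : ℝ) * (T / N))) = ((j - i : ℕ) : ℝ) * -(ρ * T / N) by ring]
    ring

lemma aux_nu (n N : ℕ) (ρ T θ : ℝ) (hN : 0 < N) (hρ : 0 < ρ) (hT : 0 < T) (hθ : 0 < θ)
    (f : ℕ → ℝ)
    (hf : ∀ i ≤ N, ∑ j ∈ range (N + 1),
      ent n (2 * θ + ((n : ℝ) + 1) / 2) (Real.exp (-(ρ * T / N))) i j * f j = 1)
    (k : Fin (N + 1)) : nuN n N ρ T θ k = f k := by
  set A := (Gam ρ θ (egrid T N) + ((n : ℝ) - 1) • GamT ρ (egrid T N)) with hA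
  have hent : ∀ i j, A i j = ent n (2 * θ + ((n : ℝ) + 1) / 2) (Real.exp (-(ρ * T / N))) i j :=
    aux_ent n N ρ T θ hN hρ hT
  have hmv : ∀ g : ℕ → ℝ, ∀ i : Fin (N + 1), A.mulVec (fun j => g j) i = ∑ j ∈ range (N + 1),
      ent n (2 * θ + ((n : ℝ) + 1) / 2) (Real.exp (-(ρ * T / N))) i j * g j := by
    intro g i
    rw [← Fin.sum_univ_eq_sum_range
      (fun j => ent n (2 * θ + ((n : ℝ) + 1) / 2) (Real.exp (-(ρ * T / N))) i j * g j)]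
    simp only [Matrix.mulVec, dotProduct, hent]
  have hinj : ∀ x : Fin (N + 1) → ℝ, A.mulVec x = 0 → x = 0 := by
    intro x hx
    set g : ℕ → ℝ := fun j => if h : j < N + 1 then x ⟨j, h⟩ else 0 with hg
    have hgx : (fun j : Fin (N + 1) => g j) = x := by
      funext j
      have hj := j.2
      simp only [hg, dif_pos hj]
    rw [← hgx] at hx
    have hle : Real.exp (-(ρ * T / N)) ≤ 1 := Real.exp_le_one_iff.2 (by
      have : 0 ≤ ρ * T / N := by positivity
      linarith)
    have hq := aux_quad n (2 * θ + ((n : ℝ) + 1) / 2) (Real.exp (-(ρ * T / N)))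
      (pow_le_one₀ (Real.exp_pos _).le hle) (by positivity) g (N + 1)
    have hz : ∑ i ∈ range (N + 1), g i * ∑ j ∈ range (N + 1),
        ent n (2 * θ + ((n : ℝ) + 1) / 2) (Real.exp (-(ρ * T / N))) i j * g j = 0 := by
      refine Finset.sum_eq_zero fun i hi => ?_
      have := hmv g ⟨i, Finset.mem_range.1 hi⟩
      rw [hx] at this
      simp only [Pi.zero_apply] at this
      rw [← this, mul_zero]
    rw [hz] at hq
    have hs : ∑ i ∈ range (N + 1), g i ^ 2 ≤ 0 := by
      by_contra hcon
      push Not at hcon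
      have : 0 < θ * ∑ i ∈ range (N + 1), g i ^ 2 := mul_pos hθ hcon
      nlinarith
    have hs0 := (Finset.sum_eq_zero_iff_of_nonneg (fun i _ => sq_nonneg (g i))).1
      (le_antisymm hs (Finset.sum_nonneg fun i _ => sq_nonneg (g i)))
    rw [← hgx]
    funext j
    have := hs0 j (Finset.mem_range.2 j.2)
    simpa using this
  have hunit : IsUnit A := by
    rw [← Matrix.mulVec_injective_iff_isUnit]
    intro x y hxy
    have : A.mulVec (x - y) = 0 := by
      rw [Matrix.mulVec_sub]; exact sub_eq_zero.2 hxy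
    exact sub_eq_zero.1 (hinj _ this)
  have hdet : IsUnit A.det := (Matrix.isUnit_iff_isUnit_det A).1 hunit
  have h1 : A.mulVec (fun j : Fin (N + 1) => f j) = 1 := by
    funext i
    rw [hmv, hf i (by omega)]; rfl
  have : nuN n N ρ T θ = fun j : Fin (N + 1) => f j := by
    unfold nuN
    rw [← hA, ← h1, Matrix.mulVec_mulVec, Matrix.nonsing_inv_mul A hdet, Matrix.one_mulVec]
  rw [this]

/-- first order approximation -/
def Ap (X : ℕ → ℝ) (x : ℝ) : Prop :=
  (fun N => X N - x) =O[atTop] (fun N : ℕ => ((N : ℝ))⁻¹)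

namespace Ap

lemma const (x : ℝ) : Ap (fun _ => x) x := by
  simp only [Ap, sub_self]; exact Asymptotics.isBigO_zero _ _

lemma congr {X Y : ℕ → ℝ} {x : ℝ} (h : Ap X x) (e : ∀ᶠ N in atTop, X N = Y N) : Ap Y x := by
  refine Asymptotics.IsBigO.congr' h ?_ EventuallyEq.rfl
  filter_upwards [e] with N hN
  rw [hN]

lemma tendsto {X : ℕ → ℝ} {x : ℝ} (h : Ap X x) : Tendsto X atTop (nhds x) := by
  have h0 := h.trans_tendsto (tendsto_inv_atTop_nhds_zero_nat (𝕜 := ℝ))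
  have := h0.add_const x
  simpa using this

lemma add {X Y : ℕ → ℝ} {x y : ℝ} (hX : Ap X x) (hY : Ap Y y) : Ap (fun N => X N + Y N) (x + y) := by
  refine (Asymptotics.IsBigO.add hX hY).congr_left fun N => ?_
  ring

lemma sub {X Y : ℕ → ℝ} {x y : ℝ} (hX : Ap X x) (hY : Ap Y y) : Ap (fun N => X N - Y N) (x - y) := by
  refine (Asymptotics.IsBigO.sub hX hY).congr_left fun N => ?_
  ring

lemma mul {X Y : ℕ → ℝ} {x y : ℝ} (hX : Ap X x) (hY : Ap Y y) : Ap (fun N => X N * Y N) (x * y) := by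
  have h1 : (fun N => (X N - x) * Y N) =O[atTop] (fun N : ℕ => ((N : ℝ))⁻¹ * 1) :=
    Asymptotics.IsBigO.mul hX (hY.tendsto.isBigO_one ℝ)
  have h2 : (fun N => x * (Y N - y)) =O[atTop] (fun N : ℕ => ((N : ℝ))⁻¹) :=
    Asymptotics.IsBigO.const_mul_left hY x
  simp only [mul_one] at h1
  refine (h1.add h2).congr_left fun N => ?_
  ring

lemma comp {X : ℕ → ℝ} {x : ℝ} (f : ℝ → ℝ) (hf : DifferentiableAt ℝ f x) (hX : Ap X x) :
    Ap (fun N => f (X N)) (f x) := by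
  have := (hf.isBigO_sub.comp_tendsto hX.tendsto)
  exact Asymptotics.IsBigO.trans this hX

lemma inv {X : ℕ → ℝ} {x : ℝ} (hX : Ap X x) (hx : x ≠ 0) : Ap (fun N => (X N)⁻¹) x⁻¹ :=
  comp (fun y => y⁻¹) (differentiableAt_inv hx) hX

lemma div {X Y : ℕ → ℝ} {x y : ℝ} (hX : Ap X x) (hY : Ap Y y) (hy : y ≠ 0) :
    Ap (fun N => X N / Y N) (x / y) := by
  simp only [div_eq_mul_inv]; exact hX.mul (hY.inv hy)

lemma ne {X : ℕ → ℝ} {x : ℝ} (hX : Ap X x) (hx : x ≠ 0) : ∀ᶠ N in atTop, X N ≠ 0 :=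
  hX.tendsto.eventually_ne hx

lemma small {X : ℕ → ℝ} {l : ℝ} (hX : Ap (fun N => N * X N) l) : Ap X 0 := by
  have h1 : (fun N : ℕ => (N : ℝ)⁻¹ * (N * X N)) =O[atTop] (fun N : ℕ => ((N : ℝ))⁻¹ * 1) :=
    (Asymptotics.isBigO_refl _ _).mul (hX.tendsto.isBigO_one ℝ)
  simp only [mul_one] at h1
  refine Asymptotics.IsBigO.congr' h1 ?_ EventuallyEq.rfl
  filter_upwards [eventually_gt_atTop 0] with N hN
  have : (N : ℝ) ≠ 0 := by positivity
  field_simp; ring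

lemma nlin {X : ℕ → ℝ} {l : ℝ} (F : ℝ → ℝ) (C : ℝ)
    (hF : ∀ᶠ x in nhds (0 : ℝ), |F x - x| ≤ C * x ^ 2)
    (hX : Ap (fun N => N * X N) l) : Ap (fun N => N * F (X N)) l := by
  have h0 : Ap (fun N => (N * (F (X N) - X N))) 0 := by
    have hb : (fun N : ℕ => (N * X N) * (N * X N) * (N : ℝ)⁻¹) =O[atTop]
        (fun N : ℕ => 1 * 1 * ((N : ℝ))⁻¹) :=
      ((hX.tendsto.isBigO_one ℝ).mul (hX.tendsto.isBigO_one ℝ)).mul (Asymptotics.isBigO_refl _ _)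
    simp only [mul_one, one_mul] at hb
    refine Asymptotics.IsBigO.trans (Asymptotics.IsBigO.of_bound C ?_) hb
    filter_upwards [hX.small.tendsto.eventually hF, eventually_gt_atTop 0] with N hN hpos
    have hp : (0 : ℝ) < N := by exact_mod_cast hpos
    have e : (N * X N) * (N * X N) * (N : ℝ)⁻¹ = N * (X N) ^ 2 := by field_simp
    rw [e, sub_zero, norm_mul, Real.norm_of_nonneg hp.le, Real.norm_eq_abs, Real.norm_of_nonneg (by positivity)]
    nlinarith
  have := h0.add hX
  rw [zero_add] at this
  refine this.congr (Eventually.of_forall fun N => ?_)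
  ring

lemma oneN : Ap (fun N : ℕ => (N : ℝ)⁻¹) 0 := by
  simp only [Ap, sub_zero]; exact Asymptotics.isBigO_refl _ _

lemma expN (h : ℝ) : Ap (fun N : ℕ => N * (1 - Real.exp (-(h / N)))) h := by
  refine nlin (X := fun N : ℕ => h / N) (fun x => 1 - Real.exp (-x)) 1 ?_ ?_
  · filter_upwards [Metric.ball_mem_nhds (0 : ℝ) one_pos] with x hx
    have hx1 : |(-x)| ≤ 1 := by
      rw [abs_neg]; simpa using (Metric.mem_ball.1 hx).le
    have := Real.abs_exp_sub_one_sub_id_le hx1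
    rw [← abs_neg]
    convert this using 2
    · ring
    · ring
  · refine (const h).congr ?_
    filter_upwards [eventually_gt_atTop 0] with N hN
    have : (N : ℝ) ≠ 0 := by positivity
    field_simp

lemma logN {z : ℕ → ℝ} {l : ℝ} (hz : Ap (fun N => N * (z N - 1)) l) :
    Ap (fun N => N * Real.log (z N)) l := by
  have := nlin (X := fun N : ℕ => z N - 1) (fun x => Real.log (1 + x)) 2 ?_ hz
  · simpa using this
  · filter_upwards [Metric.ball_mem_nhds (0 : ℝ) (show (0 : ℝ) < 1 / 2 by norm_num)] with x hx
    have hx1 : |x| < 1 / 2 := by simpa using (Metric.mem_ball.1 hx)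
    rw [abs_lt] at hx1
    have hp : 0 < 1 + x := by linarith
    have h1 := Real.log_le_sub_one_of_pos hp
    have h2 := Real.one_sub_inv_le_log_of_pos hp
    have h3 : 1 - (1 + x)⁻¹ = x - x ^ 2 / (1 + x) := by field_simp; ring
    have h4 : x ^ 2 / (1 + x) ≤ 2 * x ^ 2 := by
      rw [div_le_iff₀ hp]; nlinarith [sq_nonneg x]
    rw [abs_le]; constructor <;> linarith [sq_nonneg x]

lemma powN {z : ℕ → ℝ} {l τ : ℝ} (k : ℕ → ℕ) (hz : Ap (fun N => N * (z N - 1)) l)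
    (hk : Ap (fun N => (k N : ℝ) / N) τ) : Ap (fun N => z N ^ k N) (Real.exp (τ * l)) := by
  have h := comp Real.exp Real.differentiable_exp.differentiableAt (hk.mul hz.logN)
  refine h.congr ?_
  have h1 := (hz.small.tendsto).eventually (Metric.ball_mem_nhds (0 : ℝ) one_pos)
  filter_upwards [h1, eventually_gt_atTop 0] with N hN hpos
  have hp : (N : ℝ) ≠ 0 := by positivity
  have hx1 : |z N - 1| < 1 := by simpa using hN
  rw [abs_lt] at hx1
  have hz0 : 0 < z N := by linarith
  rw [show (k N : ℝ) / N * (N * Real.log (z N)) = k N * Real.log (z N) by field_simp,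
    Real.exp_nat_mul, Real.exp_log hz0]

lemma pow_zero' {z : ℕ → ℝ} {m τ : ℝ} (k : ℕ → ℕ) (hm : |m| < 1) (hτ : 0 < τ) (hz : Ap z m)
    (hk : Ap (fun N => (k N : ℝ) / N) τ) : Ap (fun N => z N ^ k N) 0 := by
  obtain ⟨r, hr1, hr2⟩ := exists_between hm
  have hr0 : 0 ≤ r := (abs_nonneg m).trans hr1.le
  have hkt : ∀ᶠ N : ℕ in atTop, τ / 2 < (k N : ℝ) / N :=
    hk.tendsto.eventually (lt_mem_nhds (by linarith))
  have hzr : ∀ᶠ N : ℕ in atTop, |z N| < r := hz.tendsto.abs.eventually (gt_mem_nhds hr1)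
  obtain ⟨C, hC⟩ : ∃ C : ℝ, ∀ j : ℕ, (j : ℝ) * r ^ j ≤ C := by
    obtain ⟨C, hC⟩ := (tendsto_self_mul_const_pow_of_lt_one hr0 hr2).bddAbove_range
    exact ⟨C, fun j => hC ⟨j, rfl⟩⟩
  refine Asymptotics.IsBigO.of_bound (2 / τ * C) ?_
  filter_upwards [hkt, hzr, eventually_gt_atTop 0] with N h1 h2 hpos
  have hp : (0 : ℝ) < N := by exact_mod_cast hpos
  rw [sub_zero, norm_pow, Real.norm_eq_abs, Real.norm_of_nonneg (by positivity)]
  have h3 : |z N| ^ k N ≤ r ^ k N := by gcongr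
  rw [lt_div_iff₀ hp] at h1
  have h4 := hC (k N)
  rw [← div_eq_mul_inv, le_div_iff₀ hp, div_mul_eq_mul_div, le_div_iff₀ hτ]
  have h5 : 0 ≤ r ^ k N := by positivity
  calc |z N| ^ k N * N * τ ≤ r ^ k N * N * τ := by gcongr
    _ = 2 * (r ^ k N * (τ / 2 * N)) := by ring
    _ ≤ 2 * (r ^ k N * k N) := by gcongr
    _ ≤ 2 * C := by linarith

end Ap

lemma aux_geom (c0 c1 c2 z1 z2 : ℝ) (k : ℕ) (h1 : z1 - 1 ≠ 0) (h2 : 1 - z2 ≠ 0) :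
    ∑ j ∈ range k, (c0 + c1 * z1 ^ j + c2 * z2 ^ j)
      = c0 * k + c1 * ((z1 ^ k - 1) / (z1 - 1)) + c2 * ((1 - z2 ^ k) / (1 - z2)) := by
  rw [Finset.sum_add_distrib, Finset.sum_add_distrib, ← Finset.mul_sum, ← Finset.mul_sum,
    geom_sum_eq (sub_ne_zero.1 h1), geom_sum_eq (sub_ne_zero.1 h2).symm]
  rw [← neg_sub (1 : ℝ) (z2 ^ k), ← neg_sub (1 : ℝ) z2, neg_div_neg_eq]
  simp; ring

lemma aux_VN (n N : ℕ) (ρ T θ t : ℝ) (f : ℕ → ℝ) (hf : ∀ k : Fin (N + 1), nuN n N ρ T θ k = f k)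
    (hk : ⌈(N : ℝ) * t / T⌉₊ ≤ N + 1) :
    VN n N ρ T θ t = 1 - (∑ j ∈ range ⌈(N : ℝ) * t / T⌉₊, f j) / ∑ j ∈ range (N + 1), f j := by
  unfold VN vN
  simp only [Pi.smul_apply, smul_eq_mul, hf]
  rw [Fin.sum_univ_eq_sum_range f,
    Fin.sum_univ_eq_sum_range (fun j => if j < ⌈(N : ℝ) * t / T⌉₊ then
      1 / (∑ j ∈ range (N + 1), f j) * f j else 0), ← Finset.sum_filter, ← Finset.mul_sum]
  rw [show (range (N + 1)).filter (fun j => j < ⌈(N : ℝ) * t / T⌉₊) = range ⌈(N : ℝ) * t / T⌉₊ by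
    ext j; simp; omega]
  ring

lemma Ap.named {X : ℕ → ℝ} {x : ℝ} (h : Ap X x) : ∃ C : ℕ → ℝ, C = X ∧ Ap C x := ⟨X, rfl, h⟩

lemma aux_lim (r lam x m E e τ : ℝ) (hr : 0 < r) (hx : 2 ≤ x)
    (hl : lam = r * (x + 1) / (x - 1)) (hm : m - 1 ≠ 0) (hE : 0 < E) (C0 Δ : ℝ)
    (hC0 : C0 = r / (x + 1))
    (hΔ : Δ = 1 / (lam + r) * (0 / (1 - m)) - 1 / (m - 1) * (E / (r - lam))) :
    C0 * τ + C0 * (1 / (m - 1) * (1 / r) - 1 / r * (0 / (1 - m))) / Δ * ((e - 1) / lam)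
      + C0 * (1 / r * (E / (r - lam)) - 1 / (lam + r) * (1 / r)) / Δ * ((1 - 0) / (1 - m))
    = (x * (r * τ + 1) * (x + 1) * E + 2 * x * e - (x - 1)) / (x * (x + 1) ^ 2 * E) := by
  have h1 : x - 1 ≠ 0 := by linarith
  have h2 : x + 1 ≠ 0 := by linarith
  have h0 : x ≠ 0 := by linarith
  have hm' : 1 - m ≠ 0 := fun h => hm (by linarith)
  have e1 : lam + r = 2 * r * x / (x - 1) := by rw [hl]; field_simp; ring
  have e2 : r - lam = -(2 * r) / (x - 1) := by rw [hl]; field_simp; ring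
  have hD : Δ = E * (x - 1) / ((m - 1) * (2 * r)) := by
    rw [hΔ, e2]; field_simp; ring
  rw [hD, e1, e2, hC0, hl, show 1 - m = -(m - 1) by ring]
  field_simp
  ring

lemma aux_main (n : ℕ) (hn : 2 ≤ n) (ρ T θ : ℝ) (hρ : 0 < ρ) (hT : 0 < T) (hθ : 0 < θ)
    (E : ℝ) (hE : E = Real.exp (ρ * T * ((n : ℝ) + 1) / ((n : ℝ) - 1))) :
    ∃ f : ℕ → ℕ → ℝ, (∀ᶠ N : ℕ in atTop, ∀ k : Fin (N + 1), nuN n N ρ T θ k = f N k) ∧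
      ∀ (k : ℕ → ℕ) (τ : ℝ), 0 < τ → Ap (fun N => (k N : ℝ) / N) τ →
        Ap (fun N => ∑ j ∈ range (k N), f N j)
          (((n : ℝ) * (ρ * T * τ + 1) * ((n : ℝ) + 1) * E
            + 2 * (n : ℝ) * Real.exp (τ * (ρ * T * ((n : ℝ) + 1) / ((n : ℝ) - 1)))
            - ((n : ℝ) - 1)) / ((n : ℝ) * ((n : ℝ) + 1) ^ 2 * E)) := by
  have hx : (2 : ℝ) ≤ n := by exact_mod_cast hn
  obtain ⟨x, hxn⟩ : ∃ x : ℝ, x = n := ⟨_, rfl⟩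
  rw [← hxn] at hx hE ⊢
  have hr : 0 < ρ * T := mul_pos hρ hT
  obtain ⟨r, hrr⟩ : ∃ r, r = ρ * T := ⟨_, rfl⟩
  rw [← hrr] at hr hE ⊢
  obtain ⟨κ, hκ⟩ : ∃ κ, κ = 2 * θ + (x + 1) / 2 := ⟨_, rfl⟩
  have hκ1 : 0 < κ - 1 := by linarith
  obtain ⟨m, hm⟩ : ∃ m, m = (κ - x) / (κ - 1) := ⟨_, rfl⟩
  have hmm : m * (κ - 1) = κ - x := by rw [hm]; field_simp
  have hm1 : |m| < 1 := by
    rw [hm, abs_div, abs_of_pos hκ1, div_lt_one hκ1, abs_lt]; constructor <;> linarith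
  have hm2 : m < 1 := (abs_lt.1 hm1).2
  obtain ⟨lam, hl⟩ : ∃ lam, lam = r * (x + 1) / (x - 1) := ⟨_, rfl⟩
  rw [← hl] at hE ⊢
  have hx1 : 0 < x - 1 := by linarith
  have hlpos : 0 < lam := by rw [hl]; positivity
  have hlr : r - lam ≠ 0 := by
    have : r - lam = -(2 * r) / (x - 1) := by rw [hl]; field_simp; ring
    rw [this]; exact div_ne_zero (by linarith) (by linarith)
  -- sequences
  obtain ⟨a, ha⟩ : ∃ a : ℕ → ℝ, a = fun N : ℕ => Real.exp (-(r / N)) := ⟨_, rfl⟩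
  have hapos : ∀ N, 0 < a N := fun N => by rw [ha]; exact Real.exp_pos _
  have hu : Ap (fun N => N * (1 - a N)) r := by rw [ha]; exact Ap.expN r
  have ha0 : Ap (fun N => 1 - a N) 0 := hu.small
  have ha1 : Ap a 1 := by
    have := (Ap.const 1).sub ha0
    simpa using this
  obtain ⟨S, hS⟩ : ∃ S : ℕ → ℝ, S = fun N =>
      1 + m + ((1 - a N) * (κ * ((1 - a N) / a N) + (x + 1))) / (κ - 1) := ⟨_, rfl⟩
  have hSN : Ap (fun N => N * (S N - (1 + m))) (r * (x + 1) / (κ - 1)) := by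
    have h := (hu.mul (((Ap.const κ).mul (ha0.div ha1 one_ne_zero)).add
      (Ap.const (x + 1)))).div (Ap.const (κ - 1)) hκ1.ne'
    simp only [zero_div, mul_zero, zero_add] at h
    refine h.congr (Eventually.of_forall fun N => ?_)
    rw [hS]; ring
  have hS1 : Ap S (1 + m) := by
    have := hSN.small.add (Ap.const (1 + m))
    simpa using this
  have hdisc : Ap (fun N => S N * S N - 4 * m) ((1 - m) ^ 2) := by
    have := (hS1.mul hS1).sub (Ap.const (4 * m))
    convert this using 1
    ring
  have hsq : Ap (fun N => Real.sqrt (S N * S N - 4 * m)) (1 - m) := by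
    have := hdisc.comp Real.sqrt
      ((Real.hasDerivAt_sqrt (by have : 0 < 1 - m := by linarith
                                 positivity)).differentiableAt)
    rwa [Real.sqrt_sq (by linarith)] at this
  obtain ⟨z1, hz1⟩ : ∃ z : ℕ → ℝ, z = fun N => (S N + Real.sqrt (S N * S N - 4 * m)) / 2 :=
    ⟨_, rfl⟩
  obtain ⟨z2, hz2⟩ : ∃ z : ℕ → ℝ, z = fun N => (S N - Real.sqrt (S N * S N - 4 * m)) / 2 :=
    ⟨_, rfl⟩
  have hz1A : Ap z1 1 := by
    have := (hS1.add hsq).div (Ap.const 2) two_ne_zero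
    rw [hz1]; convert this using 1; ring
  have hz2A : Ap z2 m := by
    have := (hS1.sub hsq).div (Ap.const 2) two_ne_zero
    rw [hz2]; convert this using 1; ring
  have hsum : ∀ N, z1 N + z2 N = S N := fun N => by rw [hz1, hz2]; ring
  have hprod : ∀ᶠ N in atTop, z1 N * z2 N = m := by
    have : ∀ᶠ N in atTop, 0 < S N * S N - 4 * m :=
      hdisc.tendsto.eventually (lt_mem_nhds (by have : 0 < 1 - m := by linarith
                                                positivity))
    filter_upwards [this] with N hN
    have := Real.mul_self_sqrt hN.le
    rw [hz1, hz2]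
    linear_combination -this / 4
  have hSa : ∀ N, S N * ((κ - 1) * a N) = κ * (1 + a N ^ 2) - (x + 1) * a N ^ 2 := by
    intro N
    have := (hapos N).ne'
    rw [hS]; simp only; field_simp
    linear_combination a N * hmm
  have h1z2 : Ap (fun N => 1 - z2 N) (1 - m) := (Ap.const 1).sub hz2A
  have hmne : 1 - m ≠ 0 := by linarith
  have hmne' : m - 1 ≠ 0 := by linarith
  have hw : Ap (fun N => N * (z1 N - 1)) lam := by
    have h := hSN.div h1z2 hmne
    have e : r * (x + 1) / (κ - 1) / (1 - m) = lam := by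
      have : 1 - m = (x - 1) / (κ - 1) := by field_simp; linarith
      rw [this, hl]; field_simp
    rw [e] at h
    refine h.congr ?_
    filter_upwards [hprod, h1z2.ne hmne] with N h1 h2
    rw [div_eq_iff h2, ← hsum, ← h1]; ring
  have hwne := hw.ne hlpos.ne'
  have hune := hu.ne hr.ne'
  -- N (z1 - a), N (1 - a z1)
  have hza : Ap (fun N => N * (z1 N - a N)) (lam + r) :=
    (hw.add hu).congr (Eventually.of_forall fun N => by ring)
  have hlr' : lam + r ≠ 0 := by positivity
  have haz : Ap (fun N => N * (1 - a N * z1 N)) (r - lam) := by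
    have := hu.sub (ha1.mul hw)
    rw [one_mul] at this
    exact this.congr (Eventually.of_forall fun N => by ring)
  have hza2 : Ap (fun N => z2 N - a N) (m - 1) := hz2A.sub ha1
  have haz2 : Ap (fun N => 1 - a N * z2 N) (1 - m) := by
    have := (Ap.const 1).sub (ha1.mul hz2A)
    rwa [one_mul] at this
  have hk1 : Ap (fun N : ℕ => ((N + 1 : ℕ) : ℝ) / N) 1 := by
    have := (Ap.const 1).add Ap.oneN
    rw [add_zero] at this
    refine this.congr ?_
    filter_upwards [eventually_gt_atTop 0] with N hN
    have : (N : ℝ) ≠ 0 := by positivity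
    push_cast; field_simp
  have hz1E : Ap (fun N => z1 N ^ (N + 1)) E := by
    have := hw.powN (fun N => N + 1) hk1
    rwa [one_mul, ← hE] at this
  have hz20 : Ap (fun N => z2 N ^ (N + 1)) 0 := hz2A.pow_zero' (fun N => N + 1) hm1 one_pos hk1
  have hEpos : 0 < E := by rw [hE]; exact Real.exp_pos _
  have hP0 := (Ap.const 1).div hu hr.ne'
  have hP1 := (Ap.const 1).div hza hlr'
  have hp2 := (Ap.const 1).div hza2 hmne'
  have hQ1 := hz1E.div haz hlr
  have hq2 := hz20.div haz2 hmne
  have hden : Ap (fun N => (x + 1) * a N + κ * (1 - a N)) (x + 1) := by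
    have := ((Ap.const (x + 1)).mul ha1).add ((Ap.const κ).mul ha0)
    simpa using this
  have hx1' : x + 1 ≠ 0 := by linarith
  have hC0 := hu.div hden hx1'
  have hΔ := (hP1.mul hq2).sub (hp2.mul hQ1)
  obtain ⟨Δl, hΔl⟩ : ∃ Δl, Δl = 1 / (lam + r) * (0 / (1 - m)) - 1 / (m - 1) * (E / (r - lam)) :=
    ⟨_, rfl⟩
  have hΔne : Δl ≠ 0 := by
    rw [hΔl, zero_div, mul_zero, zero_sub]
    exact neg_ne_zero.2 (mul_ne_zero (one_div_ne_zero hmne') (div_ne_zero hEpos.ne' hlr))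
  rw [← hΔl] at hΔ
  have hC1 := (hC0.mul ((hp2.mul hP0).sub (hP0.mul hq2))).div hΔ hΔne
  have hC2 := (hC0.mul ((hP0.mul hQ1).sub (hP1.mul hP0))).div hΔ hΔne
  obtain ⟨C0, hC0e, hC0⟩ := hC0.named
  obtain ⟨C1, hC1e, hC1⟩ := hC1.named
  obtain ⟨C2, hC2e, hC2⟩ := hC2.named
  refine ⟨fun N j => C0 N / N + C1 N / N * z1 N ^ j + C2 N * z2 N ^ j, ?_, ?_⟩
  · filter_upwards [eventually_gt_atTop 0, hprod, hune, hza.ne hlr', haz.ne hlr, hza2.ne hmne',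
      haz2.ne hmne, hden.ne hx1', hΔ.ne hΔne] with N hN hpr h1 h2 h3 h4 h5 h6 h7
    have hN0 : (N : ℝ) ≠ 0 := by positivity
    refine aux_nu n N ρ T θ hN hρ hT hθ
      (fun j => C0 N / N + C1 N / N * z1 N ^ j + C2 N * z2 N ^ j) ?_
    intro i hi
    obtain ⟨M, rfl⟩ := Nat.exists_eq_add_of_le hi
    rw [← hxn, ← hrr, ← hκ]
    have eaN : Real.exp (-(r / ((i + M : ℕ) : ℝ))) = a (i + M) := by rw [ha]
    rw [eaN]
    have g1 := right_ne_zero_of_mul h1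
    have g2 := right_ne_zero_of_mul h2
    have g3 := right_ne_zero_of_mul h3
    have root : ∀ z, z ^ 2 - S (i + M) * z + m = 0 → x * a (i + M) * (1 - a (i + M) * z) +
        κ * (z - a (i + M)) * (1 - a (i + M) * z) + a (i + M) * z * (z - a (i + M)) = 0 := by
      intro z hz
      linear_combination -(κ - 1) * a (i + M) * hz - z * hSa (i + M) + a (i + M) * hmm
    refine aux_solve x κ (a (i + M)) (z1 (i + M)) (z2 (i + M)) _ _ _ i M g1 ?_ g2 g3 h4 h5
      (root _ ?_) (root _ ?_) ?_ ?_
    · rw [congrFun hC0e (i + M), div_div, div_mul_eq_mul_div, div_eq_iff (mul_ne_zero h6 hN0)]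
      ring
    · rw [← hsum, ← hpr]; ring
    · rw [← hsum, ← hpr]; ring
    · have E1 : C1 (i + M) * (1 / (((i + M : ℕ) : ℝ) * (z1 (i + M) - a (i + M))))
          + C2 (i + M) * (1 / (z2 (i + M) - a (i + M)))
          = - C0 (i + M) * (1 / (((i + M : ℕ) : ℝ) * (1 - a (i + M)))) := by
        have c1 := congrFun hC1e (i + M)
        have c2 := congrFun hC2e (i + M)
        have c0 := congrFun hC0e (i + M)
        beta_reduce at c0 c1 c2 h7
        rw [← c0, eq_div_iff h7] at c1 c2
        apply mul_right_cancel₀ h7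
        linear_combination (1 / (((i + M : ℕ) : ℝ) * (z1 (i + M) - a (i + M)))) * c1 +
          (1 / (z2 (i + M) - a (i + M))) * c2
      rw [div_div, div_div]
      linear_combination E1
    · have E1 : C1 (i + M) * (z1 (i + M) ^ (i + M + 1) /
            (((i + M : ℕ) : ℝ) * (1 - a (i + M) * z1 (i + M))))
          + C2 (i + M) * (z2 (i + M) ^ (i + M + 1) / (1 - a (i + M) * z2 (i + M)))
          = - C0 (i + M) * (1 / (((i + M : ℕ) : ℝ) * (1 - a (i + M)))) := by
        have c1 := congrFun hC1e (i + M)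
        have c2 := congrFun hC2e (i + M)
        have c0 := congrFun hC0e (i + M)
        beta_reduce at c0 c1 c2 h7
        rw [← c0, eq_div_iff h7] at c1 c2
        apply mul_right_cancel₀ h7
        linear_combination (z1 (i + M) ^ (i + M + 1) /
            (((i + M : ℕ) : ℝ) * (1 - a (i + M) * z1 (i + M)))) * c1 +
          (z2 (i + M) ^ (i + M + 1) / (1 - a (i + M) * z2 (i + M))) * c2
      rw [div_div, div_mul_div_comm]
      rw [mul_div_assoc'] at E1
      linear_combination E1
  · intro k τ hτ hk
    have hzk := hw.powN k hk
    have hz2k := hz2A.pow_zero' k hm1 hτ hk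
    have h := ((hC0.mul hk).add (hC1.mul ((hzk.sub (Ap.const 1)).div hw hlpos.ne'))).add
      (hC2.mul (((Ap.const 1).sub hz2k).div h1z2 hmne))
    rw [aux_lim r lam x m E _ τ hr hx hl hmne' hEpos _ Δl rfl hΔl] at h
    refine h.congr ?_
    filter_upwards [hwne, h1z2.ne hmne, eventually_gt_atTop 0] with N h1 h2 hN
    have hN0 : (N : ℝ) ≠ 0 := by positivity
    have h1' := right_ne_zero_of_mul h1
    rw [aux_geom _ _ _ _ _ _ h1' h2]
    field_simp

lemma aux_ceil (T t : ℝ) (hT : 0 < T) (ht : 0 < t) :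
    Ap (fun N : ℕ => ((⌈(N : ℝ) * t / T⌉₊ : ℕ) : ℝ) / N) (t / T) := by
  refine Asymptotics.IsBigO.of_bound 1 ?_
  filter_upwards [eventually_gt_atTop 0] with N hN
  have hp : (0 : ℝ) < N := by exact_mod_cast hN
  have h1 := Nat.le_ceil ((N : ℝ) * t / T)
  have h2 := Nat.ceil_lt_add_one (show 0 ≤ (N : ℝ) * t / T by positivity)
  have e : (⌈(N : ℝ) * t / T⌉₊ : ℝ) / N - t / T = (⌈(N : ℝ) * t / T⌉₊ - N * t / T) / N := by
    field_simp
  rw [e, norm_div, norm_inv, Real.norm_of_nonneg hp.le, Real.norm_of_nonneg (by linarith), one_mul,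
    div_eq_mul_inv]
  have : 0 < (N : ℝ)⁻¹ := by positivity
  nlinarith

/-- Convergence of the symmetric-part inventories `V^{(N)}_t` to `𝕘(t)` at rate `1/N`, for
`θ > 0`; moreover `V^{(N)}_0 = 1` for all `N ≥ 2`. -/
theorem stmt10 (n : ℕ) (hn : 2 ≤ n) (ρ T θ : ℝ) (hρ : 0 < ρ) (hT : 0 < T) (hθ : 0 < θ)
    (E D : ℝ)
    (hE : E = Real.exp (ρ * T * ((n : ℝ) + 1) / ((n : ℝ) - 1)))
    (hD : D = (n : ℝ) * ((ρ * T + 1) * ((n : ℝ) + 1) + 2) * E - ((n : ℝ) - 1))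
    (g : ℝ → ℝ)
    (hg : ∀ t : ℝ, g t = 1 -
      ((n : ℝ) * (ρ * t + 1) * ((n : ℝ) + 1) * E
        + 2 * (n : ℝ) * Real.exp (ρ * t * ((n : ℝ) + 1) / ((n : ℝ) - 1))
        - ((n : ℝ) - 1)) / D) :
    (∀ N : ℕ, 2 ≤ N → VN n N ρ T θ 0 = 1) ∧
    ∀ t : ℝ, 0 < t → t ≤ T →
      (∃ C : ℝ, ∀ N : ℕ, 2 ≤ N → (N : ℝ) * |VN n N ρ T θ t - g t| ≤ C) ∧
      Tendsto (fun N : ℕ => VN n N ρ T θ t) atTop (nhds (g t)) := by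
  have hx : (2 : ℝ) ≤ n := by exact_mod_cast hn
  have hx1 : 0 < (n : ℝ) - 1 := by linarith
  have hE1 : 1 ≤ E := by rw [hE]; exact Real.one_le_exp (by positivity)
  have hDpos : 0 < D := by
    have h1 : (n : ℝ) * 1 * 1 ≤ (n : ℝ) * ((ρ * T + 1) * ((n : ℝ) + 1) + 2) * E := by
      have : 0 < ρ * T := by positivity
      gcongr
      nlinarith
    rw [hD]; linarith
  refine ⟨fun N _ => by simp [VN], fun t ht htT => ?_⟩
  obtain ⟨f, hf, hsum⟩ := aux_main n hn ρ T θ hρ hT hθ E hE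
  have hk1 : Ap (fun N : ℕ => ((N + 1 : ℕ) : ℝ) / N) 1 := by
    have := (Ap.const 1).add Ap.oneN
    rw [add_zero] at this
    refine this.congr ?_
    filter_upwards [eventually_gt_atTop 0] with N hN
    have : (N : ℝ) ≠ 0 := by positivity
    push_cast; field_simp
  have h1 := hsum (fun N => N + 1) 1 one_pos hk1
  have h2 := hsum _ (t / T) (by positivity) (aux_ceil T t hT ht)
  have eD : ((n : ℝ) * (ρ * T * 1 + 1) * ((n : ℝ) + 1) * E
            + 2 * (n : ℝ) * Real.exp (1 * (ρ * T * ((n : ℝ) + 1) / ((n : ℝ) - 1)))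
            - ((n : ℝ) - 1)) = D := by
    rw [one_mul, ← hE, hD]; ring
  rw [eD] at h1
  have hV : Ap (fun N => VN n N ρ T θ t) (g t) := by
    have h3 := (Ap.const 1).sub (h2.div h1 (by positivity))
    have eg : 1 - ((n : ℝ) * (ρ * T * (t / T) + 1) * ((n : ℝ) + 1) * E
            + 2 * (n : ℝ) * Real.exp (t / T * (ρ * T * ((n : ℝ) + 1) / ((n : ℝ) - 1)))
            - ((n : ℝ) - 1)) / ((n : ℝ) * ((n : ℝ) + 1) ^ 2 * E) /
            (D / ((n : ℝ) * ((n : ℝ) + 1) ^ 2 * E)) = g t := by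
      rw [hg, div_div_div_cancel_right₀ (by positivity)]
      rw [show t / T * (ρ * T * ((n : ℝ) + 1) / ((n : ℝ) - 1)) = ρ * t * ((n : ℝ) + 1) / ((n : ℝ) - 1) by
        field_simp, show ρ * T * (t / T) = ρ * t by field_simp]
    rw [eg] at h3
    refine h3.congr ?_
    filter_upwards [hf] with N hN
    rw [aux_VN n N ρ T θ t (f N) hN]
    refine Nat.ceil_le.2 ?_
    rw [div_le_iff₀ hT]
    push_cast
    nlinarith [(Nat.cast_nonneg N : (0 : ℝ) ≤ N)]
  refine ⟨?_, hV.tendsto⟩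
  obtain ⟨C, _, hC⟩ := Asymptotics.bound_of_isBigO_nat_atTop hV
  refine ⟨C, fun N hN => ?_⟩
  have hp : (0 : ℝ) < N := by exact_mod_cast (by omega : 0 < N)
  have := hC (x := N) (by positivity)
  rw [norm_inv, Real.norm_eq_abs, Real.norm_of_nonneg hp.le, ← div_eq_mul_inv, le_div_iff₀ hp] at this
  linarith
end
end

section
/- Let n ≥ 2 be an integer, ρ > 0, T > 0, θ > 0, and x_1,…,x_n ∈ ℝ with mean x̄. For each N ≥ 2 let ξ^{(N)}_i := x̄·v^{(N)} + (x_i − x̄)·w^{(N)} be the equilibrium strategy on the equidistant N-step grid, and C_N(i) := (1/2)·(ξ^{(N)}_i)^⊤ Γ^θ ξ^{(N)}_i + (ξ^{(N)}_i)^⊤ Γ̃ (Σ_{j≠i} ξ^{(N)}_j) the corresponding equilibrium execution cost. Then for each i, lim_{N→∞} C_N(i) = 𝓘 + 𝓑_0 + 𝓑_T, where, with E := e^{ρT(n+1)/(n−1)} and D := n((ρT+1)(n+1)+2)·E − (n−1): 𝓘 := (n/(ρT+1))·x̄(x_i−x̄) + x̄²·n³(n+1)·[ ((ρT+1/2)(n+1)+3)·E²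 − (2(n−1)/n²)·(n·E + 1/4) ]/D², 𝓑_0 := (n−1)(n+1)²·(1 + n·E)²·x̄²/(4D²), and 𝓑_T := (x_i−x̄)²/(4(ρT+1)²). -/
open Matrix Finset Filter

noncomputable section

/-- Equilibrium strategy `ξ^{(N)}_i = x̄ v^{(N)} + (x_i − x̄) w^{(N)}`. -/
def xiN (n N : ℕ) (ρ T θ : ℝ) (x : Fin n → ℝ) (i : Fin n) : Fin (N + 1) → ℝ :=
  ((∑ j, x j) / (n : ℝ)) • vN n N ρ T θ + (x i - (∑ j, x j) / (n : ℝ)) • wN N ρ T θ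

/-- Equilibrium execution cost of agent `i` on the `N`-step grid:
`C_N(i) = (1/2) ξ_i^⊤ Γ^θ ξ_i + ξ_i^⊤ Γ̃ (Σ_{j≠i} ξ_j)`. -/
def costN (n N : ℕ) (ρ T θ : ℝ) (x : Fin n → ℝ) (i : Fin n) : ℝ :=
  (1 / 2) * (xiN n N ρ T θ x i ⬝ᵥ (Gam ρ θ (egrid T N)).mulVec (xiN n N ρ T θ x i))
    + xiN n N ρ T θ x i ⬝ᵥ
        (GamT ρ (egrid T N)).mulVec (∑ j ∈ Finset.univ.erase i, xiN n N ρ T θ x j)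

lemma aux_pow (ρ T : ℝ) (N i k : ℕ) :
    Real.exp (-(ρ * (((i + k : ℕ) : ℝ) * T / (N : ℝ) - (i : ℝ) * T / (N : ℝ))))
      = Real.exp (-(ρ * T / N)) ^ k := by
  rw [← Real.exp_nat_mul]
  congr 1
  push_cast
  ring

lemma aux_GamT_lt (ρ T : ℝ) (N : ℕ) (i j : Fin (N + 1)) (h : j < i) :
    GamT ρ (egrid T N) i j = Real.exp (-(ρ * T / N)) ^ (i.val - j.val) := by
  have h' : j.val < i.val := h
  rw [← aux_pow ρ T N j.val (i.val - j.val), show j.val + (i.val - j.val) = i.val by omega]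
  simp [GamT, egrid, h.not_gt, h.ne']

lemma aux_GamT_eq (ρ T : ℝ) (N : ℕ) (i : Fin (N + 1)) :
    GamT ρ (egrid T N) i i = 1 / 2 := by
  simp [GamT]

lemma aux_GamT_gt (ρ T : ℝ) (N : ℕ) (i j : Fin (N + 1)) (h : i < j) :
    GamT ρ (egrid T N) i j = 0 := by
  simp [GamT, h]

lemma aux_Gam (ρ T θ : ℝ) (hρ : 0 < ρ) (hT : 0 < T) (N : ℕ) :
    Gam ρ θ (egrid T N) = GamT ρ (egrid T N) + (GamT ρ (egrid T N))ᵀ + (2 * θ) • 1 := by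
  have key : ∀ i j : Fin (N + 1), i ≤ j → egrid T N i ≤ egrid T N j := by
    intro i j h
    have h' : (i.val : ℝ) ≤ j.val := by exact_mod_cast h
    unfold egrid
    gcongr
  ext i j
  simp only [Matrix.add_apply, Matrix.transpose_apply, Matrix.smul_apply, smul_eq_mul]
  rcases lt_trichotomy i j with h | h | h
  · rw [aux_GamT_gt _ _ _ _ _ h]
    simp only [Gam, GamT, Matrix.of_apply, h.not_gt, h.ne, h.ne', if_false, Matrix.one_apply_ne h.ne]
    rw [abs_of_nonpos (sub_nonpos.2 (key _ _ h.le))]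
    ring_nf
  · subst h
    simp [Gam, GamT]
    norm_num
  · rw [aux_GamT_gt _ _ _ _ _ h]
    simp only [Gam, GamT, Matrix.of_apply, h.not_gt, h.ne, h.ne', if_false, Matrix.one_apply_ne h.ne']
    rw [abs_of_nonneg (sub_nonneg.2 (key _ _ h.le))]
    ring_nf

lemma aux_split_s12 (N : ℕ) (i : Fin (N + 1)) (f : ℕ → ℝ) :
    ∑ j : Fin (N + 1), f j.val
      = ∑ j ∈ range i.val, f j + f i.val + ∑ k ∈ range (N - i.val), f (i.val + 1 + k) := by
  rw [Fin.sum_univ_eq_sum_range, ← Finset.sum_range_succ, ← Finset.sum_range_add]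
  congr 2
  omega

lemma aux_mulL (ρ T : ℝ) (N : ℕ) (i : Fin (N + 1)) (u : ℕ → ℝ) :
    (GamT ρ (egrid T N)).mulVec (fun j => u j.val) i
      = ∑ j ∈ range i.val, Real.exp (-(ρ * T / N)) ^ (i.val - j) * u j + 1 / 2 * u i.val := by
  have := aux_split_s12 N i (fun j => if h : j < N + 1 then GamT ρ (egrid T N) i ⟨j, h⟩ * u j else 0)
  simp only [Fin.is_lt, dite_true, Fin.eta] at this
  rw [Matrix.mulVec, dotProduct, this, aux_GamT_eq]
  have h1 : ∀ k ∈ range (N - i.val), (if h : i.val + 1 + k < N + 1 then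
      GamT ρ (egrid T N) i ⟨i.val + 1 + k, h⟩ * u (i.val + 1 + k) else 0) = 0 := by
    intro k hk
    have hk := Finset.mem_range.1 hk
    rw [dif_pos (by omega), aux_GamT_gt, zero_mul]
    rw [Fin.lt_def]; simp; omega
  rw [Finset.sum_eq_zero h1, add_zero]
  congr 1
  apply Finset.sum_congr rfl
  intro j hj
  have hj := Finset.mem_range.1 hj
  rw [dif_pos (by omega), aux_GamT_lt]
  rw [Fin.lt_def]; simpa using hj

lemma aux_mulU (ρ T : ℝ) (N : ℕ) (i : Fin (N + 1)) (u : ℕ → ℝ) :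
    (GamT ρ (egrid T N))ᵀ.mulVec (fun j => u j.val) i
      = 1 / 2 * u i.val
        + ∑ k ∈ range (N - i.val), Real.exp (-(ρ * T / N)) ^ (k + 1) * u (i.val + 1 + k) := by
  have := aux_split_s12 N i (fun j => if h : j < N + 1 then GamT ρ (egrid T N) ⟨j, h⟩ i * u j else 0)
  simp only [Fin.is_lt, dite_true, Fin.eta] at this
  rw [Matrix.mulVec, dotProduct]
  simp only [Matrix.transpose_apply]
  rw [this, aux_GamT_eq]
  have h1 : ∀ j ∈ range (i.val), (if h : j < N + 1 then
      GamT ρ (egrid T N) ⟨j, h⟩ i * u j else 0) = 0 := by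
    intro k hk
    have hk := Finset.mem_range.1 hk
    rw [dif_pos (by omega), aux_GamT_gt, zero_mul]
    rw [Fin.lt_def]; simpa using hk
  rw [Finset.sum_eq_zero h1, zero_add]
  congr 1
  apply Finset.sum_congr rfl
  intro j hj
  have hj := Finset.mem_range.1 hj
  rw [dif_pos (by omega), aux_GamT_lt]
  · congr 2
    simp; omega
  · rw [Fin.lt_def]; simp; omega

lemma aux_psd_seq (a : ℝ) (ha0 : 0 ≤ a) (ha1 : a ≤ 1) (u : ℕ → ℝ) (m : ℕ) :
    1 / 2 * (∑ j ∈ range m, a ^ (m - j) * u j) ^ 2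
      ≤ ∑ i ∈ range m, u i * (∑ j ∈ range i, a ^ (i - j) * u j + 1 / 2 * u i) := by
  induction m with
  | zero => simp
  | succ m ih =>
    rw [Finset.sum_range_succ (fun i => u i * _)]
    have h : ∑ j ∈ range (m + 1), a ^ (m + 1 - j) * u j
        = a * (∑ j ∈ range m, a ^ (m - j) * u j + u m) := by
      rw [Finset.sum_range_succ, mul_add, Finset.mul_sum]
      congr 1
      · apply Finset.sum_congr rfl
        intro j hj
        have hj := Finset.mem_range.1 hj
        rw [show m + 1 - j = (m - j) + 1 by omega]; ring
      · simp
    rw [h]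
    set l := ∑ j ∈ range m, a ^ (m - j) * u j
    have h2 : a ^ 2 * (l + u m) ^ 2 ≤ 1 * (l + u m) ^ 2 := by
      gcongr
      exact pow_le_one₀ ha0 ha1
    nlinarith

lemma aux_exists_nat (N : ℕ) (x : Fin (N + 1) → ℝ) : ∃ u : ℕ → ℝ, x = fun j => u j.val := by
  refine ⟨fun j => if h : j < N + 1 then x ⟨j, h⟩ else 0, ?_⟩
  ext j
  have h : j.val < N + 1 := j.is_lt
  simp only [h, dite_true]

lemma aux_psd (ρ T : ℝ) (hρ : 0 < ρ) (hT : 0 < T) (N : ℕ) (x : Fin (N + 1) → ℝ) :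
    0 ≤ x ⬝ᵥ (GamT ρ (egrid T N)).mulVec x := by
  obtain ⟨u, rfl⟩ := aux_exists_nat N x
  rw [dotProduct]
  simp only [aux_mulL]
  rw [Fin.sum_univ_eq_sum_range (fun i => u i * (∑ j ∈ range i,
    Real.exp (-(ρ * T / N)) ^ (i - j) * u j + 1 / 2 * u i)) (N + 1)]
  refine le_trans ?_ (aux_psd_seq _ (Real.exp_pos _).le ?_ u (N + 1))
  · positivity
  · rw [Real.exp_le_one_iff]
    have : 0 ≤ ρ * T / N := by positivity
    linarith

lemma aux_det (ρ T θ p q : ℝ) (hρ : 0 < ρ) (hT : 0 < T) (hθ : 0 < θ) (hpq : 0 ≤ p + q) (N : ℕ) :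
    IsUnit (p • GamT ρ (egrid T N) + q • (GamT ρ (egrid T N))ᵀ + (2 * θ) • 1).det := by
  set M := p • GamT ρ (egrid T N) + q • (GamT ρ (egrid T N))ᵀ + (2 * θ) • (1 : Matrix (Fin (N + 1)) (Fin (N + 1)) ℝ) with hM
  have hinj : ∀ y, M.mulVec y = 0 → y = 0 := by
    intro y hy
    have h1 : y ⬝ᵥ M.mulVec y = 0 := by rw [hy, dotProduct_zero]
    have h2 : y ⬝ᵥ M.mulVec y = (p + q) * (y ⬝ᵥ (GamT ρ (egrid T N)).mulVec y)
        + 2 * θ * (y ⬝ᵥ y) := by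
      have h3 : y ⬝ᵥ (GamT ρ (egrid T N))ᵀ.mulVec y = y ⬝ᵥ (GamT ρ (egrid T N)).mulVec y := by
        rw [Matrix.mulVec_transpose, dotProduct_comm, ← Matrix.dotProduct_mulVec]
      rw [hM, Matrix.add_mulVec, Matrix.add_mulVec, Matrix.smul_mulVec, Matrix.smul_mulVec,
        Matrix.smul_mulVec, Matrix.one_mulVec, dotProduct_add, dotProduct_add, dotProduct_smul,
        dotProduct_smul, dotProduct_smul, h3]
      simp only [smul_eq_mul]
      ring
    have h4 := mul_nonneg hpq (aux_psd ρ T hρ hT N y)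
    have h5 : 0 ≤ y ⬝ᵥ y := by
      rw [dotProduct]; exact Finset.sum_nonneg (fun i _ => mul_self_nonneg _)
    have h6 : y ⬝ᵥ y = 0 := by nlinarith
    exact dotProduct_self_eq_zero.1 h6
  rw [isUnit_iff_ne_zero]
  intro h0
  obtain ⟨v, hv, hv'⟩ := Matrix.exists_mulVec_eq_zero_iff.2 h0
  exact hv (hinj v hv')

lemma aux_inv (ρ T θ p q : ℝ) (hρ : 0 < ρ) (hT : 0 < T) (hθ : 0 < θ) (hpq : 0 ≤ p + q) (N : ℕ)
    (x : Fin (N + 1) → ℝ)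
    (hx : (p • GamT ρ (egrid T N) + q • (GamT ρ (egrid T N))ᵀ + (2 * θ) • 1).mulVec x = 1) :
    (p • GamT ρ (egrid T N) + q • (GamT ρ (egrid T N))ᵀ + (2 * θ) • 1)⁻¹.mulVec 1 = x := by
  rw [← hx, Matrix.mulVec_mulVec, Matrix.nonsing_inv_mul _ (aux_det ρ T θ p q hρ hT hθ hpq N),
    Matrix.one_mulVec]

lemma aux_numat (ρ T θ : ℝ) (hρ : 0 < ρ) (hT : 0 < T) (n N : ℕ) :
    Gam ρ θ (egrid T N) + ((n : ℝ) - 1) • GamT ρ (egrid T N)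
      = (n : ℝ) • GamT ρ (egrid T N) + (1 : ℝ) • (GamT ρ (egrid T N))ᵀ + (2 * θ) • 1 := by
  rw [aux_Gam ρ T θ hρ hT]; module

lemma aux_ommat (ρ T θ : ℝ) (hρ : 0 < ρ) (hT : 0 < T) (N : ℕ) :
    Gam ρ θ (egrid T N) - GamT ρ (egrid T N)
      = (0 : ℝ) • GamT ρ (egrid T N) + (1 : ℝ) • (GamT ρ (egrid T N))ᵀ + (2 * θ) • 1 := by
  rw [aux_Gam ρ T θ hρ hT]; module

lemma aux_nu_spec (ρ T θ : ℝ) (hρ : 0 < ρ) (hT : 0 < T) (hθ : 0 < θ) (n N : ℕ) :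
    ((n : ℝ) • GamT ρ (egrid T N) + (1 : ℝ) • (GamT ρ (egrid T N))ᵀ
      + (2 * θ) • 1).mulVec (nuN n N ρ T θ) = 1 := by
  rw [nuN, aux_numat ρ T θ hρ hT, Matrix.mulVec_mulVec, Matrix.mul_nonsing_inv _
    (aux_det ρ T θ _ _ hρ hT hθ (by positivity) N), Matrix.one_mulVec]

lemma aux_om_spec (ρ T θ : ℝ) (hρ : 0 < ρ) (hT : 0 < T) (hθ : 0 < θ) (N : ℕ) :
    ((0 : ℝ) • GamT ρ (egrid T N) + (1 : ℝ) • (GamT ρ (egrid T N))ᵀ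
      + (2 * θ) • 1).mulVec (omN N ρ T θ) = 1 := by
  rw [omN, aux_ommat ρ T θ hρ hT, Matrix.mulVec_mulVec, Matrix.mul_nonsing_inv _
    (aux_det ρ T θ _ _ hρ hT hθ (by norm_num) N), Matrix.one_mulVec]

/-- abstract cost identity -/
lemma aux_cost (ρ T θ : ℝ) (hρ : 0 < ρ) (hT : 0 < T) (n N : ℕ) (hn : 2 ≤ n)
    (x : Fin n → ℝ) (i : Fin n) (xb y : ℝ) (hxb : xb = (∑ j, x j) / (n : ℝ)) (hy : y = x i - xb)
    (hnu : ((n : ℝ) • GamT ρ (egrid T N) + (1 : ℝ) • (GamT ρ (egrid T N))ᵀ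
      + (2 * θ) • 1).mulVec (nuN n N ρ T θ) = 1)
    (hom : ((0 : ℝ) • GamT ρ (egrid T N) + (1 : ℝ) • (GamT ρ (egrid T N))ᵀ
      + (2 * θ) • 1).mulVec (omN N ρ T θ) = 1) (S1 S2 S3 S4 S5 : ℝ)
    (h1 : S1 = ∑ k, nuN n N ρ T θ k) (h2 : S2 = nuN n N ρ T θ ⬝ᵥ nuN n N ρ T θ)
    (h3 : S3 = ∑ k, omN N ρ T θ k) (h4 : S4 = omN N ρ T θ ⬝ᵥ omN N ρ T θ)
    (h5 : S5 = nuN n N ρ T θ ⬝ᵥ omN N ρ T θ) (hS1 : S1 ≠ 0) (hS3 : S3 ≠ 0) :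
    costN n N ρ T θ x i = xb ^ 2 * (n / (n + 1) * (1 / S1) - (n - 1) / (n + 1) * θ * (S2 / S1 ^ 2))
      + xb * y * (n * (1 / S3) + 2 * θ * (1 - n) * (S5 / (S1 * S3))) + y ^ 2 * (θ * (S4 / S3 ^ 2)) := by
  have hn0 : (n : ℝ) ≠ 0 := by positivity
  have hsum : ∑ j ∈ Finset.univ.erase i, xiN n N ρ T θ x j
      = (n * xb) • vN n N ρ T θ - xiN n N ρ T θ x i := by
    rw [eq_sub_iff_add_eq, Finset.sum_erase_add _ _ (Finset.mem_univ i)]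
    unfold xiN
    rw [← hxb, Finset.sum_add_distrib, Finset.sum_const, ← Finset.sum_smul, Finset.sum_sub_distrib]
    simp only [Finset.sum_const, Finset.card_univ, Fintype.card_fin, nsmul_eq_mul]
    rw [show ∑ j, x j - n * xb = 0 by rw [hxb]; field_simp; ring]
    rw [zero_smul, add_zero, mul_smul, Nat.cast_smul_eq_nsmul, nsmul_eq_mul]
  unfold costN
  rw [hsum, aux_Gam ρ T θ hρ hT]
  have hxi : xiN n N ρ T θ x i = (xb * (1 / S1)) • nuN n N ρ T θ + (y * (1 / S3)) • omN N ρ T θ := by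
    unfold xiN vN wN
    rw [← hxb, ← hy, ← h1, ← h3, smul_smul, smul_smul]
  have hv : vN n N ρ T θ = (1 / S1) • nuN n N ρ T θ := by rw [vN, h1]
  rw [hv, hxi]
  set ν := nuN n N ρ T θ
  set ω := omN N ρ T θ
  set L := GamT ρ (egrid T N)
  have e1 : ∀ a b : Fin (N + 1) → ℝ, a ⬝ᵥ Lᵀ.mulVec b = b ⬝ᵥ L.mulVec a := by
    intro a b
    rw [Matrix.mulVec_transpose, dotProduct_comm, ← Matrix.dotProduct_mulVec]
  have o1 : ∀ a : Fin (N + 1) → ℝ, a ⬝ᵥ (1 : Fin (N + 1) → ℝ) = ∑ k, a k := by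
    intro a; simp [dotProduct]
  have k1 := congrArg (fun z => ν ⬝ᵥ z) hnu
  have k2 := congrArg (fun z => ν ⬝ᵥ z) hom
  simp only [Matrix.add_mulVec, Matrix.smul_mulVec, Matrix.one_mulVec, dotProduct_add,
    dotProduct_smul, e1, smul_eq_mul, o1, ← h1, ← h2, ← h5] at k1 k2
  have c5 : ω ⬝ᵥ ν = S5 := by rw [h5, dotProduct_comm]
  simp only [Matrix.add_mulVec, Matrix.smul_mulVec, Matrix.one_mulVec, dotProduct_add,
    Matrix.mulVec_add, Matrix.mulVec_sub, Matrix.mulVec_smul, dotProduct_sub, add_dotProduct,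
    smul_dotProduct, dotProduct_smul, e1, smul_eq_mul, o1, ← h1, ← h2, ← h5, ← h4, c5]
  have q1 : ν ⬝ᵥ L.mulVec ν = (S1 - 2 * θ * S2) / (n + 1) := by
    field_simp; linarith
  have q2 : ω ⬝ᵥ L.mulVec ν = S1 - 2 * θ * S5 := by linarith
  rw [q1, q2]
  field_simp
  ring
lemma aux_geomL (a z : ℝ) (h : z - a ≠ 0) (i : ℕ) :
    ∑ j ∈ range i, a ^ (i - j) * z ^ j = a * (z ^ i - a ^ i) / (z - a) := by
  rw [eq_div_iff h]
  induction i with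
  | zero => simp
  | succ m ih =>
    have h : ∑ j ∈ range (m + 1), a ^ (m + 1 - j) * z ^ j
        = a * (∑ j ∈ range m, a ^ (m - j) * z ^ j + z ^ m) := by
      rw [Finset.sum_range_succ, mul_add, Finset.mul_sum]
      congr 1
      · apply Finset.sum_congr rfl
        intro j hj
        have hj := Finset.mem_range.1 hj
        rw [show m + 1 - j = (m - j) + 1 by omega]; ring
      · simp
    rw [h, mul_assoc, add_mul, ih]
    ring

lemma aux_geomU (a z : ℝ) (h : 1 - a * z ≠ 0) (i d : ℕ) :
    ∑ k ∈ range d, a ^ (k + 1) * z ^ (i + 1 + k)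
      = (a * z ^ (i + 1) - a ^ (d + 1) * z ^ (i + d + 1)) / (1 - a * z) := by
  rw [eq_div_iff h]
  induction d with
  | zero => simp
  | succ m ih =>
    rw [Finset.sum_range_succ, add_mul, ih]
    ring

lemma aux_geomQ (a q : ℝ) (h : q - a ≠ 0) (d : ℕ) :
    ∑ k ∈ range d, a ^ (k + 1) * q ^ (d - (1 + k)) = a * (q ^ d - a ^ d) / (q - a) := by
  rw [← aux_geomL a q h, ← Finset.sum_range_reflect]
  apply Finset.sum_congr rfl
  intro j hj
  have hj := Finset.mem_range.1 hj
  rw [show d - 1 - j + 1 = d - j by omega, show d - (1 + (d - 1 - j)) = j by omega]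

lemma aux_sol_nu (ρ T θ : ℝ) (hρ : 0 < ρ) (hT : 0 < T) (hθ : 0 < θ) (n N : ℕ)
    (a κ r s c α β : ℝ) (ha : a = Real.exp (-(ρ * T / N)))
    (hκ : κ = ((n : ℝ) + 1) / 2 + 2 * θ) (h1 : 1 - a ≠ 0)
    (hr1 : r - a ≠ 0) (hr2 : 1 - a * r ≠ 0) (hs1 : s - a ≠ 0) (hs2 : 1 - a * s ≠ 0)
    (hr : κ + n * a / (r - a) + a * r / (1 - a * r) = 0)
    (hs : κ + n * a / (s - a) + a * s / (1 - a * s) = 0)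
    (hc : c * (κ + (n + 1) * a / (1 - a)) = 1)
    (hbl : c / (1 - a) + α / (r - a) + β / (s - a) = 0)
    (hbu : c / (1 - a) + α * r ^ (N + 1) / (1 - a * r) + β * s ^ (N + 1) / (1 - a * s) = 0) :
    nuN n N ρ T θ = fun j => c + α * r ^ j.val + β * s ^ j.val := by
  rw [nuN, aux_numat ρ T θ hρ hT]
  apply aux_inv ρ T θ n 1 hρ hT hθ (by positivity)
  ext i
  rw [Matrix.add_mulVec, Matrix.add_mulVec, Matrix.smul_mulVec, Matrix.smul_mulVec,
        Matrix.smul_mulVec, Matrix.one_mulVec]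
  simp only [Pi.add_apply, Pi.smul_apply, smul_eq_mul, Pi.one_apply]
  rw [aux_mulL ρ T N i (fun j => c + α * r ^ j + β * s ^ j),
    aux_mulU ρ T N i (fun j => c + α * r ^ j + β * s ^ j), ← ha]
  obtain ⟨d, hd⟩ : ∃ d, N = i.val + d := ⟨N - i.val, by omega⟩
  have hd' : N - i.val = d := by omega
  have eL : ∑ j ∈ range i.val, a ^ (i.val - j) * (c + α * r ^ j + β * s ^ j)
      = c * (a * (1 - a ^ i.val) / (1 - a)) + α * (a * (r ^ i.val - a ^ i.val) / (r - a))
        + β * (a * (s ^ i.val - a ^ i.val) / (s - a)) := by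
    have := aux_geomL a 1 h1 i.val
    simp only [one_pow] at this
    rw [← this, ← aux_geomL a r hr1, ← aux_geomL a s hs1, Finset.mul_sum, Finset.mul_sum,
      Finset.mul_sum, ← Finset.sum_add_distrib, ← Finset.sum_add_distrib]
    apply Finset.sum_congr rfl
    intro j _
    ring
  have eU : ∑ k ∈ range d, a ^ (k + 1) * (c + α * r ^ (i.val + 1 + k) + β * s ^ (i.val + 1 + k))
      = c * ((a - a ^ (d + 1)) / (1 - a))
        + α * ((a * r ^ (i.val + 1) - a ^ (d + 1) * r ^ (N + 1)) / (1 - a * r))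
        + β * ((a * s ^ (i.val + 1) - a ^ (d + 1) * s ^ (N + 1)) / (1 - a * s)) := by
    have := aux_geomU a 1 (by rwa [mul_one]) i.val d
    simp only [one_pow, mul_one] at this
    have hN1 : ∀ z : ℝ, z ^ (N + 1) = z ^ (i.val + d + 1) := fun z => by congr 1; omega
    rw [hN1, hN1, ← this, ← aux_geomU a r hr2, ← aux_geomU a s hs2, Finset.mul_sum, Finset.mul_sum,
      Finset.mul_sum, ← Finset.sum_add_distrib, ← Finset.sum_add_distrib]
    apply Finset.sum_congr rfl
    intro j _
    ring
  rw [hd', eL, eU]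
  have hk2 : 2 * θ = κ - ((n : ℝ) + 1) / 2 := by rw [hκ]; ring
  rw [hk2]
  have id : (n : ℝ) * (c * (a * (1 - a ^ i.val) / (1 - a)) + α * (a * (r ^ i.val - a ^ i.val) / (r - a))
        + β * (a * (s ^ i.val - a ^ i.val) / (s - a)) + 1 / 2 * (c + α * r ^ i.val + β * s ^ i.val)) +
      1 * (1 / 2 * (c + α * r ^ i.val + β * s ^ i.val) + (c * ((a - a ^ (d + 1)) / (1 - a))
        + α * ((a * r ^ (i.val + 1) - a ^ (d + 1) * r ^ (N + 1)) / (1 - a * r))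
        + β * ((a * s ^ (i.val + 1) - a ^ (d + 1) * s ^ (N + 1)) / (1 - a * s)))) +
      (κ - ((n : ℝ) + 1) / 2) * (c + α * r ^ i.val + β * s ^ i.val)
      = c * (κ + (n + 1) * a / (1 - a))
      + α * r ^ i.val * (κ + n * a / (r - a) + a * r / (1 - a * r))
      + β * s ^ i.val * (κ + n * a / (s - a) + a * s / (1 - a * s))
      - n * a * a ^ i.val * (c / (1 - a) + α / (r - a) + β / (s - a))
      - a ^ (d + 1) * (c / (1 - a) + α * r ^ (N + 1) / (1 - a * r)
          + β * s ^ (N + 1) / (1 - a * s)) := by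
    ring
  rw [id, hr, hs, hc, hbl, hbu]
  ring

lemma aux_sol_om (ρ T θ : ℝ) (hρ : 0 < ρ) (hT : 0 < T) (hθ : 0 < θ) (N : ℕ)
    (a κ q c δ : ℝ) (ha : a = Real.exp (-(ρ * T / N)))
    (hκ : κ = 1 / 2 + 2 * θ) (h1 : 1 - a ≠ 0)
    (hq1 : q - a ≠ 0)
    (hq : κ + a / (q - a) = 0)
    (hc : c * (κ + a / (1 - a)) = 1)
    (hb : c / (1 - a) + δ / (q - a) = 0) :
    omN N ρ T θ = fun j => c + δ * q ^ (N - j.val) := by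
  rw [omN, aux_ommat ρ T θ hρ hT]
  apply aux_inv ρ T θ 0 1 hρ hT hθ (by positivity)
  ext i
  rw [Matrix.add_mulVec, Matrix.add_mulVec, Matrix.smul_mulVec, Matrix.smul_mulVec,
        Matrix.smul_mulVec, Matrix.one_mulVec]
  simp only [Pi.add_apply, Pi.smul_apply, smul_eq_mul, Pi.one_apply]
  rw [aux_mulU ρ T N i (fun j => c + δ * q ^ (N - j)), ← ha]
  obtain ⟨d, hd⟩ : ∃ d, N = i.val + d := ⟨N - i.val, by omega⟩
  have hd' : N - i.val = d := by omega
  have eU : ∑ k ∈ range d, a ^ (k + 1) * (c + δ * q ^ (N - (i.val + 1 + k)))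
      = c * (a * (1 - a ^ d) / (1 - a)) + δ * (a * (q ^ d - a ^ d) / (q - a)) := by
    have := aux_geomQ a 1 h1 d
    simp only [one_pow] at this
    rw [← this, ← aux_geomQ a q hq1, Finset.mul_sum, Finset.mul_sum, ← Finset.sum_add_distrib]
    apply Finset.sum_congr rfl
    intro j _
    rw [show N - (i.val + 1 + j) = d - (1 + j) by omega]
    ring
  rw [hd', eU]
  have hk2 : 2 * θ = κ - 1 / 2 := by rw [hκ]; ring
  rw [hk2]
  have id : 0 * (GamT ρ (egrid T N)).mulVec (fun j => c + δ * q ^ (N - j.val)) i +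
      1 * (1 / 2 * (c + δ * q ^ d) + (c * (a * (1 - a ^ d) / (1 - a))
        + δ * (a * (q ^ d - a ^ d) / (q - a)))) + (κ - 1 / 2) * (c + δ * q ^ d)
      = c * (κ + a / (1 - a)) + δ * q ^ d * (κ + a / (q - a))
        - a * a ^ d * (c / (1 - a) + δ / (q - a)) := by
    ring
  rw [id, hq, hc, hb]
  ring
lemma lim_cdiv (f : ℕ → ℝ) (l : ℝ) (hf : Tendsto f atTop (nhds l)) (c : ℝ) (hl : l ≠ 0) :
    Tendsto (fun N => c / f N) atTop (nhds (c / l)) :=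
  (tendsto_const_nhds (x := c)).div hf hl

lemma lim_pow_zero (s : ℕ → ℝ) (s0 : ℝ) (hs : Tendsto s atTop (nhds s0)) (h0 : |s0| < 1) :
    Tendsto (fun N : ℕ => s N ^ (N + 1)) atTop (nhds 0) := by
  obtain ⟨c, hc1, hc2⟩ := exists_between h0
  have hc0 : 0 ≤ c := (abs_nonneg _).trans hc1.le
  have ht := (tendsto_pow_atTop_nhds_zero_of_lt_one hc0 hc2).comp (tendsto_add_atTop_nat 1)
  apply squeeze_zero_norm' _ ht
  filter_upwards [hs.abs.eventually_lt_const hc1] with N hN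
  simp only [Function.comp, Real.norm_eq_abs, abs_pow]
  exact pow_le_pow_left₀ (abs_nonneg _) hN.le _

lemma lim_geom (s : ℕ → ℝ) (s0 : ℝ) (hs : Tendsto s atTop (nhds s0)) (h0 : |s0| < 1) :
    Tendsto (fun N : ℕ => ∑ j ∈ range (N + 1), s N ^ j) atTop (nhds (1 / (1 - s0))) := by
  have hlt : s0 < 1 := (abs_lt.1 h0).2
  have h : Tendsto (fun N : ℕ => (s N ^ (N + 1) - 1) / (s N - 1)) atTop
      (nhds ((0 - 1) / (s0 - 1))) :=
    ((lim_pow_zero s s0 hs h0).sub_const 1).div (hs.sub_const 1) (by linarith)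
  have e : (0 - 1) / (s0 - 1) = 1 / (1 - s0) := by
    rw [div_eq_div_iff (by linarith) (by linarith)]; ring
  rw [e] at h
  apply h.congr'
  filter_upwards [hs.eventually_lt_const hlt] with N hN
  rw [geom_sum_eq hN.ne]

lemma lim_one (r : ℕ → ℝ) (μ : ℝ) (hr : Tendsto (fun N : ℕ => (N : ℝ) * (r N - 1)) atTop (nhds μ)) :
    Tendsto r atTop (nhds 1) := by
  have h := (hr.mul tendsto_one_div_atTop_nhds_zero_nat).add_const 1
  simp only [mul_zero, zero_add] at h
  apply h.congr'
  filter_upwards [eventually_ne_atTop 0] with N hN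
  have : (N : ℝ) ≠ 0 := by exact_mod_cast hN
  field_simp
  ring

lemma lim_zero (r : ℕ → ℝ) (μ : ℝ) (hr : Tendsto (fun N : ℕ => (N : ℝ) * r N) atTop (nhds μ)) :
    Tendsto r atTop (nhds 0) := by
  have h := (hr.mul tendsto_one_div_atTop_nhds_zero_nat)
  simp only [mul_zero] at h
  apply h.congr'
  filter_upwards [eventually_ne_atTop 0] with N hN
  have : (N : ℝ) ≠ 0 := by exact_mod_cast hN
  field_simp

lemma lim_rpow (r : ℕ → ℝ) (μ : ℝ) (hr : Tendsto (fun N : ℕ => (N : ℝ) * (r N - 1)) atTop (nhds μ)) :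
    Tendsto (fun N : ℕ => r N ^ (N + 1)) atTop (nhds (Real.exp μ)) := by
  have h := (Real.tendsto_one_add_pow_exp_of_tendsto hr).mul (lim_one r μ hr)
  rw [mul_one] at h
  apply h.congr
  intro N
  rw [pow_succ]
  congr 2
  ring

lemma lim_geom_one (r : ℕ → ℝ) (μ : ℝ) (hμ : μ ≠ 0)
    (hr : Tendsto (fun N : ℕ => (N : ℝ) * (r N - 1)) atTop (nhds μ)) :
    Tendsto (fun N : ℕ => (∑ j ∈ range (N + 1), r N ^ j) / N) atTop
      (nhds ((Real.exp μ - 1) / μ)) := by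
  have h := ((lim_rpow r μ hr).sub_const 1).div hr hμ
  apply h.congr'
  filter_upwards [hr.eventually_ne hμ] with N hN
  have h1 : r N ≠ 1 := by
    intro h; apply hN; rw [h]; ring
  rw [geom_sum_eq h1, div_div]
  simp only [Pi.div_apply]
  rw [mul_comm (N : ℝ)]

lemma lim_succ (c : ℕ → ℝ) (C : ℝ) (hc : Tendsto (fun N : ℕ => (N : ℝ) * c N) atTop (nhds C)) :
    Tendsto (fun N : ℕ => ((N : ℝ) + 1) * c N) atTop (nhds C) := by
  have h := hc.add (lim_zero c C hc)
  rw [add_zero] at h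
  apply h.congr
  intro N; ring

lemma lim_sum1 (c α β r s : ℕ → ℝ) (C A B s0 μ : ℝ) (hμ : μ ≠ 0)
    (hc : Tendsto (fun N : ℕ => (N : ℝ) * c N) atTop (nhds C))
    (hα : Tendsto (fun N : ℕ => (N : ℝ) * α N) atTop (nhds A))
    (hβ : Tendsto β atTop (nhds B)) (hs : Tendsto s atTop (nhds s0)) (h0 : |s0| < 1)
    (hr : Tendsto (fun N : ℕ => (N : ℝ) * (r N - 1)) atTop (nhds μ)) :
    Tendsto (fun N : ℕ => ∑ j ∈ range (N + 1), (c N + α N * r N ^ j + β N * s N ^ j)) atTop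
      (nhds (C + A * ((Real.exp μ - 1) / μ) + B * (1 / (1 - s0)))) := by
  have h := ((lim_succ c C hc).add (hα.mul (lim_geom_one r μ hμ hr))).add
    (hβ.mul (lim_geom s s0 hs h0))
  apply h.congr'
  filter_upwards [eventually_ne_atTop 0] with N hN
  have : (N : ℝ) ≠ 0 := by exact_mod_cast hN
  rw [Finset.sum_add_distrib, Finset.sum_add_distrib, ← Finset.mul_sum, ← Finset.mul_sum,
    Finset.sum_const, Finset.card_range, nsmul_eq_mul]
  push_cast
  field_simp

lemma lim_sum2 (c α β r s : ℕ → ℝ) (C A B s0 μ : ℝ) (hμ : μ ≠ 0)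
    (hc : Tendsto (fun N : ℕ => (N : ℝ) * c N) atTop (nhds C))
    (hα : Tendsto (fun N : ℕ => (N : ℝ) * α N) atTop (nhds A))
    (hβ : Tendsto β atTop (nhds B)) (hs : Tendsto s atTop (nhds s0)) (h0 : |s0| < 1)
    (hr : Tendsto (fun N : ℕ => (N : ℝ) * (r N - 1)) atTop (nhds μ)) :
    Tendsto (fun N : ℕ => ∑ j ∈ range (N + 1), (c N + α N * r N ^ j + β N * s N ^ j) ^ 2) atTop
      (nhds (B ^ 2 / (1 - s0 ^ 2))) := by
  have r1 := lim_one r μ hr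
  have c0 := lim_zero c C hc
  have a0 := lim_zero α A hα
  have hr2 : Tendsto (fun N : ℕ => (N : ℝ) * ((r N) ^ 2 - 1)) atTop (nhds (μ * 2)) := by
    have h := hr.mul (r1.add_const 1)
    norm_num at h
    apply h.congr
    intro N; ring
  have hs2 : |s0 ^ 2| < 1 := by
    rw [abs_pow]; exact pow_lt_one₀ (abs_nonneg _) h0 (by norm_num)
  have hrs : Tendsto (fun N => r N * s N) atTop (nhds s0) := by
    simpa using r1.mul hs
  have g1 := lim_geom_one r μ hμ hr
  have g2 := lim_geom_one _ _ (mul_ne_zero hμ two_ne_zero) hr2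
  have g3 := lim_geom s s0 hs h0
  have g4 := lim_geom _ _ (hs.pow 2) hs2
  have g5 := lim_geom _ _ hrs h0
  have h := ((((((lim_succ c C hc).mul c0).add ((hα.mul a0).mul g2)).add ((hβ.pow 2).mul g4)).add
    (((c0.const_mul 2).mul hα).mul g1)).add (((c0.const_mul 2).mul hβ).mul g3)).add
    (((a0.const_mul 2).mul hβ).mul g5)
  have e : C * 0 + A * 0 * ((Real.exp (μ * 2) - 1) / (μ * 2)) + B ^ 2 * (1 / (1 - s0 ^ 2)) +
      2 * 0 * A * ((Real.exp μ - 1) / μ) + 2 * 0 * B * (1 / (1 - s0)) + 2 * 0 * B * (1 / (1 - s0))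
      = B ^ 2 / (1 - s0 ^ 2) := by ring
  rw [e] at h
  apply h.congr'
  filter_upwards [eventually_ne_atTop 0] with N hN
  have hN' : (N : ℝ) ≠ 0 := by exact_mod_cast hN
  have ex : ∀ j, (c N + α N * r N ^ j + β N * s N ^ j) ^ 2 = c N ^ 2 + α N ^ 2 * (r N ^ 2) ^ j
      + β N ^ 2 * (s N ^ 2) ^ j + 2 * c N * α N * r N ^ j + 2 * c N * β N * s N ^ j
      + 2 * α N * β N * (r N * s N) ^ j := by
    intro j
    rw [mul_pow, ← pow_mul, ← pow_mul, mul_comm 2 j, pow_mul, pow_mul]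
    ring
  simp only [ex, Finset.sum_add_distrib, ← Finset.mul_sum, Finset.sum_const, Finset.card_range,
    nsmul_eq_mul]
  push_cast
  field_simp

lemma lim_cross (s q : ℕ → ℝ) (s0 q0 : ℝ) (hs : Tendsto s atTop (nhds s0)) (h0 : |s0| < 1)
    (hq : Tendsto q atTop (nhds q0)) (h1 : |q0| < 1) :
    Tendsto (fun N : ℕ => ∑ j ∈ range (N + 1), s N ^ j * q N ^ (N - j)) atTop (nhds 0) := by
  obtain ⟨c, hc1, hc2⟩ := exists_between (max_lt h0 h1)
  have hcs := (le_max_left _ _).trans_lt hc1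
  have hcq := (le_max_right _ _).trans_lt hc1
  have hc0 : 0 ≤ c := (abs_nonneg _).trans hcs.le
  have ht := (tendsto_self_mul_const_pow_of_lt_one hc0 hc2).add
    (tendsto_pow_atTop_nhds_zero_of_lt_one hc0 hc2)
  rw [add_zero] at ht
  apply squeeze_zero_norm' _ ht
  filter_upwards [hs.abs.eventually_lt_const hcs, hq.abs.eventually_lt_const hcq] with N hN hN'
  refine (norm_sum_le _ _).trans ?_
  have : ∀ j ∈ range (N + 1), ‖s N ^ j * q N ^ (N - j)‖ ≤ c ^ N := by
    intro j hj
    have hj := Finset.mem_range.1 hj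
    rw [Real.norm_eq_abs, abs_mul, abs_pow, abs_pow]
    calc |s N| ^ j * |q N| ^ (N - j) ≤ c ^ j * c ^ (N - j) := by gcongr
      _ = c ^ N := by rw [← pow_add]; congr 1; omega
  refine (Finset.sum_le_sum this).trans ?_
  rw [Finset.sum_const, Finset.card_range, nsmul_eq_mul]
  push_cast
  apply le_of_eq; ring

lemma lim_cross_r (r q : ℕ → ℝ) (μ q0 : ℝ)
    (hr : Tendsto (fun N : ℕ => (N : ℝ) * (r N - 1)) atTop (nhds μ))
    (hq : Tendsto q atTop (nhds q0)) (h1 : |q0| < 1) :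
    ∃ l, Tendsto (fun N : ℕ => ∑ j ∈ range (N + 1), r N ^ j * q N ^ (N - j)) atTop (nhds l) := by
  have hlt : q0 < 1 := (abs_lt.1 h1).2
  have h2 := (lim_one r μ hr).sub hq
  have hne : (1 : ℝ) - q0 ≠ 0 := by linarith
  refine ⟨_, (((lim_rpow r μ hr).sub (lim_pow_zero q q0 hq h1)).div h2 hne).congr' ?_⟩
  filter_upwards [h2.eventually_ne hne] with N hN
  simp only [Pi.div_apply]
  rw [div_eq_iff hN]
  have := Commute.geom_sum₂_mul (Commute.all (r N) (q N)) (N + 1)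
  simpa using this.symm

lemma lim_refl (q : ℝ) (N : ℕ) (f : ℝ → ℝ) :
    ∑ j ∈ range (N + 1), f (q ^ (N - j)) = ∑ j ∈ range (N + 1), f (q ^ j) := by
  rw [← Finset.sum_range_reflect]
  apply Finset.sum_congr rfl
  intro j hj
  have hj := Finset.mem_range.1 hj
  congr 2
  omega

lemma lim_sum5 (c α β r s d δ q : ℕ → ℝ) (C A B s0 μ D0 δ0 q0 : ℝ) (hμ : μ ≠ 0)
    (hc : Tendsto (fun N : ℕ => (N : ℝ) * c N) atTop (nhds C))
    (hα : Tendsto (fun N : ℕ => (N : ℝ) * α N) atTop (nhds A))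
    (hβ : Tendsto β atTop (nhds B)) (hs : Tendsto s atTop (nhds s0)) (h0 : |s0| < 1)
    (hr : Tendsto (fun N : ℕ => (N : ℝ) * (r N - 1)) atTop (nhds μ))
    (hd : Tendsto (fun N : ℕ => (N : ℝ) * d N) atTop (nhds D0))
    (hδ : Tendsto δ atTop (nhds δ0)) (hq : Tendsto q atTop (nhds q0)) (h1 : |q0| < 1) :
    Tendsto (fun N : ℕ => ∑ j ∈ range (N + 1), (c N + α N * r N ^ j + β N * s N ^ j)
      * (d N + δ N * q N ^ (N - j))) atTop (nhds 0) := by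
  have c0 := lim_zero c C hc
  have a0 := lim_zero α A hα
  have d0 := lim_zero d D0 hd
  obtain ⟨l, hl⟩ := lim_cross_r r q μ q0 hr hq h1
  have h := ((((((lim_succ c C hc).mul d0).add ((c0.mul hδ).mul (lim_geom q q0 hq h1))).add
    ((hα.mul d0).mul (lim_geom_one r μ hμ hr))).add ((a0.mul hδ).mul hl)).add
    ((hβ.mul d0).mul (lim_geom s s0 hs h0))).add ((hβ.mul hδ).mul (lim_cross s q s0 q0 hs h0 hq h1))
  simp only [mul_zero, zero_mul, add_zero] at h
  apply h.congr'
  filter_upwards [eventually_ne_atTop 0] with N hN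
  have hN' : (N : ℝ) ≠ 0 := by exact_mod_cast hN
  have ex : ∀ j, (c N + α N * r N ^ j + β N * s N ^ j) * (d N + δ N * q N ^ (N - j))
      = c N * d N + c N * δ N * q N ^ (N - j) + α N * d N * r N ^ j
      + α N * δ N * (r N ^ j * q N ^ (N - j)) + β N * d N * s N ^ j
      + β N * δ N * (s N ^ j * q N ^ (N - j)) := by
    intro j
    ring
  simp only [ex, Finset.sum_add_distrib, ← Finset.mul_sum, Finset.sum_const, Finset.card_range,
    nsmul_eq_mul]
  rw [lim_refl (q N) N (fun x => x)]
  push_cast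
  field_simp
lemma lim_a (c : ℝ) (hc : 0 < c) :
    Tendsto (fun N : ℕ => (N : ℝ) * (1 - Real.exp (-(c / N)))) atTop (nhds c) := by
  have h1 : Tendsto (fun N : ℕ => c / (1 + c * (1 / (N : ℝ)))) atTop (nhds c) := by
    have := ((tendsto_one_div_atTop_nhds_zero_nat (𝕜 := ℝ)).const_mul c).const_add 1
    have := lim_cdiv _ _ this c (by norm_num)
    simpa using this
  refine tendsto_of_tendsto_of_tendsto_of_le_of_le' h1 (tendsto_const_nhds (x := c)) ?_ ?_
  · filter_upwards [eventually_gt_atTop 0] with N hN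
    have hN : (0 : ℝ) < N := by exact_mod_cast hN
    have hx : 0 < c / N := by positivity
    have h2 := Real.add_one_le_exp (c / N)
    rw [Real.exp_neg]
    have h3 : (Real.exp (c / N))⁻¹ ≤ (c / N + 1)⁻¹ := by gcongr
    calc c / (1 + c * (1 / (N : ℝ))) = N * (1 - (c / N + 1)⁻¹) := by
          field_simp
          ring
      _ ≤ _ := by gcongr
  · filter_upwards [eventually_gt_atTop 0] with N hN
    have hN : (0 : ℝ) < N := by exact_mod_cast hN
    have h2 := Real.add_one_le_exp (-(c / N))
    calc (N : ℝ) * (1 - Real.exp (-(c / N))) ≤ N * (c / N) := by gcongr; linarith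
      _ = c := by field_simp

lemma om_asym (ρ T θ : ℝ) (hρ : 0 < ρ) (hT : 0 < T) (hθ : 0 < θ) :
    ∃ (d δ q : ℕ → ℝ) (q0 : ℝ),
      (∀ᶠ N in atTop, omN N ρ T θ = fun j => d N + δ N * q N ^ (N - j.val)) ∧
      Tendsto (fun N : ℕ => (N : ℝ) * d N) atTop (nhds (ρ * T)) ∧
      Tendsto δ atTop (nhds (1 - q0)) ∧ Tendsto q atTop (nhds q0) ∧ |q0| < 1 ∧
      (1 - q0) ^ 2 / (1 - q0 ^ 2) = 1 / (4 * θ) := by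
  set κ : ℝ := 1 / 2 + 2 * θ with hκ
  have hκ0 : 0 < κ := by positivity
  have hρT : 0 < ρ * T := by positivity
  have hNe := lim_a (ρ * T) hρT
  set a : ℕ → ℝ := fun N => Real.exp (-(ρ * T / N)) with ha
  have he := lim_zero _ _ hNe
  have ha1 : Tendsto a atTop (nhds 1) := by
    have := he.const_sub 1
    simpa using this
  have hden : Tendsto (fun N => κ * (1 - a N) + a N) atTop (nhds 1) := by
    have := (he.const_mul κ).add ha1
    simpa using this
  refine ⟨fun N => (1 - a N) / (κ * (1 - a N) + a N), fun N => a N / κ / (κ * (1 - a N) + a N),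
    fun N => a N * (1 - 1 / κ), 1 - 1 / κ, ?_, ?_, ?_, ?_, ?_, ?_⟩
  · filter_upwards [hNe.eventually_ne hρT.ne', hden.eventually_ne one_ne_zero] with N h1 h2
    have h1' : 1 - a N ≠ 0 := right_ne_zero_of_mul h1
    have hapos : a N ≠ 0 := (Real.exp_pos _).ne'
    have hqa : a N * (1 - 1 / κ) - a N = - (a N / κ) := by ring
    apply aux_sol_om ρ T θ hρ hT hθ N (a N) κ _ _ _ rfl hκ h1'
    · rw [hqa]; exact neg_ne_zero.2 (by positivity)
    · rw [hqa]; field_simp; ring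
    · rw [show κ + a N / (1 - a N) = (κ * (1 - a N) + a N) / (1 - a N) by field_simp]
      rw [div_mul_div_cancel₀ h2, div_self h1']
    · rw [hqa]
      field_simp
      ring
  · have := hNe.div hden one_ne_zero
    rw [div_one] at this
    apply this.congr
    intro N
    simp only [Pi.div_apply]
    rw [mul_div_assoc]
  · have := (ha1.div_const κ).div hden one_ne_zero
    rw [show 1 / κ / 1 = 1 - (1 - 1 / κ) by ring] at this
    exact this
  · simpa using ha1.mul_const (1 - 1 / κ)
  · have h1 : 1 / κ < 2 := by
      rw [div_lt_iff₀ hκ0]; rw [hκ]; linarith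
    have h2 : 0 < 1 / κ := by positivity
    rw [abs_lt]; constructor <;> linarith
  · have : 1 - (1 - 1 / κ) ^ 2 = 4 * θ / κ ^ 2 := by
      field_simp
      rw [hκ]; ring
    rw [this]
    field_simp
    ring

lemma nu_asym (ρ T θ : ℝ) (hρ : 0 < ρ) (hT : 0 < T) (hθ : 0 < θ) (n : ℕ) (hn : 2 ≤ n) (E μ : ℝ)
    (hμ : μ = ρ * T * ((n : ℝ) + 1) / ((n : ℝ) - 1)) (hE : E = Real.exp μ) :
    ∃ (c α β r s : ℕ → ℝ) (s0 : ℝ),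
      (∀ᶠ N in atTop, nuN n N ρ T θ = fun j => c N + α N * r N ^ j.val + β N * s N ^ j.val) ∧
      Tendsto (fun N : ℕ => (N : ℝ) * c N) atTop (nhds (ρ * T / (n + 1))) ∧
      Tendsto (fun N : ℕ => (N : ℝ) * α N) atTop (nhds (ρ * T * (2 / ((n + 1) * (n - 1) * E)))) ∧
      Tendsto β atTop (nhds ((1 - s0) * (1 / (n + 1) + 1 / (n * (n + 1) * E)))) ∧
      Tendsto s atTop (nhds s0) ∧ |s0| < 1 ∧
      Tendsto (fun N : ℕ => (N : ℝ) * (r N - 1)) atTop (nhds μ) ∧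
      (1 - s0) ^ 2 / (1 - s0 ^ 2) = (n - 1) / (4 * θ) := by
  set κ : ℝ := ((n : ℝ) + 1) / 2 + 2 * θ with hκ
  have hn2 : (2 : ℝ) ≤ n := by exact_mod_cast hn
  have hn1 : (0 : ℝ) < n - 1 := by linarith
  have hE0 : 0 < E := by rw [hE]; exact Real.exp_pos _
  have hκ1 : 0 < κ - 1 := by rw [hκ]; linarith
  have hρT : 0 < ρ * T := by positivity
  have hNe := lim_a (ρ * T) hρT
  set a : ℕ → ℝ := fun N => Real.exp (-(ρ * T / N)) with ha
  have hapos : ∀ N, 0 < a N := fun N => Real.exp_pos _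
  have he := lim_zero _ _ hNe
  have ha1 : Tendsto a atTop (nhds 1) := by
    have := he.const_sub 1
    simpa using this
  -- the quadratic
  set b : ℕ → ℝ := fun N => κ * (1 + a N ^ 2) - (n + 1) * a N ^ 2 with hb
  set A : ℕ → ℝ := fun N => a N * (κ - 1) with hA
  have hA0 : ∀ N, 0 < A N := fun N => mul_pos (hapos N) hκ1
  set disc : ℕ → ℝ := fun N => b N ^ 2 - 4 * A N * (a N * (κ - n)) with hdisc
  set s : ℕ → ℝ := fun N => (b N - √(disc N)) / (2 * A N) with hs
  have hAl : Tendsto A atTop (nhds (κ - 1)) := by simpa using ha1.mul_const (κ - 1)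
  have hbl : Tendsto b atTop (nhds (2 * κ - (n + 1))) := by
    have := (((ha1.pow 2).const_add 1).const_mul κ).sub ((ha1.pow 2).const_mul ((n : ℝ) + 1))
    convert! this using 2
    ring
  have hdl : Tendsto disc atTop (nhds (((n : ℝ) - 1) ^ 2)) := by
    have := (hbl.pow 2).sub ((hAl.const_mul 4).mul (ha1.mul_const (κ - n)))
    convert! this using 2
    ring
  set s0 : ℝ := (κ - n) / (κ - 1) with hs0
  have hsl : Tendsto s atTop (nhds s0) := by
    have := (hbl.sub (hdl.sqrt)).div (hAl.const_mul 2) (by positivity)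
    rw [Real.sqrt_sq hn1.le] at this
    convert! this using 2
    rw [hs0]
    field_simp
    ring
  have hs1 : 1 - s0 = (n - 1) / (κ - 1) := by rw [hs0]; field_simp; ring
  have hs1p : 0 < 1 - s0 := by rw [hs1]; positivity
  have hquad : ∀ᶠ N in atTop, A N * s N ^ 2 - b N * s N + a N * (κ - n) = 0 := by
    filter_upwards [hdl.eventually_const_lt (show (0:ℝ) < ((n : ℝ) - 1) ^ 2 by positivity)] with N hN
    have h1 := Real.sq_sqrt hN.le
    have h2 : 2 * A N * s N = b N - √(disc N) := by
      simp only [hs]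
      have := (hA0 N).ne'
      field_simp
    have h3 : 4 * A N * (A N * s N ^ 2 - b N * s N + a N * (κ - n)) = 0 := by
      have h4 : (b N - 2 * A N * s N) ^ 2 = disc N := by rw [h2, sub_sub_cancel, h1]
      simp only [hdisc] at h4
      linear_combination h4
    have := (hA0 N).ne'
    simpa [this] using h3
  set R : ℕ → ℝ := fun N => (κ * (1 - a N) + (n + 1) * a N) / (A N * (1 - s N)) with hR
  set m : ℝ := (n + 1) / (n - 1) with hm
  have hgl : Tendsto (fun N => κ * (1 - a N) + (n + 1) * a N) atTop (nhds ((n : ℝ) + 1)) := by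
    simpa using (he.const_mul κ).add (ha1.const_mul ((n : ℝ) + 1))
  have hRl : Tendsto R atTop (nhds m) := by
    have := hgl.div (hAl.mul (hsl.const_sub 1)) (by positivity)
    convert! this using 2
    rw [hs1, hm]
    field_simp
  set r : ℕ → ℝ := fun N => 1 + (1 - a N) * R N with hr
  have hm1 : 1 + m = 2 * n / (n - 1) := by rw [hm]; field_simp; ring
  have hm2 : 1 - m = - (2 / (n - 1)) := by rw [hm]; field_simp; ring
  have hrl : Tendsto (fun N : ℕ => (N : ℝ) * (r N - 1)) atTop (nhds μ) := by
    have := hNe.mul hRl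
    rw [hμ, mul_div_assoc, ← hm]
    apply this.congr
    intro N
    simp only [hr]; ring
  have hrp := lim_rpow r μ hrl
  rw [← hE] at hrp
  have hs0lt : |s0| < 1 := by
    rw [hs0, abs_div, abs_of_pos hκ1, div_lt_one hκ1, abs_lt, hκ]
    constructor <;> linarith
  have hsp := lim_pow_zero s s0 hsl hs0lt
  set g : ℕ → ℝ := fun N => 1 / (κ * (1 - a N) + (n + 1) * a N) with hg
  set P1 : ℕ → ℝ := fun N => 1 / (1 + R N) with hP1
  set Q1 : ℕ → ℝ := fun N => 1 / (s N - a N) with hQ1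
  set P2 : ℕ → ℝ := fun N => r N ^ (N + 1) / (1 - a N * R N) with hP2
  set Q2 : ℕ → ℝ := fun N => s N ^ (N + 1) / (1 - a N * s N) with hQ2
  have l1 : Tendsto (fun N => 1 + R N) atTop (nhds (1 + m)) := hRl.const_add 1
  have l2 : Tendsto (fun N => s N - a N) atTop (nhds (s0 - 1)) := hsl.sub ha1
  have l3 : Tendsto (fun N => 1 - a N * R N) atTop (nhds (1 - m)) := by
    simpa using (ha1.mul hRl).const_sub 1
  have l4 : Tendsto (fun N => 1 - a N * s N) atTop (nhds (1 - s0)) := by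
    simpa using (ha1.mul hsl).const_sub 1
  have n1 : 1 + m ≠ 0 := by rw [hm1]; positivity
  have n2 : s0 - 1 ≠ 0 := by linarith
  have n3 : 1 - m ≠ 0 := by rw [hm2]; exact neg_ne_zero.2 (by positivity)
  have n4 : 1 - s0 ≠ 0 := hs1p.ne'
  have hgL : Tendsto g atTop (nhds (1 / ((n : ℝ) + 1))) := lim_cdiv _ _ hgl 1 (by positivity)
  have hP1L : Tendsto P1 atTop (nhds (1 / (1 + m))) := lim_cdiv _ _ l1 1 n1
  have hQ1L : Tendsto Q1 atTop (nhds (1 / (s0 - 1))) := lim_cdiv _ _ l2 1 n2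
  have hP2L : Tendsto P2 atTop (nhds (E / (1 - m))) := hrp.div l3 n3
  have hQ2L : Tendsto Q2 atTop (nhds 0) := by
    have := hsp.div l4 n4
    rwa [zero_div] at this
  set Δ : ℕ → ℝ := fun N => P1 N * Q2 N - P2 N * Q1 N with hΔ
  have hΔL : Tendsto Δ atTop (nhds (1 / (1 + m) * 0 - E / (1 - m) * (1 / (s0 - 1)))) :=
    (hP1L.mul hQ2L).sub (hP2L.mul hQ1L)
  have hΔ0 : 1 / (1 + m) * 0 - E / (1 - m) * (1 / (s0 - 1)) ≠ 0 := by
    rw [mul_zero, zero_sub]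
    exact neg_ne_zero.2 (mul_ne_zero (div_ne_zero hE0.ne' n3) (div_ne_zero one_ne_zero n2))
  refine ⟨fun N => (1 - a N) * g N, fun N => (1 - a N) * (-g N * (Q2 N - Q1 N) / Δ N),
    fun N => -g N * (P1 N - P2 N) / Δ N, r, s, s0, ?_, ?_, ?_, ?_, hsl, hs0lt, hrl, ?_⟩
  · filter_upwards [hquad, hNe.eventually_ne hρT.ne', hgl.eventually_ne (by positivity),
      l1.eventually_ne n1, l2.eventually_ne n2, l3.eventually_ne n3, l4.eventually_ne n4,
      hΔL.eventually_ne hΔ0, (hsl.const_sub 1).eventually_ne n4] with N k0 k1 k2 k3 k4 k5 k6 k7 k8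
    have k1' : 1 - a N ≠ 0 := right_ne_zero_of_mul k1
    have ra : r N - a N = (1 - a N) * (1 + R N) := by simp only [hr]; ring
    have ra2 : 1 - a N * r N = (1 - a N) * (1 - a N * R N) := by simp only [hr]; ring
    have hAne := (hA0 N).ne'
    have hra : r N - a N ≠ 0 := by rw [ra]; exact mul_ne_zero k1' k3
    have hra2 : 1 - a N * r N ≠ 0 := by rw [ra2]; exact mul_ne_zero k1' k5
    have hRmul : R N * (A N * (1 - s N)) = κ * (1 - a N) + (n + 1) * a N := by
      simp only [hR]; rw [div_mul_cancel₀ _ (mul_ne_zero hAne k8)]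
    have hrs : A N * (r N + s N) = b N := by
      have : (1 - s N) * (A N * (r N + s N) - b N) = 0 := by
        simp only [hr]
        have hbN : b N = κ * (1 + a N ^ 2) - (n + 1) * a N ^ 2 := rfl
        have hAN : A N = a N * (κ - 1) := rfl
        rw [hbN] at k0 ⊢
        rw [hAN] at k0 hRmul ⊢
        linear_combination (1 - a N) * hRmul - k0
      have := (mul_eq_zero.1 this).resolve_left k8
      linarith
    have kr : A N * r N ^ 2 - b N * r N + a N * (κ - n) = 0 := by
      linear_combination k0 + (r N - s N) * hrs
    have char : ∀ z, A N * z ^ 2 - b N * z + a N * (κ - n) = 0 → z - a N ≠ 0 → 1 - a N * z ≠ 0 →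
        κ + n * a N / (z - a N) + a N * z / (1 - a N * z) = 0 := by
      intro z hz z1 z2
      have hbN : b N = κ * (1 + a N ^ 2) - (n + 1) * a N ^ 2 := rfl
      have hAN : A N = a N * (κ - 1) := rfl
      rw [hbN, hAN] at hz
      have e : κ + n * a N / (z - a N) + a N * z / (1 - a N * z)
          = (κ * (z - a N) * (1 - a N * z) + n * a N * (1 - a N * z) + a N * z * (z - a N))
            / ((z - a N) * (1 - a N * z)) := by
        rw [eq_div_iff (mul_ne_zero z1 z2)]
        generalize hz1 : z - a N = w1 at *
        generalize hz2 : 1 - a N * z = w2 at *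
        field_simp
      rw [e]
      rw [div_eq_zero_iff]; left
      linear_combination -hz
    apply aux_sol_nu ρ T θ hρ hT hθ n N (a N) κ _ _ _ _ _ rfl hκ k1' hra hra2 k4 k6
      (char _ kr hra hra2) (char _ k0 k4 k6)
    · have e : κ + (n + 1) * a N / (1 - a N) = (κ * (1 - a N) + (n + 1) * a N) / (1 - a N) := by
        rw [add_div, mul_div_cancel_right₀ _ k1']
      rw [e]
      simp only [hg]
      generalize κ * (1 - a N) + (n + 1) * a N = w1 at *
      generalize 1 - a N = w2 at *
      field_simp
    · have e1 : (1 - a N) * g N / (1 - a N) = g N := by field_simp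
      have e2 : (1 - a N) * (-g N * (Q2 N - Q1 N) / Δ N) / (r N - a N)
          = (-g N * (Q2 N - Q1 N) / Δ N) * P1 N := by
        rw [ra, mul_div_mul_left _ _ k1']; simp only [hP1]; ring
      have e3 : -g N * (P1 N - P2 N) / Δ N / (s N - a N) = -g N * (P1 N - P2 N) / Δ N * Q1 N := by
        simp only [hQ1]; ring
      rw [e1, e2, e3]
      field_simp
      simp only [hΔ]; ring
    · have e1 : (1 - a N) * g N / (1 - a N) = g N := by field_simp
      have e2 : (1 - a N) * (-g N * (Q2 N - Q1 N) / Δ N) * r N ^ (N + 1) / (1 - a N * r N)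
          = (-g N * (Q2 N - Q1 N) / Δ N) * P2 N := by
        rw [ra2, mul_assoc, mul_div_mul_left _ _ k1']; simp only [hP2]; ring
      have e3 : -g N * (P1 N - P2 N) / Δ N * s N ^ (N + 1) / (1 - a N * s N)
          = -g N * (P1 N - P2 N) / Δ N * Q2 N := by
        simp only [hQ2]; ring
      rw [e1, e2, e3]
      field_simp
      simp only [hΔ]; ring
  · have := hNe.mul hgL
    rw [mul_one_div] at this
    apply this.congr
    intro N; ring
  · have := hNe.mul ((hgL.neg.mul (hQ2L.sub hQ1L)).div hΔL hΔ0)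
    have e : ρ * T * (-(1 / ((n : ℝ) + 1)) * (0 - 1 / (s0 - 1)) /
        (1 / (1 + m) * 0 - E / (1 - m) * (1 / (s0 - 1))))
        = ρ * T * (2 / ((n + 1) * (n - 1) * E)) := by
      rw [hm2, hm1, mul_zero]
      field_simp
      try ring
    rw [e] at this
    apply this.congr
    intro N
    simp only [Pi.div_apply]; ring
  · have := ((hgL.neg.mul (hP1L.sub hP2L)).div hΔL hΔ0)
    have e : (-(1 / ((n : ℝ) + 1)) * (1 / (1 + m) - E / (1 - m)) /
        (1 / (1 + m) * 0 - E / (1 - m) * (1 / (s0 - 1))))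
        = (1 - s0) * (1 / (n + 1) + 1 / (n * (n + 1) * E)) := by
      rw [hm2, hm1, mul_zero]
      field_simp
      try ring
    rw [e] at this
    exact this
  · have : 1 - s0 ^ 2 = (1 - s0) * (4 * θ / (κ - 1)) := by
      rw [hs1, hs0]
      field_simp
      rw [hκ]; ring
    rw [this, hs1]
    field_simp
/-- Convergence of the discrete equilibrium execution costs to the continuous-time
equilibrium cost `𝓘 + 𝓑₀ + 𝓑_T`. -/
theorem stmt12 (n : ℕ) (hn : 2 ≤ n) (ρ T θ : ℝ) (hρ : 0 < ρ) (hT : 0 < T) (hθ : 0 < θ)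
    (x : Fin n → ℝ) (xb : ℝ) (hxb : xb = (∑ j, x j) / (n : ℝ))
    (E D : ℝ)
    (hE : E = Real.exp (ρ * T * ((n : ℝ) + 1) / ((n : ℝ) - 1)))
    (hD : D = (n : ℝ) * ((ρ * T + 1) * ((n : ℝ) + 1) + 2) * E - ((n : ℝ) - 1)) :
    ∀ i : Fin n,
      Tendsto (fun N : ℕ => costN n N ρ T θ x i) atTop
        (nhds
          (((n : ℝ) / (ρ * T + 1)) * xb * (x i - xb)
            + xb ^ 2 * (n : ℝ) ^ 3 * ((n : ℝ) + 1) *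
                (((ρ * T + 1 / 2) * ((n : ℝ) + 1) + 3) * E ^ 2
                  - (2 * ((n : ℝ) - 1) / (n : ℝ) ^ 2) * ((n : ℝ) * E + 1 / 4)) / D ^ 2
            + ((n : ℝ) - 1) * ((n : ℝ) + 1) ^ 2 * (1 + (n : ℝ) * E) ^ 2 * xb ^ 2
                / (4 * D ^ 2)
            + (x i - xb) ^ 2 / (4 * (ρ * T + 1) ^ 2))) := by

  intro i
  set μ : ℝ := ρ * T * ((n : ℝ) + 1) / ((n : ℝ) - 1) with hμ
  have hn2 : (2 : ℝ) ≤ n := by exact_mod_cast hn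
  have hn1 : (0 : ℝ) < n - 1 := by linarith
  have hμ0 : 0 < μ := by positivity
  have hE1 : 1 ≤ E := by rw [hE]; exact Real.one_le_exp hμ0.le
  have hE0 : 0 < E := by linarith
  have hD0 : 0 < D := by
    rw [hD]
    have : (n : ℝ) * 1 * 1 ≤ n * ((ρ * T + 1) * (n + 1) + 2) * E := by
      gcongr
      nlinarith [mul_pos hρ hT]
    linarith
  have hρT : 0 < ρ * T := by positivity
  obtain ⟨d, δ, q, q0, om, hd, hδ, hq, hq0, hqe⟩ := om_asym ρ T θ hρ hT hθ
  obtain ⟨c, α, β, r, s, s0, nu, hc, hα, hβ, hs, hs0, hr, hse⟩ :=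
    nu_asym ρ T θ hρ hT hθ n hn E μ hμ hE
  have hs1 : 1 - s0 ≠ 0 := by linarith [(abs_lt.1 hs0).2]
  have hq1 : 1 - q0 ≠ 0 := by linarith [(abs_lt.1 hq0).2]
  have hz : Tendsto (fun N : ℕ => (N : ℝ) * (0 : ℝ)) atTop (nhds 0) := by simp
  have L1 := lim_sum1 c α β r s _ _ _ s0 μ hμ0.ne' hc hα hβ hs hs0 hr
  have L2 := lim_sum2 c α β r s _ _ _ s0 μ hμ0.ne' hc hα hβ hs hs0 hr
  have L3 := lim_sum1 d (fun _ => 0) δ r q _ _ _ q0 μ hμ0.ne' hd hz hδ hq hq0 hr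
  have L4 := lim_sum2 d (fun _ => 0) δ r q _ _ _ q0 μ hμ0.ne' hd hz hδ hq hq0 hr
  have L5 := lim_sum5 c α β r s d δ q _ _ _ s0 μ _ _ q0 hμ0.ne' hc hα hβ hs hs0 hr hd hδ hq hq0
  have v1 : ρ * T / (n + 1) + ρ * T * (2 / ((n + 1) * (n - 1) * E)) * ((Real.exp μ - 1) / μ)
      + (1 - s0) * (1 / (n + 1) + 1 / (n * (n + 1) * E)) * (1 / (1 - s0))
      = D / (n * (n + 1) ^ 2 * E) := by
    rw [← hE, hμ, hD]
    field_simp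
    ring
  have v2 : ((1 - s0) * (1 / ((n : ℝ) + 1) + 1 / (n * (n + 1) * E))) ^ 2 / (1 - s0 ^ 2)
      = (n - 1) / (4 * θ) * ((n * E + 1) / (n * (n + 1) * E)) ^ 2 := by
    rw [mul_pow, mul_div_right_comm, hse]
    congr 2
    field_simp
  have v3 : ρ * T + 0 * ((Real.exp μ - 1) / μ) + (1 - q0) * (1 / (1 - q0)) = ρ * T + 1 := by
    field_simp
    ring
  rw [v1] at L1
  rw [v2] at L2
  rw [v3] at L3
  rw [hqe] at L4
  have S1 : Tendsto (fun N => ∑ k, nuN n N ρ T θ k) atTop (nhds (D / (n * (n + 1) ^ 2 * E))) := by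
    apply L1.congr'
    filter_upwards [nu] with N hN
    rw [hN, ← Fin.sum_univ_eq_sum_range]
  have S2 : Tendsto (fun N => nuN n N ρ T θ ⬝ᵥ nuN n N ρ T θ) atTop
      (nhds ((n - 1) / (4 * θ) * ((n * E + 1) / (n * (n + 1) * E)) ^ 2)) := by
    apply L2.congr'
    filter_upwards [nu] with N hN
    rw [hN, ← Fin.sum_univ_eq_sum_range, dotProduct]
    exact Finset.sum_congr rfl (fun j _ => by ring)
  have S3 : Tendsto (fun N => ∑ k, omN N ρ T θ k) atTop (nhds (ρ * T + 1)) := by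
    apply L3.congr'
    filter_upwards [om] with N hN
    rw [hN, Fin.sum_univ_eq_sum_range (fun j => d N + δ N * q N ^ (N - j)),
      lim_refl (q N) N (fun x => d N + δ N * x)]
    exact Finset.sum_congr rfl (fun j _ => by ring)
  have S4 : Tendsto (fun N => omN N ρ T θ ⬝ᵥ omN N ρ T θ) atTop (nhds (1 / (4 * θ))) := by
    apply L4.congr'
    filter_upwards [om] with N hN
    rw [hN, dotProduct, Fin.sum_univ_eq_sum_range (fun j => (d N + δ N * q N ^ (N - j))
      * (d N + δ N * q N ^ (N - j))),
      lim_refl (q N) N (fun x => (d N + δ N * x) * (d N + δ N * x))]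
    exact Finset.sum_congr rfl (fun j _ => by ring)
  have S5 : Tendsto (fun N => nuN n N ρ T θ ⬝ᵥ omN N ρ T θ) atTop (nhds 0) := by
    apply L5.congr'
    filter_upwards [om, nu] with N hN hN2
    rw [hN, hN2, dotProduct, Fin.sum_univ_eq_sum_range (fun j =>
      (c N + α N * r N ^ j + β N * s N ^ j) * (d N + δ N * q N ^ (N - j)))]
  have n1 : D / (n * (n + 1) ^ 2 * E) ≠ 0 := by positivity
  have n3 : ρ * T + 1 ≠ 0 := by positivity
  have F := ((((lim_cdiv _ _ S1 1 n1).const_mul ((n : ℝ) / (n + 1))).sub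
      ((S2.div (S1.pow 2) (pow_ne_zero 2 n1)).const_mul (((n : ℝ) - 1) / (n + 1) * θ))).const_mul
      (xb ^ 2)).add ((((lim_cdiv _ _ S3 1 n3).const_mul (n : ℝ)).add
      ((S5.div (S1.mul S3) (mul_ne_zero n1 n3)).const_mul (2 * θ * (1 - n)))).const_mul
      (xb * (x i - xb))) |>.add (((S4.div (S3.pow 2) (pow_ne_zero 2 n3)).const_mul θ).const_mul
      ((x i - xb) ^ 2))
  have hfin : xb ^ 2 * ((n : ℝ) / (n + 1) * (1 / (D / (n * (n + 1) ^ 2 * E)))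
        - ((n : ℝ) - 1) / (n + 1) * θ * ((n - 1) / (4 * θ) * ((n * E + 1) / (n * (n + 1) * E)) ^ 2
          / (D / (n * (n + 1) ^ 2 * E)) ^ 2))
      + xb * (x i - xb) * (n * (1 / (ρ * T + 1))
        + 2 * θ * (1 - n) * (0 / (D / (n * (n + 1) ^ 2 * E) * (ρ * T + 1))))
      + (x i - xb) ^ 2 * (θ * (1 / (4 * θ) / (ρ * T + 1) ^ 2))
      = (((n : ℝ) / (ρ * T + 1)) * xb * (x i - xb)
            + xb ^ 2 * (n : ℝ) ^ 3 * ((n : ℝ) + 1) *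
                (((ρ * T + 1 / 2) * ((n : ℝ) + 1) + 3) * E ^ 2
                  - (2 * ((n : ℝ) - 1) / (n : ℝ) ^ 2) * ((n : ℝ) * E + 1 / 4)) / D ^ 2
            + ((n : ℝ) - 1) * ((n : ℝ) + 1) ^ 2 * (1 + (n : ℝ) * E) ^ 2 * xb ^ 2
                / (4 * D ^ 2)
            + (x i - xb) ^ 2 / (4 * (ρ * T + 1) ^ 2)) := by
    have t1 : xb ^ 2 * ((n : ℝ) / (n + 1) * (1 / (D / (n * (n + 1) ^ 2 * E)))
        - ((n : ℝ) - 1) / (n + 1) * θ * ((n - 1) / (4 * θ) * ((n * E + 1) / (n * (n + 1) * E)) ^ 2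
          / (D / (n * (n + 1) ^ 2 * E)) ^ 2))
        = xb ^ 2 * (n ^ 2 * (n + 1) * E * D - (n - 1) ^ 2 * (n + 1) * (n * E + 1) ^ 2 / 4) / D ^ 2 := by
      field_simp
    have t2 : xb ^ 2 * (n : ℝ) ^ 3 * ((n : ℝ) + 1) *
                (((ρ * T + 1 / 2) * ((n : ℝ) + 1) + 3) * E ^ 2
                  - (2 * ((n : ℝ) - 1) / (n : ℝ) ^ 2) * ((n : ℝ) * E + 1 / 4)) / D ^ 2
            + ((n : ℝ) - 1) * ((n : ℝ) + 1) ^ 2 * (1 + (n : ℝ) * E) ^ 2 * xb ^ 2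
                / (4 * D ^ 2)
        = xb ^ 2 * (n ^ 2 * (n + 1) * E * D - (n - 1) ^ 2 * (n + 1) * (n * E + 1) ^ 2 / 4) / D ^ 2 := by
      have t3 : (n : ℝ) ^ 3 * ((2 * ((n : ℝ) - 1) / (n : ℝ) ^ 2)) = 2 * n * (n - 1) := by
        field_simp
      have t4 : xb ^ 2 * (n : ℝ) ^ 3 * ((n : ℝ) + 1) *
                (((ρ * T + 1 / 2) * ((n : ℝ) + 1) + 3) * E ^ 2
                  - (2 * ((n : ℝ) - 1) / (n : ℝ) ^ 2) * ((n : ℝ) * E + 1 / 4))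
          = xb ^ 2 * ((n : ℝ) + 1) * (n ^ 3 * ((ρ * T + 1 / 2) * ((n : ℝ) + 1) + 3) * E ^ 2
            - 2 * n * (n - 1) * ((n : ℝ) * E + 1 / 4)) := by
        rw [← t3]; ring
      rw [t4, show ∀ z : ℝ, z / (4 * D ^ 2) = z / 4 / D ^ 2 from fun z => by rw [div_div],
        ← add_div]
      congr 1
      rw [hD]; ring
    rw [t1, ← t2]
    field_simp
    ring
  rw [← hfin]
  apply F.congr'
  filter_upwards [S1.eventually_ne n1, S3.eventually_ne n3] with N h1 h3
  exact (aux_cost ρ T θ hρ hT n N hn x i xb (x i - xb) hxb rfl (aux_nu_spec ρ T θ hρ hT hθ n N)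
    (aux_om_spec ρ T θ hρ hT hθ N) _ _ _ _ _ rfl rfl rfl rfl rfl
    h1 h3).symm
end
end

section
/- Let n ≥ 2 be an integer, ρ > 0, T > 0, θ > 0, x_1,…,x_n ∈ ℝ with mean x̄, and c ∈ (0,1); set m_N := ⌈cN⌉. For each N ≥ 2 let ξ^{(N)}_i := x̄·v^{(N)} + (x_i − x̄)·w^{(N)} ∈ ℝ^{N+1} be the equilibrium strategy on the equidistant N-step grid. Then, with E := e^{ρT(n+1)/(n−1)} and D := n((ρT+1)(n+1)+2)·E − (n−1), the cumulative initial and terminal instantaneous costs converge to the block costs of the continuous-time equilibrium: θ·Σ_{k=1}^{m_N} (ξ^{(N)}_{i,k})² → 𝓑_0 := (n−1)(n+1)²·(1 + n·E)²·x̄²/(4D²) and θ·Σ_{k=m_N+1}^{N+1} (ξ^{(N)}_{i,k})² → 𝓑_T := (x_i−x̄)²/(4(ρT+1)²) as N → ∞, for each i. Moreover these limits do not depend on c ∈ (0,1) or on θ > 0. -/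
open Matrix Finset Filter

noncomputable section

/-- left sums -/
def Ls (a : ℝ) (f : ℕ → ℝ) (i : ℕ) : ℝ := ∑ j ∈ Finset.range i, a ^ (i - j) * f j

/-- right sums -/
def Us (N : ℕ) (a : ℝ) (f : ℕ → ℝ) (i : ℕ) : ℝ := ∑ j ∈ Finset.Ico (i + 1) (N + 1), a ^ (j - i) * f j

lemma Ls_zero (a : ℝ) (f : ℕ → ℝ) : Ls a f 0 = 0 := by simp [Ls]

lemma Ls_succ (a : ℝ) (f : ℕ → ℝ) (i : ℕ) : Ls a f (i + 1) = a * (Ls a f i + f i) := by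
  unfold Ls
  rw [Finset.sum_range_succ, mul_add, Finset.mul_sum]
  congr 1
  · apply Finset.sum_congr rfl
    intro j hj
    rw [Finset.mem_range] at hj
    rw [show i + 1 - j = (i - j) + 1 by omega, pow_succ]
    ring
  · simp

lemma Us_last (N : ℕ) (a : ℝ) (f : ℕ → ℝ) : Us N a f N = 0 := by simp [Us]

lemma Us_rec (N : ℕ) (a : ℝ) (f : ℕ → ℝ) (i : ℕ) (hi : i < N) :
    Us N a f i = a * (Us N a f (i + 1) + f (i + 1)) := by
  unfold Us
  rw [Finset.sum_eq_sum_Ico_succ_bot (by omega), mul_add, Finset.mul_sum, add_comm]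
  congr 1
  · apply Finset.sum_congr rfl
    intro j hj
    rw [Finset.mem_Ico] at hj
    rw [show j - i = (j - (i + 1)) + 1 by omega, pow_succ]
    ring
  · simp

lemma Ls_unique (a : ℝ) (f L : ℕ → ℝ) (h0 : L 0 = 0) (h : ∀ i, L (i + 1) = a * (L i + f i)) (i : ℕ) :
    Ls a f i = L i := by
  induction i with
  | zero => rw [Ls_zero, h0]
  | succ i ih => rw [Ls_succ, h, ih]

lemma Us_unique (N : ℕ) (a : ℝ) (f U : ℕ → ℝ) (h0 : U N = 0)
    (h : ∀ i, i < N → U i = a * (U (i + 1) + f (i + 1))) (i : ℕ) (hi : i ≤ N) :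
    Us N a f i = U i := by
  induction hi using Nat.decreasingInduction with
  | self => rw [Us_last, h0]
  | of_succ k hk ih => rw [Us_rec N a f k hk, h k hk, ih]

/-- the model matrix -/
def kmat (N : ℕ) (a p d : ℝ) : Matrix (Fin (N + 1)) (Fin (N + 1)) ℝ :=
  Matrix.of (fun i j => if j.val < i.val then p * a ^ (i.val - j.val)
    else if i.val = j.val then d else a ^ (j.val - i.val))

lemma kmat_mulVec (N : ℕ) (a p d : ℝ) (f : ℕ → ℝ) (i : Fin (N + 1)) :
    (kmat N a p d).mulVec (fun k => f k.val) i = p * Ls a f i.val + d * f i.val + Us N a f i.val := by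
  have h1 : (kmat N a p d).mulVec (fun k => f k.val) i
      = ∑ j ∈ Finset.range (N + 1), (if j < i.val then p * a ^ (i.val - j)
    else if i.val = j then d else a ^ (j - i.val)) * f j := by
    rw [← Fin.sum_univ_eq_sum_range (fun j => (if j < i.val then p * a ^ (i.val - j)
    else if i.val = j then d else a ^ (j - i.val)) * f j)]
    rfl
  have hi := i.isLt
  rw [h1, Finset.range_eq_Ico, ← Finset.sum_Ico_consecutive _ (Nat.zero_le i.val) hi.le,
    Finset.sum_eq_sum_Ico_succ_bot hi, ← add_assoc, ← Finset.range_eq_Ico]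
  congr 1
  · congr 1
    · unfold Ls
      rw [Finset.mul_sum]
      apply Finset.sum_congr rfl
      intro j hj
      rw [Finset.mem_range] at hj
      rw [if_pos hj]; ring
    · simp
  · unfold Us
    apply Finset.sum_congr rfl
    intro j hj
    rw [Finset.mem_Ico] at hj
    rw [if_neg (by omega), if_neg (by omega)]

lemma sum_swap (N : ℕ) (a : ℝ) (f : ℕ → ℝ) :
    ∑ i ∈ Finset.range (N + 1), f i * Us N a f i = ∑ i ∈ Finset.range (N + 1), f i * Ls a f i := by
  unfold Us Ls
  simp_rw [Finset.mul_sum]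
  rw [Finset.sum_comm' (t' := Finset.range (N + 1)) (s' := fun j => Finset.range j)]
  · apply Finset.sum_congr rfl
    intro j hj
    apply Finset.sum_congr rfl
    intro i hi
    ring
  · intro x y
    simp only [Finset.mem_range, Finset.mem_Ico]
    omega

lemma sum_pos (N : ℕ) (a : ℝ) (ha0 : 0 ≤ a) (ha : a ≤ 1) (f : ℕ → ℝ) :
    0 ≤ ∑ i ∈ Finset.range N, (2 * (f i * Ls a f i) + f i ^ 2) := by
  have key : (Ls a f N) ^ 2 ≤ ∑ i ∈ Finset.range N, (2 * (f i * Ls a f i) + f i ^ 2) := by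
    induction N with
    | zero => simp [Ls_zero]
    | succ N ih =>
      rw [Finset.sum_range_succ, Ls_succ]
      have : a ^ 2 ≤ 1 := by nlinarith
      nlinarith [sq_nonneg (Ls a f N + f N)]
  exact (sq_nonneg _).trans key

lemma kmat_inj (N : ℕ) (a p θ : ℝ) (ha0 : 0 ≤ a) (ha : a ≤ 1) (hp : 0 ≤ p) (hθ : 0 < θ) :
    IsUnit (kmat N a p ((p + 1) / 2 + 2 * θ)) := by
  rw [← Matrix.mulVec_injective_iff_isUnit]
  intro x y hxy
  set M := kmat N a p ((p + 1) / 2 + 2 * θ) with hM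
  have hz : M.mulVec (x - y) = 0 := by rw [Matrix.mulVec_sub]; exact sub_eq_zero.mpr hxy
  set f : ℕ → ℝ := fun k => if h : k < N + 1 then (x - y) ⟨k, h⟩ else 0 with hf
  have hfx : (fun k : Fin (N + 1) => f k.val) = x - y := by
    funext k; simp only [hf, k.isLt, dif_pos]
  have hrow : ∀ i ∈ Finset.range (N + 1),
      p * Ls a f i + ((p + 1) / 2 + 2 * θ) * f i + Us N a f i = 0 := by
    intro i hi
    rw [Finset.mem_range] at hi
    have := kmat_mulVec N a p ((p + 1) / 2 + 2 * θ) f ⟨i, hi⟩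
    rw [hfx, ← hM, hz] at this
    exact this.symm
  have h1 : ∑ i ∈ Finset.range (N + 1),
      f i * (p * Ls a f i + ((p + 1) / 2 + 2 * θ) * f i + Us N a f i) = 0 := by
    apply Finset.sum_eq_zero
    intro i hi
    rw [hrow i hi, mul_zero]
  have h2 : ∑ i ∈ Finset.range (N + 1),
      f i * (p * Ls a f i + ((p + 1) / 2 + 2 * θ) * f i + Us N a f i)
      = (p + 1) / 2 * ∑ i ∈ Finset.range (N + 1), (2 * (f i * Ls a f i) + f i ^ 2)
        + 2 * θ * ∑ i ∈ Finset.range (N + 1), f i ^ 2 := by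
    have h3 : ∀ i, f i * (p * Ls a f i + ((p + 1) / 2 + 2 * θ) * f i + Us N a f i)
      = p * (f i * Ls a f i) + ((p + 1) / 2 + 2 * θ) * f i ^ 2 + f i * Us N a f i := by
      intro i; ring
    simp_rw [h3]
    rw [Finset.sum_add_distrib, sum_swap, Finset.sum_add_distrib, Finset.sum_add_distrib,
      ← Finset.mul_sum, ← Finset.mul_sum, ← Finset.mul_sum]
    ring
  have h4 := sum_pos (N + 1) a ha0 ha f
  have h5 : ∑ i ∈ Finset.range (N + 1), f i ^ 2 = 0 := by
    have h6 : 0 ≤ ∑ i ∈ Finset.range (N + 1), f i ^ 2 := Finset.sum_nonneg (fun i _ => sq_nonneg _)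
    rw [h1] at h2
    have h7 : 0 ≤ (p + 1) / 2 * ∑ i ∈ Finset.range (N + 1), (2 * (f i * Ls a f i) + f i ^ 2) := by
      positivity
    have h8 : 0 ≤ 2 * θ * ∑ i ∈ Finset.range (N + 1), f i ^ 2 := by positivity
    have h9 : 2 * θ * ∑ i ∈ Finset.range (N + 1), f i ^ 2 = 0 := by linarith
    rcases mul_eq_zero.mp h9 with h | h
    · linarith
    · exact h
  rw [Finset.sum_eq_zero_iff_of_nonneg (fun i _ => sq_nonneg _)] at h5
  have : x - y = 0 := by
    rw [← hfx]
    funext k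
    have := h5 k.val (Finset.mem_range.mpr k.isLt)
    simpa using this
  exact sub_eq_zero.mp this

lemma inv_eq_of_sol (N : ℕ) (a p θ : ℝ) (ha0 : 0 ≤ a) (ha : a ≤ 1) (hp : 0 ≤ p) (hθ : 0 < θ)
    (f : ℕ → ℝ)
    (h : ∀ i, i ≤ N → p * Ls a f i + ((p + 1) / 2 + 2 * θ) * f i + Us N a f i = 1) :
    (kmat N a p ((p + 1) / 2 + 2 * θ))⁻¹.mulVec 1 = fun k => f k.val := by
  have hu := kmat_inj N a p θ ha0 ha hp hθ
  have : (1 : Fin (N + 1) → ℝ) = (kmat N a p ((p + 1) / 2 + 2 * θ)).mulVec (fun k => f k.val) := by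
    funext k
    rw [kmat_mulVec, h _ (Nat.lt_succ_iff.mp k.isLt)]
    rfl
  rw [this, Matrix.mulVec_mulVec, Matrix.nonsing_inv_mul _ ((Matrix.isUnit_iff_isUnit_det _).mp hu),
    Matrix.one_mulVec]

/-- decay factor -/
def av (ρ T : ℝ) (N : ℕ) : ℝ := Real.exp (-(ρ * T / N))

lemma exp_grid (ρ T : ℝ) (N : ℕ) (i j : ℕ) (h : j ≤ i) :
    Real.exp (-(ρ * ((i : ℝ) * T / (N : ℝ) - (j : ℝ) * T / (N : ℝ)))) = av ρ T N ^ (i - j) := by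
  unfold av
  rw [← Real.exp_nat_mul, Nat.cast_sub h]
  congr 1
  ring

lemma abs_grid (T : ℝ) (hT : 0 < T) (N : ℕ) (i j : ℕ) (h : j ≤ i) :
    0 ≤ (i : ℝ) * T / (N : ℝ) - (j : ℝ) * T / (N : ℝ) := by
  have : (j : ℝ) ≤ i := by exact_mod_cast h
  rw [sub_nonneg]
  gcongr

lemma mat_nu (n N : ℕ) (ρ T θ : ℝ) (hT : 0 < T) :
    Gam ρ θ (egrid T N) + ((n : ℝ) - 1) • GamT ρ (egrid T N)
      = kmat N (av ρ T N) n (((n : ℝ) + 1) / 2 + 2 * θ) := by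
  ext i j
  simp only [Gam, GamT, kmat, egrid, Matrix.add_apply, Matrix.smul_apply, Matrix.of_apply, smul_eq_mul]
  rcases lt_trichotomy i j with h | h | h
  · have h' : i.val < j.val := h
    rw [if_neg h.ne, if_pos h, if_neg (by omega), if_neg (by omega), abs_sub_comm,
      abs_of_nonneg (abs_grid T hT N _ _ h'.le), exp_grid _ _ _ _ _ h'.le]
    ring
  · subst h
    simp
    ring
  · have h' : j.val < i.val := h
    rw [if_neg h.ne', if_neg h.not_gt, if_neg h.ne', if_pos h',
      abs_of_nonneg (abs_grid T hT N _ _ h'.le), exp_grid _ _ _ _ _ h'.le]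
    ring

lemma mat_om (N : ℕ) (ρ T θ : ℝ) (hT : 0 < T) :
    Gam ρ θ (egrid T N) - GamT ρ (egrid T N)
      = kmat N (av ρ T N) 0 (((0 : ℝ) + 1) / 2 + 2 * θ) := by
  ext i j
  simp only [Gam, GamT, kmat, egrid, Matrix.sub_apply, Matrix.of_apply]
  rcases lt_trichotomy i j with h | h | h
  · have h' : i.val < j.val := h
    rw [if_neg h.ne, if_pos h, if_neg (by omega), if_neg (by omega), abs_sub_comm,
      abs_of_nonneg (abs_grid T hT N _ _ h'.le), exp_grid _ _ _ _ _ h'.le]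
    ring
  · subst h
    simp
    ring
  · have h' : j.val < i.val := h
    rw [if_neg h.ne', if_neg h.not_gt, if_neg h.ne', if_pos h',
      abs_of_nonneg (abs_grid T hT N _ _ h'.le), exp_grid _ _ _ _ _ h'.le]
    ring

lemma sol_nu (N : ℕ) (a p d A B C l m : ℝ) (ha : 1 - a ≠ 0) (h1 : l - a ≠ 0) (h2 : 1 - a * l ≠ 0)
    (h3 : m - a ≠ 0) (h4 : 1 - a * m ≠ 0)
    (hA : A * (p * a / (1 - a) + d + a / (1 - a)) = 1)
    (hl : p * a * (1 - a * l) + d * (l - a) * (1 - a * l) + a * l * (l - a) = 0)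
    (hm : p * a * (1 - a * m) + d * (m - a) * (1 - a * m) + a * m * (m - a) = 0)
    (c1 : A / (1 - a) + B / (l - a) + C / (m - a) = 0)
    (c2 : A / (1 - a) + B * l ^ (N + 1) / (1 - a * l) + C * m ^ (N + 1) / (1 - a * m) = 0) :
    ∀ i, i ≤ N → p * Ls a (fun i => A + B * l ^ i + C * m ^ i) i
      + d * (A + B * l ^ i + C * m ^ i) + Us N a (fun i => A + B * l ^ i + C * m ^ i) i = 1 := by
  intro i hi
  have hl' : p * a / (l - a) + d + a * l / (1 - a * l) = 0 := by
    field_simp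
    linarith
  have hm' : p * a / (m - a) + d + a * m / (1 - a * m) = 0 := by
    field_simp
    linarith
  have e1 : ∀ z, z - a ≠ 0 → a * (a / (z - a) + 1) = a * z / (z - a) := by
    intro z hz; field_simp; ring
  have e2 : ∀ z, 1 - a * z ≠ 0 → a * (a * z * z / (1 - a * z) + z) = a * z / (1 - a * z) := by
    intro z hz; field_simp; ring
  have hL := Ls_unique a (fun i => A + B * l ^ i + C * m ^ i)
    (fun i => A * (a / (1 - a)) + B * l ^ i * (a / (l - a)) + C * m ^ i * (a / (m - a)))
    (by linear_combination a * c1)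
    (by
      intro i
      have := e1 1 ha
      have := e1 l h1
      have := e1 m h3
      linear_combination (-A) * e1 1 ha - B * l ^ i * e1 l h1 - C * m ^ i * e1 m h3) i
  have hU := Us_unique N a (fun i => A + B * l ^ i + C * m ^ i)
    (fun i => A * (a / (1 - a)) + B * l ^ i * (a * l / (1 - a * l)) + C * m ^ i * (a * m / (1 - a * m)))
    (by linear_combination a * c2)
    (by
      intro i _
      have h5 := e2 1 (by simpa using ha)
      simp only [mul_one] at h5
      linear_combination (-A) * h5 - B * l ^ i * e2 l h2 - C * m ^ i * e2 m h4) i hi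
  rw [hL, hU]
  linear_combination hA + B * l ^ i * hl' + C * m ^ i * hm'

lemma sol_om (N : ℕ) (a k : ℝ) (hk : k ≠ 0) (hk2 : k * (1 - a) + a ≠ 0) (w q g : ℝ)
    (hw : w = (1 - a) / (k * (1 - a) + a)) (hq : q = a * (1 - 1 / k)) (hg : g = 1 / k - w) :
    ∀ i, i ≤ N → 0 * Ls a (fun i => w + g * q ^ (N - i)) i
      + k * (w + g * q ^ (N - i)) + Us N a (fun i => w + g * q ^ (N - i)) i = 1 := by
  intro i hi
  have hU := Us_unique N a (fun i => w + g * q ^ (N - i))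
    (fun i => 1 - k * (w + g * q ^ (N - i)))
    (by simp only [Nat.sub_self, pow_zero, hg]; field_simp; ring)
    (by
      intro i h
      rw [show N - i = (N - (i + 1)) + 1 by omega, pow_succ]
      have e1 : k * q = a * (k - 1) := by rw [hq]; field_simp
      have e2 : w * (k * (1 - a) + a) = 1 - a := by rw [hw]; exact div_mul_cancel₀ _ hk2
      linear_combination (-g * q ^ (N - (i + 1))) * e1 - e2) i hi
  rw [hU]
  ring
lemma pow_tendsto_zero (q : ℕ → ℝ) (q0 : ℝ) (hq : Tendsto q atTop (nhds q0)) (h0 : |q0| < 1)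
    (m : ℕ → ℕ) (hm : Tendsto m atTop atTop) :
    Tendsto (fun N => q N ^ m N) atTop (nhds 0) := by
  obtain ⟨r, hr1, hr2⟩ := exists_between h0
  have hr0 : 0 ≤ r := (abs_nonneg _).trans hr1.le
  have h1 : Tendsto (fun N => r ^ m N) atTop (nhds 0) :=
    (tendsto_pow_atTop_nhds_zero_of_lt_one hr0 hr2).comp hm
  apply squeeze_zero_norm' _ h1
  filter_upwards [hq.abs.eventually_lt_const hr1] with N hN
  rw [Real.norm_eq_abs, abs_pow]
  exact pow_le_pow_left₀ (abs_nonneg _) hN.le _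

lemma sq_lt_one_of {q : ℝ} (h : |q| < 1) : q ^ 2 < 1 := by
  rw [← sq_abs]; nlinarith [abs_nonneg q]

lemma abs_sq_lt {q : ℝ} (h : |q| < 1) : |q ^ 2| < 1 := by
  rw [abs_of_nonneg (sq_nonneg q)]; exact sq_lt_one_of h

/-- sum of squares of the geometric part -/
lemma geo_sq (C q : ℕ → ℝ) (C0 q0 : ℝ) (hC : Tendsto C atTop (nhds C0))
    (hq : Tendsto q atTop (nhds q0)) (h0 : |q0| < 1)
    (m : ℕ → ℕ) (hm : Tendsto m atTop atTop) :
    Tendsto (fun N => ∑ k ∈ Finset.range (m N), (C N * q N ^ k) ^ 2) atTop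
      (nhds (C0 ^ 2 / (1 - q0 ^ 2))) := by
  have h1 : Tendsto (fun N => C N ^ 2 * (((q N ^ 2) ^ m N - 1) / (q N ^ 2 - 1))) atTop
      (nhds (C0 ^ 2 * ((0 - 1) / (q0 ^ 2 - 1)))) := by
    refine (hC.pow 2).mul (((pow_tendsto_zero _ _ (hq.pow 2) (abs_sq_lt h0) m hm).sub_const 1).div
      ((hq.pow 2).sub_const 1) ?_)
    have := sq_lt_one_of h0
    linarith
  have e : C0 ^ 2 * ((0 - 1) / (q0 ^ 2 - 1)) = C0 ^ 2 / (1 - q0 ^ 2) := by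
    rw [← neg_sub 1 (q0 ^ 2), div_neg]; ring
  rw [e] at h1
  refine h1.congr' ?_
  filter_upwards [(hq.pow 2).eventually_lt_const (sq_lt_one_of h0)] with N hN
  rw [← geom_sum_eq hN.ne, Finset.mul_sum]
  apply Finset.sum_congr rfl
  intro k _
  ring

/-- sum of squares of the reflected geometric part vanishes -/
lemma geo_sq_far (G q : ℕ → ℝ) (G0 q0 : ℝ) (hG : Tendsto G atTop (nhds G0))
    (hq : Tendsto q atTop (nhds q0)) (h0 : |q0| < 1)
    (m : ℕ → ℕ) (hmN : ∀ᶠ N in atTop, m N ≤ N)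
    (hm2 : Tendsto (fun N => N - m N) atTop atTop) :
    Tendsto (fun N => ∑ k ∈ Finset.range (m N), (G N * q N ^ (N - k)) ^ 2) atTop (nhds 0) := by
  have h1 : Tendsto (fun N => (q N ^ 2) ^ (N - m N) * (G N ^ 2 * (1 / (1 - q N ^ 2)))) atTop
      (nhds (0 * (G0 ^ 2 * (1 / (1 - q0 ^ 2))))) := by
    refine (pow_tendsto_zero _ _ (hq.pow 2) (abs_sq_lt h0) _ hm2).mul ((hG.pow 2).mul
      (tendsto_const_nhds.div ((hq.pow 2).const_sub 1) ?_))
    have := sq_lt_one_of h0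
    linarith
  rw [zero_mul] at h1
  refine squeeze_zero' (Eventually.of_forall fun N => Finset.sum_nonneg fun _ _ => sq_nonneg _) ?_ h1
  filter_upwards [(hq.pow 2).eventually_lt_const (sq_lt_one_of h0), hmN] with N hN hmN
  have hpos : 0 < 1 - q N ^ 2 := by linarith
  have e1 : ∑ k ∈ Finset.range (m N), (G N * q N ^ (N - k)) ^ 2
      ≤ ∑ k ∈ Finset.range (m N), (q N ^ 2) ^ (N - m N) * (G N ^ 2 * (q N ^ 2) ^ (m N - 1 - k)) := by
    apply Finset.sum_le_sum
    intro k hk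
    rw [Finset.mem_range] at hk
    have e2 : (G N * q N ^ (N - k)) ^ 2 = (q N ^ 2) ^ (N - m N) * (G N ^ 2 * (q N ^ 2) ^ (m N - 1 - k)) * q N ^ 2 := by
      rw [show N - k = (N - m N) + (m N - 1 - k) + 1 by omega]
      ring
    rw [e2]
    apply mul_le_of_le_one_right (by positivity) hN.le
  refine e1.trans ?_
  rw [← Finset.mul_sum, ← Finset.mul_sum, Finset.sum_range_reflect (fun k => (q N ^ 2) ^ k)]
  gcongr
  rw [geom_sum_eq hN.ne, ← neg_div_neg_eq, neg_sub, neg_sub]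
  gcongr
  have : 0 ≤ (q N ^ 2) ^ m N := by positivity
  linarith

lemma small_sq (s : ℕ → ℕ → ℝ) (K : ℝ) (hs : ∀ᶠ N in atTop, ∀ k, k ≤ N → |s N k| ≤ K / N)
    (m : ℕ → ℕ) (hmN : ∀ᶠ N in atTop, m N ≤ N) :
    Tendsto (fun N => ∑ k ∈ Finset.range (m N), (s N k) ^ 2) atTop (nhds 0) := by
  have h1 : Tendsto (fun N : ℕ => K ^ 2 / (N : ℝ)) atTop (nhds 0) :=
    tendsto_const_div_atTop_nhds_zero_nat _
  refine squeeze_zero' (Eventually.of_forall fun N => Finset.sum_nonneg fun _ _ => sq_nonneg _) ?_ h1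
  filter_upwards [hs, hmN, eventually_gt_atTop 0] with N hN hmN h0
  have h0' : (0 : ℝ) < N := by exact_mod_cast h0
  have e1 : ∑ k ∈ Finset.range (m N), (s N k) ^ 2 ≤ ∑ k ∈ Finset.range (m N), (K / N) ^ 2 := by
    apply Finset.sum_le_sum
    intro k hk
    rw [Finset.mem_range] at hk
    rw [← sq_abs]
    exact pow_le_pow_left₀ (abs_nonneg _) (hN k (by omega)) 2
  refine e1.trans ?_
  rw [Finset.sum_const, Finset.card_range, nsmul_eq_mul]
  have : (m N : ℝ) ≤ N := by exact_mod_cast hmN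
  calc (m N : ℝ) * (K / N) ^ 2 ≤ N * (K / N) ^ 2 := by gcongr
    _ = K ^ 2 / N := by field_simp

lemma window (s : ℕ → ℕ → ℝ) (K : ℝ) (hs : ∀ᶠ N in atTop, ∀ k, k ≤ N → |s N k| ≤ K / N)
    (C μ G q : ℕ → ℝ) (C0 μ0 G0 q0 : ℝ) (hC : Tendsto C atTop (nhds C0))
    (hμ : Tendsto μ atTop (nhds μ0)) (hμ0 : |μ0| < 1) (hG : Tendsto G atTop (nhds G0))
    (hq : Tendsto q atTop (nhds q0)) (hq0 : |q0| < 1)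
    (m : ℕ → ℕ) (hmN : ∀ᶠ N in atTop, m N ≤ N) (hm : Tendsto m atTop atTop)
    (hm2 : Tendsto (fun N => N - m N) atTop atTop) :
    Tendsto (fun N => ∑ k ∈ Finset.range (m N), (s N k + C N * μ N ^ k + G N * q N ^ (N - k)) ^ 2) atTop
      (nhds (C0 ^ 2 / (1 - μ0 ^ 2))) := by
  have h1 := geo_sq C μ C0 μ0 hC hμ hμ0 m hm
  have h2 := geo_sq_far G q G0 q0 hG hq hq0 m hmN hm2
  have h3 := small_sq s K hs m hmN
  have h4 : Tendsto (fun N => ∑ k ∈ Finset.range (m N), (s N k + G N * q N ^ (N - k)) ^ 2) atTop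
      (nhds 0) := by
    have h5 := (h3.add h2).const_mul 2
    rw [add_zero, mul_zero] at h5
    refine squeeze_zero (fun N => Finset.sum_nonneg fun _ _ => sq_nonneg _) (fun N => ?_) h5
    rw [← Finset.sum_add_distrib, Finset.mul_sum]
    apply Finset.sum_le_sum
    intro k _
    nlinarith [sq_nonneg (s N k - G N * q N ^ (N - k))]
  have h5 : Tendsto (fun N => ∑ k ∈ Finset.range (m N),
      (C N * μ N ^ k) * (s N k + G N * q N ^ (N - k))) atTop (nhds 0) := by
    have h6 := h1.mul h4
    rw [mul_zero] at h6
    have h7 := h6.sqrt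
    rw [Real.sqrt_zero] at h7
    apply squeeze_zero_norm _ h7
    intro N
    rw [Real.norm_eq_abs]
    apply Real.abs_le_sqrt
    exact Finset.sum_mul_sq_le_sq_mul_sq _ _ _
  have h6 := (h1.add h4).add (h5.const_mul 2)
  rw [mul_zero, add_zero, add_zero] at h6
  refine h6.congr (fun N => ?_)
  rw [Finset.mul_sum, ← Finset.sum_add_distrib, ← Finset.sum_add_distrib]
  apply Finset.sum_congr rfl
  intro k _
  ring

lemma ceil_facts (c : ℝ) (hc0 : 0 < c) (hc1 : c < 1) :
    Tendsto (fun N : ℕ => ⌈c * (N : ℝ)⌉₊) atTop atTop ∧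
    (∀ N : ℕ, ⌈c * (N : ℝ)⌉₊ ≤ N) ∧
    Tendsto (fun N : ℕ => N - ⌈c * (N : ℝ)⌉₊) atTop atTop := by
  have h2 : ∀ N : ℕ, ⌈c * (N : ℝ)⌉₊ ≤ N := by
    intro N
    rw [Nat.ceil_le]
    have : (0 : ℝ) ≤ N := Nat.cast_nonneg N
    nlinarith
  refine ⟨?_, h2, ?_⟩
  · exact tendsto_nat_ceil_atTop.comp (tendsto_natCast_atTop_atTop.const_mul_atTop hc0)
  · rw [← tendsto_natCast_atTop_iff (R := ℝ)]
    have h3 : Tendsto (fun N : ℕ => (1 - c) * (N : ℝ) + (-1)) atTop atTop :=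
      tendsto_atTop_add_const_right _ _ (tendsto_natCast_atTop_atTop.const_mul_atTop (by linarith))
    refine tendsto_atTop_mono (fun N => ?_) h3
    rw [Nat.cast_sub (h2 N)]
    have := Nat.ceil_lt_add_one (a := c * (N : ℝ)) (by positivity)
    linarith

lemma both_windows (ξ : (N : ℕ) → Fin (N + 1) → ℝ)
    (s : ℕ → ℕ → ℝ) (K : ℝ) (hs : ∀ᶠ N in atTop, ∀ k, k ≤ N → |s N k| ≤ K / N)
    (C μ G q : ℕ → ℝ) (C0 μ0 G0 q0 : ℝ) (hC : Tendsto C atTop (nhds C0))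
    (hμ : Tendsto μ atTop (nhds μ0)) (hμ0 : |μ0| < 1) (hG : Tendsto G atTop (nhds G0))
    (hq : Tendsto q atTop (nhds q0)) (hq0 : |q0| < 1)
    (hξ : ∀ᶠ N in atTop, ∀ k : Fin (N + 1), ξ N k = s N k + C N * μ N ^ k.val + G N * q N ^ (N - k.val))
    (c : ℝ) (hc0 : 0 < c) (hc1 : c < 1) :
    Tendsto (fun N : ℕ => ∑ k : Fin (N + 1), (if k.val < ⌈c * (N : ℝ)⌉₊ then (ξ N k) ^ 2 else 0))
      atTop (nhds (C0 ^ 2 / (1 - μ0 ^ 2))) ∧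
    Tendsto (fun N : ℕ => ∑ k : Fin (N + 1), (if ⌈c * (N : ℝ)⌉₊ ≤ k.val then (ξ N k) ^ 2 else 0))
      atTop (nhds (G0 ^ 2 / (1 - q0 ^ 2))) := by
  obtain ⟨c1, c2, c3⟩ := ceil_facts c hc0 hc1
  constructor
  · refine (window s K hs C μ G q C0 μ0 G0 q0 hC hμ hμ0 hG hq hq0 _
      (Eventually.of_forall c2) c1 c3).congr' ?_
    filter_upwards [hξ] with N hN
    simp_rw [hN]
    rw [Fin.sum_univ_eq_sum_range (fun k => if k < ⌈c * (N : ℝ)⌉₊ then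
      (s N k + C N * μ N ^ k + G N * q N ^ (N - k)) ^ 2 else 0), ← Finset.sum_filter]
    apply Finset.sum_congr _ (fun _ _ => rfl)
    ext k
    have := c2 N
    simp only [Finset.mem_range, Finset.mem_filter]
    omega
  · have hs' : ∀ᶠ N in atTop, ∀ k, k ≤ N → |s N (N - k)| ≤ K / N := by
      filter_upwards [hs] with N hN k hk
      exact hN _ (by omega)
    have c4 : ∀ᶠ N : ℕ in atTop, N - ⌈c * (N : ℝ)⌉₊ + 1 ≤ N := by
      filter_upwards [c1.eventually_ge_atTop 1] with N hN
      have := c2 N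
      omega
    have c5 : Tendsto (fun N : ℕ => N - (N - ⌈c * (N : ℝ)⌉₊ + 1)) atTop atTop := by
      refine ((tendsto_sub_atTop_nat 1).comp c1).congr (fun N => ?_)
      have := c2 N
      simp only [Function.comp]
      omega
    refine (window (fun N k => s N (N - k)) K hs' G q C μ G0 q0 C0 μ0 hG hq hq0 hC hμ hμ0 _
      c4 (tendsto_atTop_mono (fun N => Nat.le_succ _) c3) c5).congr' ?_
    filter_upwards [hξ] with N hN
    simp_rw [hN]
    rw [Fin.sum_univ_eq_sum_range (fun k => if ⌈c * (N : ℝ)⌉₊ ≤ k then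
      (s N k + C N * μ N ^ k + G N * q N ^ (N - k)) ^ 2 else 0), ← Finset.sum_range_reflect (fun k => if ⌈c * (N : ℝ)⌉₊ ≤ k then
      (s N k + C N * μ N ^ k + G N * q N ^ (N - k)) ^ 2 else 0) (N + 1),
      ← Finset.sum_filter_add_sum_filter_not (Finset.range (N + 1)) (fun k => k < N - ⌈c * (N : ℝ)⌉₊ + 1)]
    have := c2 N
    rw [Finset.sum_eq_zero (s := Finset.filter (fun k => ¬ k < N - ⌈c * (N : ℝ)⌉₊ + 1) (Finset.range (N + 1))), add_zero]
    · apply Finset.sum_congr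
      · ext k
        simp only [Finset.mem_range, Finset.mem_filter]
        omega
      · intro k hk
        simp only [Finset.mem_range, Finset.mem_filter] at hk
        rw [show N + 1 - 1 - k = N - k by omega, if_pos (by omega), show N - (N - k) = k by omega]
        ring
    · intro k hk
      simp only [Finset.mem_range, Finset.mem_filter] at hk
      rw [if_neg (by omega)]
lemma av_lt (ρ T : ℝ) (hρ : 0 < ρ) (hT : 0 < T) (N : ℕ) (hN : 0 < N) : av ρ T N < 1 := by
  unfold av
  rw [Real.exp_lt_one_iff]
  have : (0 : ℝ) < N := by exact_mod_cast hN
  have : 0 < ρ * T / N := by positivity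
  linarith

lemma av_pos (ρ T : ℝ) (N : ℕ) : 0 < av ρ T N := Real.exp_pos _

lemma av_tendsto (ρ T : ℝ) : Tendsto (av ρ T) atTop (nhds 1) := by
  have h : Tendsto (fun N : ℕ => -(ρ * T / (N : ℝ))) atTop (nhds (-0)) :=
    (tendsto_const_div_atTop_nhds_zero_nat _).neg
  have h2 := (Real.continuous_exp.tendsto (-0)).comp h
  rw [neg_zero, Real.exp_zero] at h2
  exact h2

lemma av_deriv (ρ T : ℝ) (hρ : 0 < ρ) (hT : 0 < T) :
    Tendsto (fun N : ℕ => (N : ℝ) * (1 - av ρ T N)) atTop (nhds (ρ * T)) := by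
  have h0 := (hasDerivAt_iff_tendsto_slope_zero.mp (Real.hasDerivAt_exp 0))
  have h : Tendsto (fun N : ℕ => -(ρ * T / (N : ℝ))) atTop (nhdsWithin 0 {0}ᶜ) := by
    rw [tendsto_nhdsWithin_iff]
    constructor
    · have : Tendsto (fun N : ℕ => -(ρ * T / (N : ℝ))) atTop (nhds (-0)) :=
        (tendsto_const_div_atTop_nhds_zero_nat _).neg
      rwa [neg_zero] at this
    · filter_upwards [eventually_gt_atTop 0] with N hN
      have : (0 : ℝ) < N := by exact_mod_cast hN
      have : 0 < ρ * T / N := by positivity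
      simp only [Set.mem_compl_iff, Set.mem_singleton_iff]
      linarith
  have h1 := (h0.comp h).const_mul (ρ * T)
  rw [Real.exp_zero, mul_one] at h1
  refine h1.congr' ?_
  filter_upwards [eventually_gt_atTop 0] with N hN
  have : (0 : ℝ) < N := by exact_mod_cast hN
  simp only [Function.comp, zero_add, smul_eq_mul, av]
  field_simp
  ring

lemma om_asymp (ρ T θ : ℝ) (hρ : 0 < ρ) (hT : 0 < T) (hθ : 0 < θ) :
    ∃ (s : ℕ → ℕ → ℝ) (K : ℝ) (G q : ℕ → ℝ),
      (∀ᶠ N in atTop, ∀ k, k ≤ N → |s N k| ≤ K / N) ∧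
      (∀ᶠ N in atTop, ∀ k : Fin (N + 1), omN N ρ T θ k = s N k + G N * q N ^ (N - k.val)) ∧
      Tendsto G atTop (nhds (1 / (1 / 2 + 2 * θ))) ∧
      Tendsto q atTop (nhds (1 - 1 / (1 / 2 + 2 * θ))) ∧
      |1 - 1 / (1 / 2 + 2 * θ)| < 1 ∧
      Tendsto (fun N => ∑ k, omN N ρ T θ k) atTop (nhds (ρ * T + 1)) := by
  set κ := 1 / 2 + 2 * θ with hκ
  have hκ0 : 1 / 2 < κ := by linarith
  have ha := av_tendsto ρ T
  have hd := av_deriv ρ T hρ hT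
  set a := av ρ T with hadef
  set w : ℕ → ℝ := fun N => (1 - a N) / (κ * (1 - a N) + a N) with hw
  set q : ℕ → ℝ := fun N => a N * (1 - 1 / κ) with hq
  set g : ℕ → ℝ := fun N => 1 / κ - w N with hg
  have hden : Tendsto (fun N => κ * (1 - a N) + a N) atTop (nhds 1) := by
    have := ((ha.const_sub 1).const_mul κ).add ha
    simpa using this
  have hNw : Tendsto (fun N : ℕ => (N : ℝ) * w N) atTop (nhds (ρ * T)) := by
    have := hd.div hden one_ne_zero
    rw [div_one] at this
    refine this.congr (fun N => ?_)
    simp only [hw, Pi.div_apply]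
    ring
  have hw0 : Tendsto w atTop (nhds 0) := by
    have := (ha.const_sub 1).div hden one_ne_zero
    rw [sub_self, zero_div] at this
    exact this
  have hq0 : Tendsto q atTop (nhds (1 - 1 / κ)) := by
    have := ha.mul_const (1 - 1 / κ)
    rw [one_mul] at this
    exact this
  have hg0 : Tendsto g atTop (nhds (1 / κ)) := by
    have := hw0.const_sub (1 / κ)
    rw [sub_zero] at this
    exact this
  have hκinv : 1 / κ < 2 := by rw [div_lt_iff₀ (by linarith)]; linarith
  have hκpos : 0 < 1 / κ := by positivity
  have habs : |1 - 1 / κ| < 1 := by rw [abs_lt]; constructor <;> linarith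
  have hsol : ∀ᶠ N in atTop, omN N ρ T θ = fun k => w N + g N * q N ^ (N - k.val) := by
    filter_upwards [hden.eventually_ne one_ne_zero, eventually_gt_atTop 0] with N hN hN0
    unfold omN
    rw [mat_om N ρ T θ hT]
    refine inv_eq_of_sol N _ 0 θ (av_pos ρ T N).le (av_lt ρ T hρ hT N hN0).le le_rfl hθ
      (fun i => w N + g N * q N ^ (N - i)) ?_
    rw [show ((0 : ℝ) + 1) / 2 + 2 * θ = κ by rw [hκ]; ring]
    exact sol_om N (a N) κ (by linarith) hN (w N) (q N) (g N) rfl rfl rfl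
  refine ⟨fun N _ => w N, ρ * T + 1, g, q, ?_, ?_, hg0, hq0, habs, ?_⟩
  · filter_upwards [hNw.abs.eventually_lt_const (show |ρ * T| < ρ * T + 1 by
      rw [abs_of_pos (by positivity)]; linarith), eventually_gt_atTop 0] with N hN h0 k _
    have h0' : (0 : ℝ) < N := by exact_mod_cast h0
    rw [le_div_iff₀ h0', mul_comm]
    rw [abs_mul, abs_of_pos h0'] at hN
    exact hN.le
  · filter_upwards [hsol] with N hN k
    rw [hN]
  · have hlim : Tendsto (fun N : ℕ => (N : ℝ) * w N + w N + g N * ((q N ^ (N + 1) - 1) / (q N - 1))) atTop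
        (nhds (ρ * T + 0 + 1 / κ * ((0 - 1) / ((1 - 1 / κ) - 1)))) := by
      refine (hNw.add hw0).add (hg0.mul (((pow_tendsto_zero q _ hq0 habs (fun N => N + 1)
        (tendsto_add_atTop_nat 1)).sub_const 1).div (hq0.sub_const 1) ?_))
      linarith
    have e : ρ * T + 0 + 1 / κ * ((0 - 1) / ((1 - 1 / κ) - 1)) = ρ * T + 1 := by
      have : κ ≠ 0 := by linarith
      rw [show (1 - 1 / κ) - 1 = -(1 / κ) by ring]
      field_simp
      ring
    rw [e] at hlim
    refine hlim.congr' ?_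
    filter_upwards [hsol, hq0.eventually_lt_const (show 1 - 1 / κ < 1 by linarith)] with N hN hq1
    rw [hN, Fin.sum_univ_eq_sum_range (fun k => w N + g N * q N ^ (N - k)), Finset.sum_add_distrib,
      ← Finset.mul_sum, Finset.sum_const, Finset.card_range, nsmul_eq_mul,
      ← geom_sum_eq hq1.ne, ← Finset.sum_range_reflect (fun k => q N ^ k)]
    push_cast
    ring

/-- small root -/
def muF (p θ a : ℝ) : ℝ :=
  ((((p + 1) / 2 + 2 * θ) * (1 + a ^ 2) - (p + 1) * a ^ 2)
    - √((((p + 1) / 2 + 2 * θ) * (1 + a ^ 2) - (p + 1) * a ^ 2) ^ 2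
      - 4 * (a * ((p - 1) / 2 + 2 * θ)) * (a * (2 * θ - (p - 1) / 2)))) / (2 * (a * ((p - 1) / 2 + 2 * θ)))

/-- rescaled large root -/
def rF (p θ a : ℝ) : ℝ :=
  (((p + 1) / 2 + 2 * θ) - (2 * θ - (p + 1) / 2) * a) / (a * ((p - 1) / 2 + 2 * θ) * (1 - muF p θ a))

lemma muF_one (p θ : ℝ) (hp : 1 < p) (hθ : 0 < θ) :
    muF p θ 1 = (4 * θ - (p - 1)) / (4 * θ + (p - 1)) := by
  unfold muF
  have e : ((((p + 1) / 2 + 2 * θ) * (1 + 1 ^ 2) - (p + 1) * 1 ^ 2) ^ 2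
      - 4 * (1 * ((p - 1) / 2 + 2 * θ)) * (1 * (2 * θ - (p - 1) / 2))) = (p - 1) ^ 2 := by ring
  rw [e, Real.sqrt_sq (by linarith)]
  have : 4 * θ + (p - 1) ≠ 0 := by linarith
  have : (2 * (1 * ((p - 1) / 2 + 2 * θ))) ≠ 0 := by linarith
  rw [div_eq_div_iff (by linarith) (by linarith)]
  ring

lemma muF_cont (p θ : ℝ) (hp : 1 < p) (hθ : 0 < θ) :
    Tendsto (muF p θ) (nhds 1) (nhds ((4 * θ - (p - 1)) / (4 * θ + (p - 1)))) := by
  rw [← muF_one p θ hp hθ]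
  have : (2 * ((1 : ℝ) * ((p - 1) / 2 + 2 * θ))) ≠ 0 := by linarith
  unfold muF
  apply ContinuousAt.tendsto
  refine ContinuousAt.div₀ (f := fun a : ℝ => _) (g := fun a : ℝ => 2 * (a * ((p - 1) / 2 + 2 * θ))) ?_ ?_ this
  · fun_prop
  · fun_prop

lemma one_sub_mu (p θ : ℝ) (hp : 1 < p) (hθ : 0 < θ) :
    1 - (4 * θ - (p - 1)) / (4 * θ + (p - 1)) = (p - 1) / ((p - 1) / 2 + 2 * θ) := by
  have : 4 * θ + (p - 1) ≠ 0 := by linarith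
  have : ((p - 1) / 2 + 2 * θ) ≠ 0 := by linarith
  rw [eq_div_iff (by assumption)]
  field_simp
  ring

lemma rF_cont (p θ : ℝ) (hp : 1 < p) (hθ : 0 < θ) :
    Tendsto (rF p θ) (nhds 1) (nhds ((p + 1) / (p - 1))) := by
  have h1 := muF_cont p θ hp hθ
  have h2 : Tendsto (fun a : ℝ => a) (nhds 1) (nhds 1) := tendsto_id
  have hk : ((p - 1) / 2 + 2 * θ) ≠ 0 := by linarith
  have hp1 : p - 1 ≠ 0 := by linarith
  have e0 : (1 : ℝ) * ((p - 1) / 2 + 2 * θ) * (1 - (4 * θ - (p - 1)) / (4 * θ + (p - 1))) = p - 1 := by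
    rw [one_sub_mu p θ hp hθ, one_mul, mul_div_cancel₀ _ hk]
  have h3 := ((h2.const_mul (2 * θ - (p + 1) / 2)).const_sub ((p + 1) / 2 + 2 * θ)).div
    ((h2.mul_const ((p - 1) / 2 + 2 * θ)).mul (h1.const_sub 1)) (by rw [e0]; exact hp1)
  rw [e0] at h3
  rw [show ((p + 1) / 2 + 2 * θ - (2 * θ - (p + 1) / 2) * 1) = p + 1 by ring] at h3
  exact h3

lemma mu_root (p θ a : ℝ) (ha : a * ((p - 1) / 2 + 2 * θ) ≠ 0)
    (hdisc : 0 ≤ (((p + 1) / 2 + 2 * θ) * (1 + a ^ 2) - (p + 1) * a ^ 2) ^ 2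
      - 4 * (a * ((p - 1) / 2 + 2 * θ)) * (a * (2 * θ - (p - 1) / 2))) :
    (a * ((p - 1) / 2 + 2 * θ)) * muF p θ a ^ 2
      - (((p + 1) / 2 + 2 * θ) * (1 + a ^ 2) - (p + 1) * a ^ 2) * muF p θ a
      + a * (2 * θ - (p - 1) / 2) = 0 := by
  unfold muF
  set Q := a * ((p - 1) / 2 + 2 * θ)
  set R := a * (2 * θ - (p - 1) / 2)
  set P := ((p + 1) / 2 + 2 * θ) * (1 + a ^ 2) - (p + 1) * a ^ 2
  have hs := Real.sq_sqrt hdisc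
  set S := √(P ^ 2 - 4 * Q * R)
  field_simp
  linear_combination hs

lemma lam_root (Q P R r m a t : ℝ) (hQ : Q ≠ 0) (hm1 : 1 - m ≠ 0) (hm : Q * m ^ 2 - P * m + R = 0)
    (hr : r = t / (Q * (1 - m))) (ht : (1 - a) * t = -(Q - P + R)) :
    Q * (1 + (1 - a) * r) ^ 2 - P * (1 + (1 - a) * r) + R = 0 := by
  have h1 : r * (Q * (1 - m)) = t := by rw [hr]; field_simp
  set l := 1 + (1 - a) * r with hl
  have h2 : Q * l = P - Q * m := by
    apply mul_right_cancel₀ hm1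
    rw [hl]
    linear_combination (1 - a) * h1 + ht - hm
  apply mul_left_cancel₀ hQ
  linear_combination (Q * l + P - Q * m - P) * h2 + Q * hm
lemma nu_asymp (n : ℕ) (hn : 2 ≤ n) (ρ T θ : ℝ) (hρ : 0 < ρ) (hT : 0 < T) (hθ : 0 < θ) (E : ℝ)
    (hE : E = Real.exp (ρ * T * ((n : ℝ) + 1) / ((n : ℝ) - 1))) :
    ∃ (s : ℕ → ℕ → ℝ) (K : ℝ) (C m : ℕ → ℝ),
      (∀ᶠ N in atTop, ∀ k, k ≤ N → |s N k| ≤ K / N) ∧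
      (∀ᶠ N in atTop, ∀ k : Fin (N + 1), nuN n N ρ T θ k = s N k + C N * m N ^ k.val) ∧
      Tendsto C atTop (nhds ((1 - (4 * θ - ((n : ℝ) - 1)) / (4 * θ + ((n : ℝ) - 1)))
        * ((1 + n * E) / (n * (n + 1) * E)))) ∧
      Tendsto m atTop (nhds ((4 * θ - ((n : ℝ) - 1)) / (4 * θ + ((n : ℝ) - 1)))) ∧
      |(4 * θ - ((n : ℝ) - 1)) / (4 * θ + ((n : ℝ) - 1))| < 1 ∧
      Tendsto (fun N => ∑ k, nuN n N ρ T θ k) atTop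
        (nhds (((n : ℝ) * ((ρ * T + 1) * ((n : ℝ) + 1) + 2) * E - ((n : ℝ) - 1))
          / (n * (n + 1) ^ 2 * E))) := by
  have hp : (1 : ℝ) < n := by exact_mod_cast hn
  set p : ℝ := (n : ℝ) with hpdef
  have hE0 : 0 < E := by rw [hE]; exact Real.exp_pos _
  set m0 := (4 * θ - (p - 1)) / (4 * θ + (p - 1)) with hm0
  have hm0abs : |m0| < 1 := by
    rw [hm0, abs_div, abs_of_pos (show 0 < 4 * θ + (p - 1) by linarith), div_lt_one (by linarith), abs_lt]
    constructor <;> linarith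
  have hm1 : m0 < 1 := (abs_lt.mp hm0abs).2
  set r0 := (p + 1) / (p - 1) with hr0
  have hp1 : p - 1 ≠ 0 := by linarith
  have hr0pos : 1 < r0 := by rw [hr0, lt_div_iff₀ (by linarith)]; linarith
  set d := (p + 1) / 2 + 2 * θ with hd
  have ha := av_tendsto ρ T
  have hda := av_deriv ρ T hρ hT
  set a := av ρ T with hadef
  set m : ℕ → ℝ := fun N => muF p θ (a N) with hm
  set r : ℕ → ℝ := fun N => rF p θ (a N) with hr
  have hmT : Tendsto m atTop (nhds m0) := (muF_cont p θ hp hθ).comp ha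
  have hrT : Tendsto r atTop (nhds r0) := (rF_cont p θ hp hθ).comp ha
  set l : ℕ → ℝ := fun N => 1 + (1 - a N) * r N with hl
  have heT : Tendsto (fun N => 1 - a N) atTop (nhds 0) := by
    have := ha.const_sub 1
    rwa [sub_self] at this
  have hlT : Tendsto l atTop (nhds 1) := by
    have := (heT.mul hrT).const_add 1
    rwa [zero_mul, add_zero] at this
  have hlN : Tendsto (fun N => l N ^ N) atTop (nhds E) := by
    rw [hE]
    apply Real.tendsto_one_add_pow_exp_of_tendsto
    have := hda.mul hrT
    rw [hr0, ← mul_div_assoc] at this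
    refine this.congr (fun N => ?_)
    ring
  have hlN1 : Tendsto (fun N => l N ^ (N + 1)) atTop (nhds E) := by
    have := hlN.mul hlT
    rw [mul_one] at this
    exact this.congr (fun N => (pow_succ _ _).symm)
  have hmN1 : Tendsto (fun N => m N ^ (N + 1)) atTop (nhds 0) :=
    pow_tendsto_zero m m0 hmT hm0abs (fun N => N + 1) (tendsto_add_atTop_nat 1)
  set x : ℕ → ℝ := fun N => 1 / (a N * (p + 1) + d * (1 - a N)) with hx
  have hxd : Tendsto (fun N => a N * (p + 1) + d * (1 - a N)) atTop (nhds (p + 1)) := by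
    have := (ha.mul_const (p + 1)).add (heT.const_mul d)
    rwa [one_mul, mul_zero, add_zero] at this
  have hxT : Tendsto x atTop (nhds (1 / (p + 1))) := tendsto_const_nhds.div hxd (by linarith)
  set y1 : ℕ → ℝ := fun N => 1 / (1 + r N) with hy1
  set y2 : ℕ → ℝ := fun N => 1 / (m N - a N) with hy2
  set z1 : ℕ → ℝ := fun N => l N ^ (N + 1) / (1 - a N * r N) with hz1
  set z2 : ℕ → ℝ := fun N => m N ^ (N + 1) / (1 - a N * m N) with hz2
  have d1 : Tendsto (fun N => 1 + r N) atTop (nhds (1 + r0)) := hrT.const_add 1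
  have d2 : Tendsto (fun N => m N - a N) atTop (nhds (m0 - 1)) := hmT.sub ha
  have d3 : Tendsto (fun N => 1 - a N * r N) atTop (nhds (1 - r0)) := by
    have := (ha.mul hrT).const_sub 1
    rwa [one_mul] at this
  have d4 : Tendsto (fun N => 1 - a N * m N) atTop (nhds (1 - m0)) := by
    have := (ha.mul hmT).const_sub 1
    rwa [one_mul] at this
  have n1 : 1 + r0 ≠ 0 := by linarith
  have n2 : m0 - 1 ≠ 0 := by linarith
  have n3 : 1 - r0 ≠ 0 := by linarith
  have n4 : 1 - m0 ≠ 0 := by linarith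
  have hy1T : Tendsto y1 atTop (nhds (1 / (1 + r0))) := tendsto_const_nhds.div d1 n1
  have hy2T : Tendsto y2 atTop (nhds (1 / (m0 - 1))) := tendsto_const_nhds.div d2 n2
  have hz1T : Tendsto z1 atTop (nhds (E / (1 - r0))) := hlN1.div d3 n3
  have hz2T : Tendsto z2 atTop (nhds 0) := by
    have := hmN1.div d4 n4
    rwa [zero_div] at this
  set Δ : ℕ → ℝ := fun N => y1 N * z2 N - y2 N * z1 N with hΔ
  have hΔT : Tendsto Δ atTop (nhds (1 / (1 + r0) * 0 - 1 / (m0 - 1) * (E / (1 - r0)))) :=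
    (hy1T.mul hz2T).sub (hy2T.mul hz1T)
  have hΔ0 : 1 / (1 + r0) * 0 - 1 / (m0 - 1) * (E / (1 - r0)) ≠ 0 := by
    rw [mul_zero, zero_sub]
    exact neg_ne_zero.mpr (mul_ne_zero (one_div_ne_zero n2) (div_ne_zero hE0.ne' n3))
  set b : ℕ → ℝ := fun N => -x N * (z2 N - y2 N) / Δ N with hb
  set C : ℕ → ℝ := fun N => -x N * (y1 N - z1 N) / Δ N with hC
  have r1 : 1 + r0 = 2 * p / (p - 1) := by rw [hr0]; field_simp; ring
  have r2 : 1 - r0 = -2 / (p - 1) := by rw [hr0]; field_simp; ring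
  have hp0 : p ≠ 0 := by linarith
  have hp2 : p + 1 ≠ 0 := by linarith
  have hE1 : E ≠ 0 := hE0.ne'
  have hbT : Tendsto b atTop (nhds (2 / ((p + 1) * (p - 1) * E))) := by
    have := (hxT.neg.mul (hz2T.sub hy2T)).div hΔT hΔ0
    have e : -(1 / (p + 1)) * (0 - 1 / (m0 - 1)) /
        (1 / (1 + r0) * 0 - 1 / (m0 - 1) * (E / (1 - r0))) = 2 / ((p + 1) * (p - 1) * E) := by
      rw [r2, mul_zero]
      field_simp
      ring
    rwa [e] at this
  have hCT : Tendsto C atTop (nhds ((1 - m0) * ((1 + p * E) / (p * (p + 1) * E)))) := by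
    have := (hxT.neg.mul (hy1T.sub hz1T)).div hΔT hΔ0
    have e : -(1 / (p + 1)) * (1 / (1 + r0) - E / (1 - r0)) /
        (1 / (1 + r0) * 0 - 1 / (m0 - 1) * (E / (1 - r0)))
        = (1 - m0) * ((1 + p * E) / (p * (p + 1) * E)) := by
      rw [r2, r1, mul_zero]
      field_simp
      ring
    rwa [e] at this
  have hdisc : Tendsto (fun N => ((((p + 1) / 2 + 2 * θ) * (1 + a N ^ 2) - (p + 1) * a N ^ 2) ^ 2
      - 4 * (a N * ((p - 1) / 2 + 2 * θ)) * (a N * (2 * θ - (p - 1) / 2)))) atTop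
      (nhds ((p - 1) ^ 2)) := by
    have h1 : ContinuousAt (fun a : ℝ => ((((p + 1) / 2 + 2 * θ) * (1 + a ^ 2) - (p + 1) * a ^ 2) ^ 2
      - 4 * (a * ((p - 1) / 2 + 2 * θ)) * (a * (2 * θ - (p - 1) / 2)))) 1 := by fun_prop
    have h2 := h1.tendsto.comp ha
    rw [show ((((p + 1) / 2 + 2 * θ) * (1 + (1 : ℝ) ^ 2) - (p + 1) * 1 ^ 2) ^ 2
      - 4 * (1 * ((p - 1) / 2 + 2 * θ)) * (1 * (2 * θ - (p - 1) / 2))) = (p - 1) ^ 2 by ring] at h2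
    exact h2
  have hsol : ∀ᶠ N in atTop, nuN n N ρ T θ = fun k => (1 - a N) * x N + (1 - a N) * b N * l N ^ k.val
      + C N * m N ^ k.val := by
    filter_upwards [hdisc.eventually_const_lt (show 0 < (p - 1) ^ 2 by positivity),
      d1.eventually_ne n1, d2.eventually_ne n2, d3.eventually_ne n3, d4.eventually_ne n4,
      hΔT.eventually_ne hΔ0, hxd.eventually_ne hp2, eventually_gt_atTop 0,
      hmT.eventually_lt_const hm1] with N k0 k1 k2 k3 k4 k5 k6 hN0 k7
    have ha0 : 0 < a N := av_pos ρ T N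
    have ha1 : a N < 1 := av_lt ρ T hρ hT N hN0
    have he : 1 - a N ≠ 0 := by linarith
    have hQ : a N * ((p - 1) / 2 + 2 * θ) ≠ 0 := mul_ne_zero ha0.ne' (by linarith)
    have hmr := mu_root p θ (a N) hQ k0.le
    have hlr := lam_root _ _ _ (r N) (m N) (a N) _ hQ (by linarith) hmr rfl (by ring)
    have f1 : l N - a N = (1 - a N) * (1 + r N) := by simp only [hl]; ring
    have f2 : 1 - a N * l N = (1 - a N) * (1 - a N * r N) := by simp only [hl]; ring
    unfold nuN
    rw [mat_nu n N ρ T θ hT]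
    refine inv_eq_of_sol N _ p θ ha0.le ha1.le (by linarith) hθ
      (fun k => (1 - a N) * x N + (1 - a N) * b N * l N ^ k + C N * m N ^ k) ?_
    have g1 : b N * y1 N + C N * y2 N = - x N := by
      simp only [hb, hC]
      rw [div_mul_eq_mul_div, div_mul_eq_mul_div, ← add_div, div_eq_iff k5]
      simp only [hΔ]
      ring
    have g2 : b N * z1 N + C N * z2 N = - x N := by
      simp only [hb, hC]
      rw [div_mul_eq_mul_div, div_mul_eq_mul_div, ← add_div, div_eq_iff k5]
      simp only [hΔ]
      ring
    have hA1 : (1 - a N) * x N / (1 - a N) = x N := by field_simp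
    refine sol_nu N (a N) p d _ _ (C N) (l N) (m N) he ?_ ?_ k2 k4 ?_ ?_ ?_ ?_ ?_
    · rw [f1]; exact mul_ne_zero he k1
    · rw [f2]; exact mul_ne_zero he k3
    · have : (1 - a N) * (p * a N / (1 - a N) + d + a N / (1 - a N))
          = a N * (p + 1) + d * (1 - a N) := by field_simp; ring
      rw [mul_right_comm, this, mul_one_div_cancel k6]
    · linear_combination -hlr
    · linear_combination -hmr
    · rw [hA1, f1, mul_div_mul_left _ _ he]
      simp only [hy1, hy2] at g1
      linear_combination g1
    · rw [hA1, f2, mul_assoc, mul_div_mul_left _ _ he]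
      simp only [hz1, hz2] at g2
      linear_combination g2
  have hNA : Tendsto (fun N : ℕ => (N : ℝ) * (1 - a N) * x N) atTop (nhds (ρ * T * (1 / (p + 1)))) :=
    hda.mul hxT
  have hNB : Tendsto (fun N : ℕ => (N : ℝ) * (1 - a N) * b N) atTop
    (nhds (ρ * T * (2 / ((p + 1) * (p - 1) * E)))) := hda.mul hbT
  refine ⟨fun N k => (1 - a N) * x N + (1 - a N) * b N * l N ^ k,
    |ρ * T * (1 / (p + 1))| + |ρ * T * (2 / ((p + 1) * (p - 1) * E))| * E + 1, C, m, ?_, ?_,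
    hCT, hmT, hm0abs, ?_⟩
  · have hlim := hNA.abs.add (hNB.abs.mul hlN)
    filter_upwards [hlim.eventually_lt_const (lt_add_one _), eventually_gt_atTop 0,
      hrT.eventually_const_lt (show 0 < r0 by linarith)] with N hN h0 hrpos k hk
    have h0' : (0 : ℝ) < N := by exact_mod_cast h0
    have ha1 : a N < 1 := av_lt ρ T hρ hT N h0
    have hl1 : 1 ≤ l N := by
      have : 0 < (1 - a N) * r N := mul_pos (by linarith) hrpos
      simp only [hl]; linarith
    rw [le_div_iff₀ h0']
    refine le_trans ?_ hN.le
    have hpk : l N ^ k ≤ l N ^ N := pow_le_pow_right₀ hl1 hk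
    have hpk0 : 0 ≤ l N ^ k := by positivity
    calc |(1 - a N) * x N + (1 - a N) * b N * l N ^ k| * N
        ≤ (|(1 - a N) * x N| + |(1 - a N) * b N * l N ^ k|) * N := by
          gcongr; exact abs_add_le _ _
      _ = |(N : ℝ) * (1 - a N) * x N| + |(N : ℝ) * (1 - a N) * b N| * l N ^ k := by
          rw [abs_mul _ (l N ^ k), abs_of_nonneg hpk0, mul_assoc (N : ℝ), mul_assoc (N : ℝ),
            abs_mul (N : ℝ), abs_mul (N : ℝ), abs_of_pos h0']
          ring
      _ ≤ _ := by gcongr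
  · filter_upwards [hsol] with N hN k
    rw [hN]
  · have hlim : Tendsto (fun N : ℕ => (N : ℝ) * (1 - a N) * x N + (1 - a N) * x N
        + b N * ((l N ^ (N + 1) - 1) / r N)
        + C N * ((m N ^ (N + 1) - 1) / (m N - 1))) atTop
        (nhds (ρ * T * (1 / (p + 1)) + 0 * (1 / (p + 1))
          + 2 / ((p + 1) * (p - 1) * E) * ((E - 1) / r0)
          + (1 - m0) * ((1 + p * E) / (p * (p + 1) * E)) * ((0 - 1) / (m0 - 1)))) := by
      refine ((hNA.add (heT.mul hxT)).add (hbT.mul ((hlN1.sub_const 1).div hrT (by linarith)))).add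
        (hCT.mul ((hmN1.sub_const 1).div (hmT.sub_const 1) n2))
    have e : ρ * T * (1 / (p + 1)) + 0 * (1 / (p + 1))
          + 2 / ((p + 1) * (p - 1) * E) * ((E - 1) / r0)
          + (1 - m0) * ((1 + p * E) / (p * (p + 1) * E)) * ((0 - 1) / (m0 - 1))
        = (p * ((ρ * T + 1) * (p + 1) + 2) * E - (p - 1)) / (p * (p + 1) ^ 2 * E) := by
      rw [show (0 - 1) / (m0 - 1) = 1 / (1 - m0) by rw [← neg_sub 1 m0, zero_sub, neg_div_neg_eq], hr0]
      field_simp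
      ring
    rw [e] at hlim
    refine hlim.congr' ?_
    filter_upwards [hsol, hmT.eventually_lt_const hm1, eventually_gt_atTop 0,
      hrT.eventually_const_lt (show 0 < r0 by linarith)] with N hN hmlt h0 hrpos
    have ha1 : a N < 1 := av_lt ρ T hρ hT N h0
    have he : 1 - a N ≠ 0 := by linarith
    have hl1 : l N ≠ 1 := by
      have : 0 < (1 - a N) * r N := mul_pos (by linarith) hrpos
      simp only [hl]; linarith
    have hl2 : l N - 1 = (1 - a N) * r N := by simp only [hl]; ring
    rw [hN, Fin.sum_univ_eq_sum_range (fun k => (1 - a N) * x N + (1 - a N) * b N * l N ^ k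
      + C N * m N ^ k), Finset.sum_add_distrib, Finset.sum_add_distrib,
      Finset.sum_const, Finset.card_range, nsmul_eq_mul, ← Finset.mul_sum, ← Finset.mul_sum,
      geom_sum_eq hmlt.ne, geom_sum_eq hl1, hl2]
    push_cast
    have : (1 - a N) * b N * ((l N ^ (N + 1) - 1) / ((1 - a N) * r N))
        = b N * ((l N ^ (N + 1) - 1) / r N) := by
      have := hrpos.ne'
      field_simp
    rw [this]
    ring

/-- The cumulative instantaneous costs over the initial window `{1,…,m_N}` (paper indexing,
with `m_N = ⌈cN⌉`) converge to the initial block cost `𝓑₀`, and those over the terminal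
window `{m_N+1,…,N+1}` converge to the terminal block cost `𝓑_T`; the limits depend on
neither `c ∈ (0,1)` nor `θ > 0`. -/
theorem stmt13 (n : ℕ) (hn : 2 ≤ n) (ρ T θ : ℝ) (hρ : 0 < ρ) (hT : 0 < T) (hθ : 0 < θ)
    (x : Fin n → ℝ) (xb : ℝ) (hxb : xb = (∑ j, x j) / (n : ℝ))
    (c : ℝ) (hc0 : 0 < c) (hc1 : c < 1)
    (E D : ℝ)
    (hE : E = Real.exp (ρ * T * ((n : ℝ) + 1) / ((n : ℝ) - 1)))
    (hD : D = (n : ℝ) * ((ρ * T + 1) * ((n : ℝ) + 1) + 2) * E - ((n : ℝ) - 1)) :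
    ∀ i : Fin n,
      Tendsto
        (fun N : ℕ => θ * ∑ k : Fin (N + 1),
          (if k.val < ⌈c * (N : ℝ)⌉₊ then (xiN n N ρ T θ x i k) ^ 2 else 0))
        atTop
        (nhds (((n : ℝ) - 1) * ((n : ℝ) + 1) ^ 2 * (1 + (n : ℝ) * E) ^ 2 * xb ^ 2
          / (4 * D ^ 2))) ∧
      Tendsto
        (fun N : ℕ => θ * ∑ k : Fin (N + 1),
          (if ⌈c * (N : ℝ)⌉₊ ≤ k.val then (xiN n N ρ T θ x i k) ^ 2 else 0))
        atTop
        (nhds ((x i - xb) ^ 2 / (4 * (ρ * T + 1) ^ 2))) := by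

  intro i
  have hp : (1 : ℝ) < n := by exact_mod_cast hn
  have hE0 : 1 < E := by
    rw [hE, Real.one_lt_exp_iff]
    have : 0 < (n : ℝ) - 1 := by linarith
    positivity
  obtain ⟨s1, K1, C, m, h1, h2, h3, h4, h5, h6⟩ := nu_asymp n hn ρ T θ hρ hT hθ E hE
  obtain ⟨s2, K2, G, q, g1, g2, g3, g4, g5, g6⟩ := om_asymp ρ T θ hρ hT hθ
  rw [← hD] at h6
  have hD0 : 0 < D := by
    have : (n : ℝ) * ((ρ * T + 1) * ((n : ℝ) + 1) + 2) * E ≥ n * 1 * 1 := by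
      gcongr
      nlinarith [mul_pos hρ hT]
    rw [hD]; linarith
  have hS1 : D / ((n : ℝ) * (n + 1) ^ 2 * E) ≠ 0 := by positivity
  have hS2 : ρ * T + 1 ≠ 0 := by positivity
  have hα : Tendsto (fun N => xb * (1 / ∑ k, nuN n N ρ T θ k)) atTop
      (nhds (xb * (1 / (D / ((n : ℝ) * (n + 1) ^ 2 * E))))) :=
    (tendsto_const_nhds.div h6 hS1).const_mul xb
  have hβ : Tendsto (fun N => (x i - xb) * (1 / ∑ k, omN N ρ T θ k)) atTop
      (nhds ((x i - xb) * (1 / (ρ * T + 1)))) :=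
    (tendsto_const_nhds.div g6 hS2).const_mul _
  set α : ℕ → ℝ := fun N => xb * (1 / ∑ k, nuN n N ρ T θ k) with hαd
  set β : ℕ → ℝ := fun N => (x i - xb) * (1 / ∑ k, omN N ρ T θ k) with hβd
  set α0 := xb * (1 / (D / ((n : ℝ) * (n + 1) ^ 2 * E))) with hα0
  set β0 := (x i - xb) * (1 / (ρ * T + 1)) with hβ0
  have hs : ∀ᶠ N in atTop, ∀ k, k ≤ N → |α N * s1 N k + β N * s2 N k|
      ≤ ((|α0| + 1) * K1 + (|β0| + 1) * K2) / N := by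
    filter_upwards [h1, g1, hα.abs.eventually_lt_const (lt_add_one _),
      hβ.abs.eventually_lt_const (lt_add_one _)] with N k1 k2 k3 k4 k hk
    calc |α N * s1 N k + β N * s2 N k| ≤ |α N| * |s1 N k| + |β N| * |s2 N k| := by
          rw [← abs_mul, ← abs_mul]; exact abs_add_le _ _
      _ ≤ (|α0| + 1) * (K1 / N) + (|β0| + 1) * (K2 / N) := by
          gcongr
          · exact k1 k hk
          · exact k2 k hk
      _ = _ := by ring
  have hξ : ∀ᶠ N in atTop, ∀ k : Fin (N + 1), xiN n N ρ T θ x i k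
      = (α N * s1 N k + β N * s2 N k) + (α N * C N) * m N ^ k.val + (β N * G N) * q N ^ (N - k.val) := by
    filter_upwards [h2, g2] with N k1 k2 k
    simp only [xiN, vN, wN, Pi.add_apply, Pi.smul_apply, smul_eq_mul, ← hxb]
    rw [k1 k, k2 k]
    simp only [hαd, hβd]
    ring
  obtain ⟨w1, w2⟩ := both_windows (fun N => xiN n N ρ T θ x i)
    (fun N k => α N * s1 N k + β N * s2 N k) _ hs _ m _ q _ _ _ _ (hα.mul h3) h4 h5 (hβ.mul g3) g4 g5
    hξ c hc0 hc1
  have hp0 : (n : ℝ) ≠ 0 := by linarith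
  have hp2 : (n : ℝ) + 1 ≠ 0 := by linarith
  have hE1 : E ≠ 0 := by linarith
  have hD1 : D ≠ 0 := hD0.ne'
  constructor
  · have := w1.const_mul θ
    convert this using 2
    have hz : 4 * θ + ((n : ℝ) - 1) ≠ 0 := by linarith
    have hu : 1 - (4 * θ - ((n : ℝ) - 1)) / (4 * θ + ((n : ℝ) - 1))
        = 2 * ((n : ℝ) - 1) / (4 * θ + ((n : ℝ) - 1)) := by field_simp; ring
    have hu2 : 1 - ((4 * θ - ((n : ℝ) - 1)) / (4 * θ + ((n : ℝ) - 1))) ^ 2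
        = 16 * θ * ((n : ℝ) - 1) / (4 * θ + ((n : ℝ) - 1)) ^ 2 := by field_simp; ring
    have hp1 : (n : ℝ) - 1 ≠ 0 := by linarith
    rw [hu, hu2, hα0]
    generalize 4 * θ + ((n : ℝ) - 1) = Z at hz
    generalize (n : ℝ) - 1 = Y at hp1
    generalize (1 + (n : ℝ) * E) = X
    field_simp
    ring
  · have := w2.const_mul θ
    convert this using 2
    have hz : 1 / 2 + 2 * θ ≠ 0 := by positivity
    have hu2 : 1 - (1 - 1 / (1 / 2 + 2 * θ)) ^ 2 = 4 * θ / (1 / 2 + 2 * θ) ^ 2 := by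
      field_simp; ring
    rw [hu2, hβ0]
    generalize 1 / 2 + 2 * θ = Z at hz
    field_simp
end
end
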